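/- Let S be a closed surface not homeomorphic to the 2-sphere. Then the fundamental group π_1(S) is surface-like: there exist classes α, β ∈ H^1(π_1(S); Z/2) with α ∪ β ≠ 0 in H^2(π_1(S); Z/2). -/

import Mathlib

noncomputable section

/-- A group `T` is *surface-like* if there exist classes `α, β ∈ H¹(T; ℤ/2)` with
`α ∪ β ≠ 0` in `H²(T; ℤ/2)` (group cohomology with trivial `ℤ/2`-coefficients).
Explicitly, in terms of inhomogeneous group cochains: there are homomorphisms
`φ, ψ : T → ℤ/2` (these are exactly the `1`-cocycles, and they represent `H¹`
faithfully since every `1`-coboundary is trivial) whose cup product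
`(a, b) ↦ φ(a) · ψ(b)` is not the coboundary `(a, b) ↦ f(a) + f(b) + f(ab)`
of any `1`-cochain `f : T → ℤ/2`. -/
def IsSurfaceLike (T : Type*) [Group T] : Prop :=
  ∃ φ ψ : T → ZMod 2,
    (∀ a b : T, φ (a * b) = φ a + φ b) ∧
    (∀ a b : T, ψ (a * b) = ψ a + ψ b) ∧
    ∀ f : T → ZMod 2, ∃ a b : T, φ a * ψ b ≠ f a + f b + f (a * b)

end

set_option linter.unusedSectionVars false
set_option linter.unusedVariables false

open Set Filter Topology Metric unitInterval

section Cocycles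

variable {X Y : Type*}

/-- `c` satisfies the (Alexander–Spanier) 1-cocycle identity on small sets of `l`. -/
def CocF (c : X → X → ZMod 2) (l : Filter X) : Prop :=
  ∀ᶠ V in l.smallSets, ∀ y ∈ V, ∀ z ∈ V, ∀ w ∈ V, c y z + c z w = c y w

/-- `c` is the coboundary of `s` on small sets of `l`. -/
def SecF (c : X → X → ZMod 2) (s : X → ZMod 2) (l : Filter X) : Prop :=
  ∀ᶠ V in l.smallSets, ∀ y ∈ V, ∀ z ∈ V, c y z = s y + s z

def pull (f : Y → X) (c : X → X → ZMod 2) : Y → Y → ZMod 2 := fun y z => c (f y) (f z)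

theorem zmod_add_self (a : ZMod 2) : a + a = 0 := CharTwo.add_self_eq_zero a

theorem zmod_eq_iff {a b : ZMod 2} : a = b ↔ a + b = 0 := by
  revert a b; decide

theorem zmod_cases (a : ZMod 2) : a = 0 ∨ a = 1 := by
  revert a; decide

theorem cocF_iff {c : X → X → ZMod 2} {l : Filter X} :
    CocF c l ↔ ∃ V ∈ l, ∀ y ∈ V, ∀ z ∈ V, ∀ w ∈ V, c y z + c z w = c y w :=
  eventually_smallSets' fun _ _ h H y hy z hz w hw => H y (h hy) z (h hz) w (h hw)

theorem secF_iff {c : X → X → ZMod 2} {s : X → ZMod 2} {l : Filter X} :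
    SecF c s l ↔ ∃ V ∈ l, ∀ y ∈ V, ∀ z ∈ V, c y z = s y + s z :=
  eventually_smallSets' fun _ _ h H y hy z hz => H y (h hy) z (h hz)

theorem SecF.mono {c : X → X → ZMod 2} {s : X → ZMod 2} {l l' : Filter X} (h : SecF c s l)
    (hl : l' ≤ l) : SecF c s l' := h.filter_mono (monotone_smallSets hl)

theorem SecF.cocF {c : X → X → ZMod 2} {s : X → ZMod 2} {l : Filter X} (h : SecF c s l) :
    CocF c l := by
  filter_upwards [h] with V h y hy z hz w hw
  rw [h y hy z hz, h z hz w hw, h y hy w hw]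
  linear_combination zmod_add_self (s z)

theorem CocF.pull {c : X → X → ZMod 2} {l : Filter X} (h : CocF c l) {f : Y → X} {m : Filter Y}
    (hf : Tendsto f m l) : CocF (pull f c) m := by
  obtain ⟨V, hV, H⟩ := cocF_iff.1 h
  exact cocF_iff.2 ⟨f ⁻¹' V, hf hV, fun y hy z hz w hw => H _ hy _ hz _ hw⟩

theorem SecF.pull {c : X → X → ZMod 2} {s : X → ZMod 2} {l : Filter X} (h : SecF c s l)
    {f : Y → X} {m : Filter Y} (hf : Tendsto f m l) : SecF (pull f c) (s ∘ f) m := by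
  obtain ⟨V, hV, H⟩ := secF_iff.1 h
  exact secF_iff.2 ⟨f ⁻¹' V, hf hV, fun y hy z hz => H _ hy _ hz⟩

theorem CocF.add {c d : X → X → ZMod 2} {l : Filter X} (h : CocF c l) (h' : CocF d l) :
    CocF (c + d) l := by
  filter_upwards [h, h'] with V h h' y hy z hz w hw
  simp only [Pi.add_apply]
  linear_combination h y hy z hz w hw + h' y hy z hz w hw

theorem SecF.add {c d : X → X → ZMod 2} {s t : X → ZMod 2} {l : Filter X} (h : SecF c s l)
    (h' : SecF d t l) : SecF (c + d) (s + t) l := by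
  filter_upwards [h, h'] with V h h' y hy z hz
  simp only [Pi.add_apply]
  linear_combination h y hy z hz + h' y hy z hz

/-- The coboundary of a 0-cochain. -/
def cobd (s : X → ZMod 2) : X → X → ZMod 2 := fun y z => s y + s z

theorem secF_cobd (s : X → ZMod 2) (l : Filter X) : SecF (cobd s) s l :=
  Eventually.of_forall fun _ _ _ _ _ => rfl

theorem cocF_zero (l : Filter X) : CocF (0 : X → X → ZMod 2) l :=
  Eventually.of_forall fun _ _ _ _ _ _ _ => by simp

theorem CocF.congr {c d : X → X → ZMod 2} {l : Filter X} (h : CocF c l)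
    (e : ∀ᶠ V in l.smallSets, ∀ y ∈ V, ∀ z ∈ V, c y z = d y z) : CocF d l := by
  filter_upwards [h, e] with V h e y hy z hz w hw
  rw [← e y hy z hz, ← e z hz w hw, ← e y hy w hw, h y hy z hz w hw]

theorem SecF.congr {c d : X → X → ZMod 2} {s : X → ZMod 2} {l : Filter X} (h : SecF c s l)
    (e : ∀ᶠ V in l.smallSets, ∀ y ∈ V, ∀ z ∈ V, c y z = d y z) : SecF d s l := by
  filter_upwards [h, e] with V h e y hy z hz
  rw [← e y hy z hz, h y hy z hz]

theorem SecF.congr' {c : X → X → ZMod 2} {s t : X → ZMod 2} {l : Filter X} (h : SecF c s l)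
    (e : ∀ᶠ y in l, s y = t y) : SecF c t l := by
  filter_upwards [h, e.smallSets] with V h e y hy z hz
  rw [h y hy z hz, e y hy, e z hz]

theorem CocF.self {c : X → X → ZMod 2} {l : Filter X} (h : CocF c l) : ∀ᶠ y in l, c y y = 0 := by
  obtain ⟨V, hV, H⟩ := cocF_iff.1 h
  filter_upwards [hV] with y hy
  have := H y hy y hy y hy
  rw [zmod_add_self] at this
  exact this.symm

variable [TopologicalSpace X] [TopologicalSpace Y]

def Coc (c : X → X → ZMod 2) (U : Set X) : Prop := ∀ x ∈ U, CocF c (𝓝 x)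

def SecOn (c : X → X → ZMod 2) (s : X → ZMod 2) (K : Set X) : Prop :=
  ∀ x ∈ K, SecF c s (𝓝[K] x)

def Triv (c : X → X → ZMod 2) (K : Set X) : Prop := ∃ s, SecOn c s K

theorem Coc.mono {c : X → X → ZMod 2} {U V : Set X} (h : Coc c U) (hV : V ⊆ U) : Coc c V :=
  fun x hx => h x (hV hx)

theorem SecOn.mono {c : X → X → ZMod 2} {s : X → ZMod 2} {U V : Set X} (h : SecOn c s U)
    (hV : V ⊆ U) : SecOn c s V := fun x hx => (h x (hV hx)).mono (nhdsWithin_mono _ hV)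

theorem Triv.mono {c : X → X → ZMod 2} {U V : Set X} (h : Triv c U)
    (hV : V ⊆ U) : Triv c V := h.imp fun _ h => h.mono hV

theorem Coc.add {c d : X → X → ZMod 2} {U : Set X} (h : Coc c U) (h' : Coc d U) :
    Coc (c + d) U := fun x hx => (h x hx).add (h' x hx)

theorem SecOn.add {c d : X → X → ZMod 2} {s t : X → ZMod 2} {U : Set X} (h : SecOn c s U)
    (h' : SecOn d t U) : SecOn (c + d) (s + t) U := fun x hx => (h x hx).add (h' x hx)

theorem Triv.add {c d : X → X → ZMod 2} {U : Set X} (h : Triv c U) (h' : Triv d U) :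
    Triv (c + d) U := by
  obtain ⟨s, hs⟩ := h
  obtain ⟨t, ht⟩ := h'
  exact ⟨_, hs.add ht⟩

theorem secOn_cobd (s : X → ZMod 2) (K : Set X) : SecOn (cobd s) s K := fun _ _ => secF_cobd _ _

theorem coc_cobd (s : X → ZMod 2) (K : Set X) : Coc (cobd s) K := fun _ _ => (secF_cobd _ _).cocF

theorem coch_add_self (c : X → X → ZMod 2) : c + c = 0 := by
  funext x y; exact zmod_add_self _

theorem coch_add_cancel (c d : X → X → ZMod 2) : c + d + d = c := by
  rw [add_assoc, coch_add_self, add_zero]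

theorem triv_zero (K : Set X) : Triv (0 : X → X → ZMod 2) K :=
  ⟨0, fun _ _ => Eventually.of_forall fun _ _ _ _ _ => by simp⟩

/-- Sections over a preconnected set differ by a constant. -/
theorem SecOn.unique {c : X → X → ZMod 2} {s t : X → ZMod 2} {K : Set X} (hs : SecOn c s K)
    (ht : SecOn c t K) (hK : IsPreconnected K) : ∃ k, ∀ x ∈ K, t x = s x + k := by
  have hc : ContinuousOn (fun x => s x + t x) K := by
    intro x hx
    obtain ⟨V, hV, H⟩ := secF_iff.1 (hs x hx)
    obtain ⟨V', hV', H'⟩ := secF_iff.1 (ht x hx)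
    refine ContinuousWithinAt.congr_of_eventuallyEq (f := fun _ => s x + t x)
      continuousWithinAt_const ?_ rfl
    filter_upwards [hV, hV'] with y hy hy'
    have h1 := H y hy x (mem_of_mem_nhdsWithin hx hV)
    have h2 := H' y hy' x (mem_of_mem_nhdsWithin hx hV')
    rw [h1] at h2
    revert h2
    generalize s y = a, s x = b, t y = c, t x = d
    revert a b c d; decide
  rcases K.eq_empty_or_nonempty with rfl | ⟨x0, hx0⟩
  · exact ⟨0, by simp⟩
  refine ⟨s x0 + t x0, fun x hx => ?_⟩
  have := hK.constant hc hx hx0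
  rw [← this, ← add_assoc, zmod_add_self, zero_add]

theorem SecOn.add_const {c : X → X → ZMod 2} {s : X → ZMod 2} {K : Set X} (h : SecOn c s K)
    (k : ZMod 2) : SecOn c (fun x => s x + k) K := fun x hx => by
  filter_upwards [h x hx] with V h y hy z hz
  rw [h y hy z hz]
  linear_combination - zmod_add_self k

theorem SecOn.congr {c : X → X → ZMod 2} {s t : X → ZMod 2} {K : Set X} (h : SecOn c s K)
    (e : ∀ x ∈ K, s x = t x) : SecOn c t K := fun x hx =>
  (h x hx).congr' (eventually_of_mem self_mem_nhdsWithin e)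

theorem SecOn.closed_union {c : X → X → ZMod 2} {s : X → ZMod 2} {A B : Set X} (hA : IsClosed A)
    (hB : IsClosed B) (h1 : SecOn c s A) (h2 : SecOn c s B) (hc : Coc c (A ∩ B)) :
    SecOn c s (A ∪ B) := by
  intro x hx
  rw [nhdsWithin_union]
  by_cases hxA : x ∈ A
  · by_cases hxB : x ∈ B
    · obtain ⟨V, hV, H⟩ := secF_iff.1 (h1 x hxA)
      obtain ⟨V', hV', H'⟩ := secF_iff.1 (h2 x hxB)
      obtain ⟨W, hW, K⟩ := cocF_iff.1 (hc x ⟨hxA, hxB⟩)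
      have hxV := mem_of_mem_nhdsWithin hxA hV
      have hxV' := mem_of_mem_nhdsWithin hxB hV'
      have hxW := mem_of_mem_nhds hW
      refine secF_iff.2 ⟨(V ∪ V') ∩ W, ⟨?_, ?_⟩, ?_⟩
      · exact inter_mem (mem_of_superset hV subset_union_left) (mem_nhdsWithin_of_mem_nhds hW)
      · exact inter_mem (mem_of_superset hV' subset_union_right) (mem_nhdsWithin_of_mem_nhds hW)
      · rintro y ⟨hy, hyW⟩ z ⟨hz, hzW⟩
        rw [← K y hyW x hxW z hzW]
        have e1 : c y x = s y + s x := hy.elim (fun h => H y h x hxV) (fun h => H' y h x hxV')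
        have e2 : c x z = s x + s z := hz.elim (fun h => H x hxV z h) (fun h => H' x hxV' z h)
        rw [e1, e2]
        linear_combination zmod_add_self (s x)
    · have : 𝓝[B] x = ⊥ := by
        rwa [← not_neBot, ← mem_closure_iff_nhdsWithin_neBot, hB.closure_eq]
      rw [this, sup_bot_eq]
      exact h1 x hxA
  · have hxB := hx.resolve_left hxA
    have : 𝓝[A] x = ⊥ := by
      rwa [← not_neBot, ← mem_closure_iff_nhdsWithin_neBot, hA.closure_eq]
    rw [this, bot_sup_eq]
    exact h2 x hxB

/-- Sections over two closed sets with connected intersection can be glued. -/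
theorem SecOn.closed_glue {c : X → X → ZMod 2} {s : X → ZMod 2} {A B : Set X} (hA : IsClosed A)
    (hB : IsClosed B) (h1 : SecOn c s A) (h2 : Triv c B) (hc : Coc c (A ∩ B))
    (hAB : IsPreconnected (A ∩ B)) : ∃ t, SecOn c t (A ∪ B) ∧ ∀ x ∈ A, t x = s x := by
  classical
  obtain ⟨t, ht⟩ := h2
  obtain ⟨k, hk⟩ := (ht.mono inter_subset_right).unique (h1.mono inter_subset_left) hAB
  refine ⟨A.piecewise s (fun x => t x + k), SecOn.closed_union hA hB ?_ ?_ hc, ?_⟩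
  · exact h1.congr fun x hx => by simp [hx]
  · refine (ht.add_const k).congr fun x hx => ?_
    by_cases hxA : x ∈ A
    · simp [hxA, hk x ⟨hxA, hx⟩]
    · simp [hxA]
  · intro x hx; simp [hx]

theorem Triv.closed_glue {c : X → X → ZMod 2} {A B : Set X} (hA : IsClosed A)
    (hB : IsClosed B) (h1 : Triv c A) (h2 : Triv c B) (hc : Coc c (A ∩ B))
    (hAB : IsPreconnected (A ∩ B)) : Triv c (A ∪ B) := by
  obtain ⟨s, hs⟩ := h1
  obtain ⟨t, ht, -⟩ := hs.closed_glue hA hB h2 hc hAB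
  exact ⟨t, ht⟩

theorem SecOn.of_open {c : X → X → ZMod 2} {s : X → ZMod 2} {K : Set X}
    (h : ∀ x ∈ K, ∃ U, IsOpen U ∧ x ∈ U ∧ ∃ t, SecOn c t (U ∩ K) ∧ ∀ y ∈ U ∩ K, t y = s y) :
    SecOn c s K := by
  intro x hx
  obtain ⟨U, hU, hxU, t, ht, e⟩ := h x hx
  have := (ht.congr e) x ⟨hxU, hx⟩
  rwa [inter_comm, nhdsWithin_inter_of_mem' (mem_nhdsWithin_of_mem_nhds (hU.mem_nhds hxU))] at this

theorem SecOn.open_union {c : X → X → ZMod 2} {s : X → ZMod 2} {A B : Set X} (hA : IsOpen A)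
    (hB : IsOpen B) (h1 : SecOn c s A) (h2 : SecOn c s B) : SecOn c s (A ∪ B) :=
  SecOn.of_open fun x hx => hx.elim
    (fun h => ⟨A, hA, h, s, h1.mono inter_subset_left, fun _ _ => rfl⟩)
    (fun h => ⟨B, hB, h, s, h2.mono inter_subset_left, fun _ _ => rfl⟩)

theorem Triv.open_glue {c : X → X → ZMod 2} {A B : Set X} (hA : IsOpen A)
    (hB : IsOpen B) (h1 : Triv c A) (h2 : Triv c B)
    (hAB : IsPreconnected (A ∩ B)) : Triv c (A ∪ B) := by
  classical
  obtain ⟨s, h1⟩ := h1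
  obtain ⟨t, ht⟩ := h2
  obtain ⟨k, hk⟩ := (ht.mono inter_subset_right).unique (h1.mono inter_subset_left) hAB
  refine ⟨A.piecewise s (fun x => t x + k), SecOn.open_union hA hB ?_ ?_⟩
  · exact h1.congr fun x hx => by simp [hx]
  · refine (ht.add_const k).congr fun x hx => ?_
    by_cases hxA : x ∈ A
    · simp [hxA, hk x ⟨hxA, hx⟩]
    · simp [hxA]

theorem Coc.pull {c : X → X → ZMod 2} {U : Set X} (h : Coc c U) {f : Y → X} {L : Set Y}
    (hf : Continuous f) (hL : MapsTo f L U) : Coc (pull f c) L :=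
  fun y hy => (h (f y) (hL hy)).pull hf.continuousAt

theorem SecOn.pull {c : X → X → ZMod 2} {s : X → ZMod 2} {K : Set X} (h : SecOn c s K)
    {f : Y → X} {L : Set Y} (hf : ContinuousOn f L) (hL : MapsTo f L K) :
    SecOn (pull f c) (s ∘ f) L :=
  fun y hy => (h (f y) (hL hy)).pull ((hf y hy).tendsto_nhdsWithin hL)

theorem Triv.pull {c : X → X → ZMod 2} {K : Set X} (h : Triv c K)
    {f : Y → X} {L : Set Y} (hf : ContinuousOn f L) (hL : MapsTo f L K) :
    Triv (pull f c) L := by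
  obtain ⟨s, hs⟩ := h
  exact ⟨_, hs.pull hf hL⟩

theorem Triv.push {c : X → X → ZMod 2} {f : Y → X} (hf : IsEmbedding f) {K : Set Y}
    (h : Triv (_root_.pull f c) K) : Triv c (f '' K) := by
  obtain ⟨s, hs⟩ := h
  rcases isEmpty_or_nonempty Y with hY | hY
  · refine ⟨0, ?_⟩
    rintro _ ⟨y, -, -⟩
    exact hY.elim y
  refine ⟨s ∘ Function.invFun f, ?_⟩
  rintro _ ⟨y, hy, rfl⟩
  obtain ⟨V, hV, H⟩ := secF_iff.1 (hs y hy)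
  rw [← hf.map_nhdsWithin_eq]
  refine secF_iff.2 ⟨f '' V, image_mem_map hV, ?_⟩
  rintro _ ⟨z, hz, rfl⟩ _ ⟨w, hw, rfl⟩
  simpa [Function.leftInverse_invFun hf.injective _, _root_.pull] using H z hz w hw

/-- A cocycle is trivial on a set on which the cocycle identity holds globally. -/
theorem triv_of_global {c : X → X → ZMod 2} {K V : Set X} (hK : K ⊆ V)
    (h : ∀ y ∈ V, ∀ z ∈ V, ∀ w ∈ V, c y z + c z w = c y w) : Triv c K := by
  rcases K.eq_empty_or_nonempty with rfl | ⟨x0, hx0⟩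
  · exact ⟨0, by simp [SecOn]⟩
  refine ⟨fun y => c y x0, fun x hx => secF_iff.2 ⟨K, self_mem_nhdsWithin, fun y hy z hz => ?_⟩⟩
  have h1 := h z (hK hz) x0 (hK hx0) z (hK hz)
  have h2 := h z (hK hz) z (hK hz) z (hK hz)
  rw [← h y (hK hy) x0 (hK hx0) z (hK hz)]
  revert h1 h2
  generalize c z x0 = a, c x0 z = b, c z z = d, c y x0 = e
  revert a b d e; decide

theorem triv_Icc {c : ℝ → ℝ → ZMod 2} {a b : ℝ} (hab : a ≤ b) (h : Coc c (Icc a b)) :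
    Triv c (Icc a b) := by
  have h' : ∀ x : Icc a b, ∃ V, IsOpen V ∧ x.1 ∈ V ∧
      ∀ y ∈ V, ∀ z ∈ V, ∀ w ∈ V, c y z + c z w = c y w := by
    intro x
    obtain ⟨V, hV, H⟩ := cocF_iff.1 (h x.1 x.2)
    obtain ⟨W, hWV, hW, hx⟩ := _root_.mem_nhds_iff.1 hV
    exact ⟨W, hW, hx, fun y hy z hz w hw => H y (hWV hy) z (hWV hz) w (hWV hw)⟩
  choose V hVo hVx hV using h'
  obtain ⟨t, ht0, htm, ⟨n, hn⟩, ht⟩ := exists_monotone_Icc_subset_open_cover_Icc hab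
    (c := fun i => (Subtype.val : Icc a b → ℝ) ⁻¹' (V i))
    (fun i => (hVo i).preimage continuous_subtype_val)
    (fun x _ => mem_iUnion.2 ⟨x, hVx x⟩)
  have key : ∀ m, Triv c (Icc a (t m : ℝ)) := by
    intro m
    induction m with
    | zero =>
      rw [ht0, Icc_self]
      refine triv_of_global (V := V ⟨a, left_mem_Icc.2 hab⟩) ?_ (hV _)
      rintro _ rfl
      exact hVx _
    | succ m ih =>
      obtain ⟨i, hi⟩ := ht m
      have h1 : Triv c (Icc (t m : ℝ) (t (m+1))) := by
        refine triv_of_global (V := V i) (fun x hx => ?_) (hV i)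
        exact hi (a := ⟨x, (t m).2.1.trans hx.1, hx.2.trans (t (m+1)).2.2⟩) ⟨hx.1, hx.2⟩
      have hle : (t m : ℝ) ≤ t (m+1) := htm m.le_succ
      have hI : Icc a (t m : ℝ) ∩ Icc (t m : ℝ) (t (m+1)) = {(t m : ℝ)} := by
        ext x
        simp only [mem_inter_iff, mem_Icc, mem_singleton_iff]
        have := (t m).2.1
        constructor
        · rintro ⟨⟨h1, h2⟩, h3, h4⟩
          exact le_antisymm h2 h3
        · rintro rfl
          exact ⟨⟨this, le_rfl⟩, le_rfl, hle⟩
      have := Triv.closed_glue isClosed_Icc isClosed_Icc ih h1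
        (h.mono fun x hx => by rw [hI] at hx; rw [mem_singleton_iff.1 hx]; exact (t m).2)
        (by rw [hI]; exact isPreconnected_singleton)
      rwa [Icc_union_Icc_eq_Icc (t m).2.1 hle] at this
  have := key n
  rwa [hn n le_rfl] at this

end Cocycles

section Metric

variable {X : Type*} [MetricSpace X]

theorem Coc.uniform {c : X → X → ZMod 2} {K : Set X} (hK : IsCompact K) (h : Coc c K) :
    ∃ δ > 0, ∀ x ∈ K, ∀ y ∈ ball x δ, ∀ z ∈ ball x δ, ∀ w ∈ ball x δ,
      c y z + c z w = c y w := by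
  have h' : ∀ x : K, ∃ V, IsOpen V ∧ x.1 ∈ V ∧
      ∀ y ∈ V, ∀ z ∈ V, ∀ w ∈ V, c y z + c z w = c y w := by
    intro x
    obtain ⟨V, hV, H⟩ := cocF_iff.1 (h x.1 x.2)
    obtain ⟨W, hWV, hW, hx⟩ := _root_.mem_nhds_iff.1 hV
    exact ⟨W, hW, hx, fun y hy z hz w hw => H y (hWV hy) z (hWV hz) w (hWV hw)⟩
  choose V hVo hVx hV using h'
  obtain ⟨δ, hδ, H⟩ := lebesgue_number_lemma_of_metric hK hVo
    (fun x hx => mem_iUnion.2 ⟨⟨x, hx⟩, hVx _⟩)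
  refine ⟨δ, hδ, fun x hx y hy z hz w hw => ?_⟩
  obtain ⟨i, hi⟩ := H x hx
  exact hV i y (hi hy) z (hi hz) w (hi hw)

theorem SecOn.uniform {c : X → X → ZMod 2} {s : X → ZMod 2} {K : Set X} (hK : IsCompact K)
    (h : SecOn c s K) :
    ∃ δ > 0, ∀ x ∈ K, ∀ y ∈ ball x δ ∩ K, ∀ z ∈ ball x δ ∩ K, c y z = s y + s z := by
  have h' : ∀ x : K, ∃ V, IsOpen V ∧ x.1 ∈ V ∧
      ∀ y ∈ V ∩ K, ∀ z ∈ V ∩ K, c y z = s y + s z := by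
    intro x
    obtain ⟨V, hV, H⟩ := secF_iff.1 (h x.1 x.2)
    obtain ⟨W, hW, hx, hWV⟩ := mem_nhdsWithin.1 hV
    exact ⟨W, hW, hx, fun y hy z hz => H y (hWV hy) z (hWV hz)⟩
  choose V hVo hVx hV using h'
  obtain ⟨δ, hδ, H⟩ := lebesgue_number_lemma_of_metric hK hVo
    (fun x hx => mem_iUnion.2 ⟨⟨x, hx⟩, hVx _⟩)
  refine ⟨δ, hδ, fun x hx y hy z hz => ?_⟩
  obtain ⟨i, hi⟩ := H x hx
  exact hV i y ⟨hi hy.1, hy.2⟩ z ⟨hi hz.1, hz.2⟩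

/-- A section over a compact set extends to a neighbourhood. -/
theorem SecOn.extend {c : X → X → ZMod 2} {s : X → ZMod 2} {K : Set X} (hK : IsCompact K)
    (hc : Coc c K) (h : SecOn c s K) :
    ∃ δ > 0, ∃ t, SecOn c t (thickening δ K) ∧ ∀ x ∈ K, t x = s x := by
  classical
  obtain ⟨δ₁, hδ₁, H₁⟩ := hc.uniform hK
  obtain ⟨δ₂, hδ₂, H₂⟩ := h.uniform hK
  set δ := min δ₁ δ₂ with hδd
  have hδ : 0 < δ := lt_min hδ₁ hδ₂
  have : ∀ y, ∃ p, y ∈ thickening (δ / 4) K → p ∈ K ∧ dist y p < δ / 4 := by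
    intro y
    by_cases hy : y ∈ thickening (δ / 4) K
    · obtain ⟨p, hp, h⟩ := mem_thickening_iff.1 hy
      exact ⟨p, fun _ => ⟨hp, h⟩⟩
    · exact ⟨y, fun h => (hy h).elim⟩
  choose p hp using this
  refine ⟨δ / 4, by positivity, fun y => c y (p y) + s (p y), ?_, ?_⟩
  · intro y0 hy0
    refine secF_iff.2 ⟨ball y0 (δ / 4) ∩ thickening (δ / 4) K,
      inter_mem (mem_nhdsWithin_of_mem_nhds (ball_mem_nhds _ (by positivity)))
        self_mem_nhdsWithin, ?_⟩
    rintro y ⟨hy, hyK⟩ z ⟨hz, hzK⟩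
    obtain ⟨a0, a1⟩ := hp y0 hy0
    obtain ⟨b0, b1⟩ := hp y hyK
    obtain ⟨c0, c1⟩ := hp z hzK
    rw [mem_ball] at hy hz
    have d1 : dist y (p y0) < δ := by linarith [dist_triangle y y0 (p y0)]
    have d2 : dist z (p y0) < δ := by linarith [dist_triangle z y0 (p y0)]
    have d3 : dist (p y) (p y0) < δ := by
      linarith [dist_triangle (p y) y (p y0), dist_triangle y y0 (p y0), dist_comm y (p y)]
    have d4 : dist (p z) (p y0) < δ := by
      linarith [dist_triangle (p z) z (p y0), dist_triangle z y0 (p y0), dist_comm z (p z)]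
    have l1 := min_le_left δ₁ δ₂
    have l2 := min_le_right δ₁ δ₂
    have e := H₂ (p y0) a0 (p y) ⟨by simpa using by linarith, b0⟩ (p z)
      ⟨by simpa using by linarith, c0⟩
    have m1 : y ∈ ball (p y0) δ₁ := by simpa using by linarith
    have m2 : z ∈ ball (p y0) δ₁ := by simpa using by linarith
    have m3 : p y ∈ ball (p y0) δ₁ := by simpa using by linarith
    have m4 : p z ∈ ball (p y0) δ₁ := by simpa using by linarith
    have e1 := H₁ (p y0) a0 y m1 (p y) m3 z m2
    have e2 := H₁ (p y0) a0 (p y) m3 (p z) m4 z m2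
    have e3 := H₁ (p y0) a0 z m2 (p z) m4 z m2
    have e4 := H₁ (p y0) a0 z m2 z m2 z m2
    revert e e1 e2 e3 e4
    generalize c y z = v1, c y (p y) = v2, c (p y) z = v3, c (p y) (p z) = v4, c (p z) z = v5,
      c z (p z) = v6, c z z = v7, s (p y) = v8, s (p z) = v9
    intro e e1 e2 e3 e4
    have e4' : v7 = 0 := by rw [zmod_add_self] at e4; exact e4.symm
    linear_combination -e1 - e2 + e + e4' - e3  + zmod_add_self v5 - 2 * e4'
  · intro x hx
    obtain ⟨b0, b1⟩ := hp x (self_subset_thickening (by positivity) K hx)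
    have l2 := min_le_right δ₁ δ₂
    have e := H₂ x hx x ⟨by simpa using hδ₂, hx⟩ (p x)
      ⟨by rw [mem_ball, dist_comm]; linarith, b0⟩
    simp only
    rw [e, add_assoc, zmod_add_self, add_zero]

theorem Triv.extend {c : X → X → ZMod 2} {K : Set X} (hK : IsCompact K)
    (hc : Coc c K) (h : Triv c K) : ∃ U, IsOpen U ∧ K ⊆ U ∧ Triv c U := by
  obtain ⟨s, hs⟩ := h
  obtain ⟨δ, hδ, t, ht, -⟩ := hs.extend hK hc
  exact ⟨_, isOpen_thickening, self_subset_thickening hδ K, t, ht⟩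

end Metric

section Star

variable {E : Type*} [NormedAddCommGroup E] [NormedSpace ℝ E]

theorem triv_segment {c : E → E → ZMod 2} (x y : E) (h : Coc c (segment ℝ x y)) :
    Triv c (segment ℝ x y) := by
  by_cases hxy : x = y
  · subst hxy
    rw [segment_same] at h ⊢
    obtain ⟨V, hV, H⟩ := cocF_iff.1 (h x rfl)
    refine triv_of_global (V := V) ?_ H
    rintro _ rfl
    exact mem_of_mem_nhds hV
  have hcont : Continuous (AffineMap.lineMap x y : ℝ → E) := AffineMap.lineMap_continuous
  have hm : MapsTo (AffineMap.lineMap x y : ℝ → E) (Icc 0 1) (segment ℝ x y) := by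
    rw [segment_eq_image_lineMap]; exact mapsTo_image _ _
  have h1 := triv_Icc zero_le_one (h.pull hcont hm)
  obtain ⟨s, hs⟩ := h1
  have hemb : IsEmbedding (AffineMap.lineMap x y : ℝ → E) := by
    have hd : 0 < dist x y := dist_pos.2 hxy
    have : AntilipschitzWith (Real.toNNReal (dist x y)⁻¹)
        (AffineMap.lineMap x y : ℝ → E) := by
      refine AntilipschitzWith.of_le_mul_dist fun a b => ?_
      rw [dist_lineMap_lineMap, Real.coe_toNNReal _ (by positivity)]
      field_simp
      exact le_rfl
    exact this.isEmbedding (lipschitzWith_lineMap x y).continuous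
  rw [segment_eq_image_lineMap]
  exact Triv.push hemb ⟨s, hs⟩

theorem triv_starConvex {c : E → E → ZMod 2} {U : Set E} (hU : IsOpen U) {x0 : E}
    (hx0 : x0 ∈ U) (hs : StarConvex ℝ x0 U) (hc : Coc c U) : Triv c U := by
  have hseg : ∀ x ∈ U, segment ℝ x0 x ⊆ U := fun x hx => hs.segment_subset hx
  have hsec : ∀ x, ∃ s, x ∈ U → SecOn c s (segment ℝ x0 x) ∧ s x0 = 0 := by
    intro x
    by_cases hx : x ∈ U
    · obtain ⟨s, h⟩ := triv_segment x0 x (hc.mono (hseg x hx))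
      exact ⟨_, fun _ => ⟨h.add_const (s x0), zmod_add_self _⟩⟩
    · exact ⟨0, fun h => (hx h).elim⟩
  choose s h using hsec
  have hcp : ∀ x, IsCompact (segment ℝ x0 x) := fun x => by
    rw [segment_eq_image_lineMap]
    exact isCompact_Icc.image AffineMap.lineMap_continuous
  refine ⟨fun x => s x x, SecOn.of_open fun x hx => ?_⟩
  obtain ⟨δ, hδ, t, ht, hts⟩ := (h x hx).1.extend (hcp x) (hc.mono (hseg x hx))
  have hball : ∀ y ∈ ball x δ, segment ℝ x0 y ⊆ thickening δ (segment ℝ x0 x) := by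
    intro y hy z hz
    rw [segment_eq_image_lineMap] at hz
    obtain ⟨r, hr, rfl⟩ := hz
    refine mem_thickening_iff.2 ⟨AffineMap.lineMap x0 x r, ?_, ?_⟩
    · rw [segment_eq_image_lineMap]; exact mem_image_of_mem _ hr
    · have : dist (AffineMap.lineMap x0 y r) (AffineMap.lineMap x0 x r) = r * dist y x := by
        rw [AffineMap.lineMap_apply, AffineMap.lineMap_apply, dist_vadd_cancel_right, vsub_eq_sub,
          vsub_eq_sub, dist_smul₀, dist_sub_right, Real.norm_of_nonneg hr.1]
      rw [this]
      have h2 : dist y x < δ := hy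
      nlinarith [hr.1, hr.2, dist_nonneg (x := y) (y := x)]
  refine ⟨ball x δ, isOpen_ball, mem_ball_self hδ, t, ?_, ?_⟩
  · exact ht.mono fun y hy => hball y hy.1 (right_mem_segment ℝ _ _)
  · rintro y ⟨hy, hyU⟩
    obtain ⟨k, hk⟩ := (h y hyU).1.unique (ht.mono (hball y hy))
      (convex_segment x0 y).isPreconnected
    have h0 := hk x0 (left_mem_segment ℝ _ _)
    rw [(h y hyU).2, hts x0 (left_mem_segment ℝ _ _), (h x hx).2, zero_add] at h0
    simpa [← h0] using hk y (right_mem_segment ℝ _ _)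

end Star

section Branching

variable {X Y : Type*} [TopologicalSpace X] [TopologicalSpace Y]

/-- `c` is trivial on a punctured neighbourhood of `v`. -/
def LTr (c : X → X → ZMod 2) (v : X) : Prop := ∃ V ∈ 𝓝 v, Triv c (V \ {v})

/-- `c` is a cocycle on a punctured neighbourhood of `v`. -/
def PCoc (c : X → X → ZMod 2) (v : X) : Prop := ∃ U ∈ 𝓝 v, Coc c (U \ {v})

open Classical in
/-- The branching number of `c` at `v`. -/
noncomputable def lam (c : X → X → ZMod 2) (v : X) : ZMod 2 := if LTr c v then 0 else 1

theorem lam_eq_zero {c : X → X → ZMod 2} {v : X} : lam c v = 0 ↔ LTr c v := by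
  unfold lam; split_ifs with h <;> simp [h]

theorem lam_eq_one {c : X → X → ZMod 2} {v : X} : lam c v = 1 ↔ ¬ LTr c v := by
  unfold lam; split_ifs with h <;> simp [h]

theorem lam_eq_of_iff {c : X → X → ZMod 2} {d : Y → Y → ZMod 2} {v : X} {w : Y}
    (h : LTr c v ↔ LTr d w) : lam c v = lam d w := by
  by_cases h2 : LTr d w
  · rw [lam_eq_zero.2 h2, lam_eq_zero.2 (h.2 h2)]
  · rw [lam_eq_one.2 h2, lam_eq_one.2 (mt h.1 h2)]

theorem LTr.add {c d : X → X → ZMod 2} {v : X} (h : LTr c v) (h' : LTr d v) : LTr (c + d) v := by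
  obtain ⟨V, hV, H⟩ := h
  obtain ⟨W, hW, K⟩ := h'
  exact ⟨V ∩ W, inter_mem hV hW, (H.mono (sdiff_subset_sdiff_left inter_subset_left)).add
    (K.mono (sdiff_subset_sdiff_left inter_subset_right))⟩

theorem lam_congr {c d : X → X → ZMod 2} {v : X} (h : LTr (c + d) v) : lam c v = lam d v := by
  have h1 : LTr c v ↔ LTr d v := by
    constructor
    · intro h'
      have := h'.add h
      rwa [← add_assoc, coch_add_self, zero_add] at this
    · intro h'
      have := h.add h'
      rwa [coch_add_cancel] at this
  exact lam_eq_of_iff h1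

theorem lt_cobd (s : X → ZMod 2) (v : X) : LTr (cobd s) v := ⟨univ, univ_mem, s, secOn_cobd _ _⟩

theorem CocF.lt {c : X → X → ZMod 2} {v : X} (h : CocF c (𝓝 v)) : LTr c v := by
  obtain ⟨V, hV, H⟩ := cocF_iff.1 h
  exact ⟨V, hV, triv_of_global sdiff_subset H⟩

theorem CocF.pcoc [T1Space X] {c : X → X → ZMod 2} {v : X} (h : CocF c (𝓝 v)) : PCoc c v := by
  obtain ⟨V, hV, H⟩ := cocF_iff.1 h
  obtain ⟨W, hWV, hW, hx⟩ := _root_.mem_nhds_iff.1 hV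
  exact ⟨W, hW.mem_nhds hx, fun x hx => cocF_iff.2 ⟨W, hW.mem_nhds hx.1,
    fun y hy z hz w hw => H y (hWV hy) z (hWV hz) w (hWV hw)⟩⟩

theorem PCoc.add {c d : X → X → ZMod 2} {v : X} (h : PCoc c v) (h' : PCoc d v) :
    PCoc (c + d) v := by
  obtain ⟨V, hV, H⟩ := h
  obtain ⟨W, hW, K⟩ := h'
  exact ⟨V ∩ W, inter_mem hV hW, (H.mono (sdiff_subset_sdiff_left inter_subset_left)).add
    (K.mono (sdiff_subset_sdiff_left inter_subset_right))⟩

theorem Coc.pcoc {c : X → X → ZMod 2} {U : Set X} {v : X} (hU : IsOpen U) (hv : v ∈ U)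
    (h : Coc c (U \ {v})) : PCoc c v := ⟨U, hU.mem_nhds hv, h⟩

theorem lt_pull {c : X → X → ZMod 2} {j : Y → X} (hj : IsOpenEmbedding j) {y : Y} :
    LTr (pull j c) y ↔ LTr c (j y) := by
  constructor
  · rintro ⟨V, hV, H⟩
    refine ⟨j '' V, hj.isOpenMap.image_mem_nhds hV, (H.push hj.isEmbedding).mono ?_⟩
    rintro _ ⟨⟨z, hz, rfl⟩, h⟩
    exact ⟨z, ⟨hz, fun h' => h (by rw [mem_singleton_iff.1 h']; rfl)⟩, rfl⟩
  · rintro ⟨V, hV, H⟩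
    refine ⟨j ⁻¹' V, hj.continuous.continuousAt hV, H.pull hj.continuous.continuousOn ?_⟩
    rintro z ⟨hz, hzy⟩
    exact ⟨hz, fun h => hzy (hj.injective h)⟩

theorem lam_pull {c : X → X → ZMod 2} {j : Y → X} (hj : IsOpenEmbedding j) {y : Y} :
    lam (pull j c) y = lam c (j y) :=
  lam_eq_of_iff (lt_pull hj)

theorem PCoc.pull {c : X → X → ZMod 2} {j : Y → X} (hj : Continuous j) (hi : Function.Injective j)
    {y : Y} (h : PCoc c (j y)) : PCoc (pull j c) y := by
  obtain ⟨V, hV, H⟩ := h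
  refine ⟨j ⁻¹' V, hj.continuousAt hV, H.pull hj ?_⟩
  rintro z ⟨hz, hzy⟩
  exact ⟨hz, fun h => hzy (hi h)⟩

theorem not_triv_of_two {c : X → X → ZMod 2} {K L : Set X} {s t : X → ZMod 2} {p q : X}
    (hK : IsPreconnected K) (hL : IsPreconnected L) (hs : SecOn c s K) (ht : SecOn c t L)
    (hp : p ∈ K ∩ L) (hq : q ∈ K ∩ L) (h : s p + s q ≠ t p + t q) : ¬ Triv c (K ∪ L) := by
  rintro ⟨r, hr⟩
  obtain ⟨k, hk⟩ := hs.unique (hr.mono subset_union_left) hK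
  obtain ⟨l, hl⟩ := ht.unique (hr.mono subset_union_right) hL
  have := hk p hp.1
  have := hk q hq.1
  have := hl p hp.2
  have := hl q hq.2
  exact h (by grind)

end Branching

section Plane

/-- Indicator of the closed upper half plane. -/
noncomputable def uH (z : ℂ) : ZMod 2 := if 0 ≤ z.im then 1 else 0

open Classical in
/-- The coboundary of `uH`, cut off to `Ω`. -/
noncomputable def slit (Ω : Set ℂ) : ℂ → ℂ → ZMod 2 :=
  fun x y => if x ∈ Ω then uH x + uH y else 0

theorem uH_eventually {z : ℂ} (hz : z.im ≠ 0) : ∀ᶠ w in 𝓝 z, uH w = uH z := by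
  rcases lt_or_gt_of_ne hz with h | h
  · filter_upwards [(isOpen_lt Complex.continuous_im continuous_const).mem_nhds h] with w hw
    have hw : w.im < 0 := hw
    simp [uH, not_le.2 h, not_le.2 hw]
  · filter_upwards [(isOpen_lt continuous_const Complex.continuous_im).mem_nhds h] with w hw
    have hw : 0 < w.im := hw
    simp [uH, h.le, hw.le]

theorem slit_zero_of_im {Ω : Set ℂ} {z : ℂ} (hz : z.im ≠ 0) : SecF (slit Ω) 0 (𝓝 z) := by
  filter_upwards [(uH_eventually hz).smallSets] with V hV y hy w hw
  simp [slit, hV y hy, hV w hw, zmod_add_self]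

theorem slit_uH_of_im {Ω : Set ℂ} {z : ℂ} (hz : z.im ≠ 0) : SecF (slit Ω) uH (𝓝 z) := by
  filter_upwards [(uH_eventually hz).smallSets] with V hV y hy w hw
  simp [slit, hV y hy, hV w hw, zmod_add_self]

theorem slit_zero {Ω : Set ℂ} {z : ℂ} (hz : z ∉ closure Ω) : SecF (slit Ω) 0 (𝓝 z) := by
  have : (closure Ω)ᶜ ∈ 𝓝 z := isClosed_closure.isOpen_compl.mem_nhds hz
  filter_upwards [Eventually.smallSets this] with V hV y hy w hw
  have : y ∉ Ω := fun h => hV y hy (subset_closure h)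
  simp [slit, this]

theorem slit_uH {Ω : Set ℂ} {z : ℂ} (hΩ : IsOpen Ω) (hz : z ∈ Ω) : SecF (slit Ω) uH (𝓝 z) := by
  filter_upwards [Eventually.smallSets (hΩ.mem_nhds hz)] with V hV y hy w hw
  have : y ∈ Ω := hV y hy
  simp [slit, this]

theorem secOn_of_nhds {X : Type*} [TopologicalSpace X] {c : X → X → ZMod 2} {s : X → ZMod 2}
    {K : Set X} (h : ∀ x ∈ K, SecF c s (𝓝 x)) : SecOn c s K :=
  fun x hx => (h x hx).mono nhdsWithin_le_nhds

theorem SecOn.secF {X : Type*} [TopologicalSpace X] {c : X → X → ZMod 2} {s : X → ZMod 2}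
    {K : Set X} (h : SecOn c s K) (hK : IsOpen K) {x : X} (hx : x ∈ K) : SecF c s (𝓝 x) := by
  have := h x hx
  rwa [hK.nhdsWithin_eq hx] at this

noncomputable def halfArc (e : ℝ) (v : ℂ) (r t : ℝ) : ℂ := v + ⟨e * √(r ^ 2 - t ^ 2), t⟩

theorem continuous_halfArc (e : ℝ) (v : ℂ) (r : ℝ) : Continuous (halfArc e v r) := by
  unfold halfArc
  refine continuous_const.add ?_
  have : (fun t : ℝ => (⟨e * √(r ^ 2 - t ^ 2), t⟩ : ℂ)) =
      fun t : ℝ => ((e * √(r ^ 2 - t ^ 2) : ℝ) : ℂ) + (t : ℂ) * Complex.I := by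
    funext t; apply Complex.ext <;> simp
  rw [this]
  fun_prop

theorem halfArc_mem {e : ℝ} (he : e ^ 2 = 1) (v : ℂ) {r t : ℝ} (hr : 0 < r)
    (ht : t ∈ Icc (-r) r) : halfArc e v r t ∈ sphere v r := by
  have h0 : 0 ≤ r ^ 2 - t ^ 2 := by nlinarith [ht.1, ht.2]
  rw [mem_sphere_iff_norm, halfArc, add_sub_cancel_left, Complex.norm_def,
    Real.sqrt_eq_iff_mul_self_eq_of_pos hr, Complex.normSq_mk]
  have := Real.mul_self_sqrt h0
  linear_combination -(e ^ 2) * this  - (r ^ 2 - t ^ 2) * he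

/-- A cochain with `uH` as section over the right (or left) half of a circle and `0` over the
other half is not trivial over the circle. -/
theorem not_triv_sphere {c : ℂ → ℂ → ZMod 2} {v : ℂ} (hv : v.im = 0) {r : ℝ} (hr : 0 < r)
    {e : ℝ} (he : e ^ 2 = 1)
    (h1 : ∀ z ∈ sphere v r, (z.im ≠ 0 ∨ 0 < e * (z.re - v.re)) → SecF c uH (𝓝 z))
    (h2 : ∀ z ∈ sphere v r, (z.im ≠ 0 ∨ e * (z.re - v.re) < 0) → SecF c 0 (𝓝 z)) :
    ¬ Triv c (sphere v r) := by
  intro h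
  have he' : (-e) ^ 2 = 1 := by rw [neg_sq, he]
  have hpre : ∀ e, IsPreconnected (halfArc e v r '' Icc (-r) r) := fun e =>
    isPreconnected_Icc.image _ (continuous_halfArc e v r).continuousOn
  have key : ∀ t ∈ Icc (-r) r, t ≠ 0 ∨ 0 < √(r ^ 2 - t ^ 2) := by
    intro t ht
    by_cases h0 : t = 0
    · right; subst h0; apply Real.sqrt_pos.2; nlinarith
    · exact Or.inl h0
  have A : SecOn c uH (halfArc e v r '' Icc (-r) r) := secOn_of_nhds <| by
    rintro _ ⟨t, ht, rfl⟩
    refine h1 _ (halfArc_mem he v hr ht) ((key t ht).imp ?_ ?_)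
    · intro h; simpa [halfArc, hv] using h
    · intro h; simp only [halfArc, Complex.add_re]; nlinarith
  have B : SecOn c 0 (halfArc (-e) v r '' Icc (-r) r) := secOn_of_nhds <| by
    rintro _ ⟨t, ht, rfl⟩
    refine h2 _ (halfArc_mem he' v hr ht) ((key t ht).imp ?_ ?_)
    · intro h; simpa [halfArc, hv] using h
    · intro h; simp only [halfArc, Complex.add_re]; nlinarith
  refine not_triv_of_two (hpre e) (hpre (-e)) A B (p := halfArc e v r r)
    (q := halfArc e v r (-r)) ⟨mem_image_of_mem _ (by constructor <;> linarith),
      r, by constructor <;> linarith, by simp [halfArc]⟩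
      ⟨mem_image_of_mem _ (by constructor <;> linarith),
      -r, by constructor <;> linarith, by simp [halfArc]⟩ ?_ (h.mono ?_)
  · simp [uH, halfArc, hv, hr.le, not_le.2 hr]
  · rintro _ (⟨t, ht, rfl⟩ | ⟨t, ht, rfl⟩)
    exacts [halfArc_mem he v hr ht, halfArc_mem he' v hr ht]

theorem not_lt_of_spheres {c : ℂ → ℂ → ZMod 2} {v : ℂ} {R : ℝ} (hR : 0 < R)
    (h : ∀ r, 0 < r → r < R → ¬ Triv c (sphere v r)) : ¬ LTr c v := by
  rintro ⟨V, hV, H⟩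
  obtain ⟨ε, hε, hV⟩ := Metric.mem_nhds_iff.1 hV
  have h1 := lt_min hε hR
  refine h (min ε R / 2) (by positivity) (by linarith [min_le_right ε R]) (H.mono fun z hz => ?_)
  rw [mem_sphere] at hz
  refine ⟨hV ?_, ?_⟩
  · rw [mem_ball, hz]; linarith [min_le_left ε R]
  · rintro rfl
    rw [dist_self] at hz
    linarith

def rightHalf : Set ℂ := {z | 0 < z.re}

theorem isOpen_rightHalf : IsOpen rightHalf := isOpen_lt continuous_const Complex.continuous_re

theorem closure_rightHalf_subset : closure rightHalf ⊆ {z | 0 ≤ z.re} :=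
  closure_minimal (fun z (hz : 0 < z.re) => hz.le) (isClosed_le continuous_const Complex.continuous_re)

/-- The standard branched cocycle at the origin of the plane. -/
noncomputable abbrev E0 : ℂ → ℂ → ZMod 2 := slit rightHalf

theorem E0_uH {z : ℂ} (hz : z ∈ Complex.slitPlane) : SecF E0 uH (𝓝 z) := by
  rcases hz with h | h
  · exact slit_uH isOpen_rightHalf h
  · exact slit_uH_of_im h

theorem E0_zero {z : ℂ} (hz : -z ∈ Complex.slitPlane) : SecF E0 0 (𝓝 z) := by
  rcases hz with h | h
  · refine slit_zero fun h' => ?_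
    have : 0 ≤ z.re := closure_rightHalf_subset h'
    simp at h; linarith
  · exact slit_zero_of_im (by simpa using h)

theorem slit_cover {z : ℂ} (hz : z ≠ 0) : z ∈ Complex.slitPlane ∨ -z ∈ Complex.slitPlane := by
  simp only [Complex.mem_slitPlane_iff, Complex.neg_re, Complex.neg_im]
  by_contra! h
  exact hz (Complex.ext (by simp; linarith [h.1.1, h.2.1]) h.1.2)

theorem coc_E0 : Coc E0 {0}ᶜ := fun z hz =>
  (slit_cover hz).elim (fun h => (E0_uH h).cocF) (fun h => (E0_zero h).cocF)

theorem not_triv_E0 {r : ℝ} (hr : 0 < r) : ¬ Triv E0 (sphere 0 r) := by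
  refine not_triv_sphere (e := 1) (by simp) hr (by norm_num) (fun z _ h => E0_uH ?_)
    (fun z _ h => E0_zero ?_)
  · simp only [one_mul, Complex.zero_re, sub_zero] at h; exact h.symm
  · simp only [one_mul, Complex.zero_re, sub_zero] at h
    rw [Complex.mem_slitPlane_iff]; simpa [or_comm] using h

/-- Every cocycle on a punctured disc is trivial up to the standard one. -/
theorem dichotomy {c : ℂ → ℂ → ZMod 2} {R : ℝ} (hR : 0 < R) (hc : Coc c (ball 0 R \ {0})) :
    Triv c (ball 0 R \ {0}) ∨ Triv (c + E0) (ball 0 R \ {0}) := by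
  classical
  have h0 : ∀ z ∈ Complex.slitPlane, z ≠ 0 := fun z hz => Complex.slitPlane_ne_zero hz
  set A := ball (0:ℂ) R ∩ Complex.slitPlane with hA
  set B := ball (0:ℂ) R ∩ {z | -z ∈ Complex.slitPlane} with hB
  have hAo : IsOpen A := isOpen_ball.inter Complex.isOpen_slitPlane
  have hBo : IsOpen B := isOpen_ball.inter (Complex.isOpen_slitPlane.preimage continuous_neg)
  have hAB : ball (0:ℂ) R \ {0} = A ∪ B := by
    ext z
    constructor
    · rintro ⟨h1, h2⟩
      exact (slit_cover h2).imp (fun h => ⟨h1, h⟩) (fun h => ⟨h1, h⟩)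
    · rintro (⟨h1, h2⟩ | ⟨h1, h2⟩)
      · exact ⟨h1, h0 z h2⟩
      · exact ⟨h1, fun h => h0 _ h2 (by simpa using h)⟩
  have hRm : ((R / 2 : ℝ) : ℂ) ∈ ball (0:ℂ) R := by
    simp [abs_of_pos hR, hR]
  have hst : StarConvex ℝ ((R / 2 : ℝ) : ℂ) Complex.slitPlane :=
    Complex.starConvex_ofReal_slitPlane (by positivity)
  obtain ⟨s, hs⟩ := triv_starConvex hAo (x0 := ((R / 2 : ℝ) : ℂ))
    ⟨hRm, by simp [Complex.mem_slitPlane_iff, hR]⟩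
    (((convex_ball (0:ℂ) R).starConvex hRm).inter hst)
    (hc.mono (by rw [hAB]; exact subset_union_left))
  obtain ⟨t, ht⟩ := triv_starConvex hBo (x0 := -((R / 2 : ℝ) : ℂ))
    ⟨by simpa using hRm, by simp [Complex.mem_slitPlane_iff, hR]⟩
    (((convex_ball (0:ℂ) R).starConvex (by simpa using hRm)).inter (by
      have := hst.neg
      exact this)) (hc.mono (by rw [hAB]; exact subset_union_right))
  have hU : ∀ z : ℂ, z.im ≠ 0 → z ∈ Complex.slitPlane ∧ -z ∈ Complex.slitPlane := fun z hz =>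
    ⟨Or.inr hz, Or.inr (by simpa using hz)⟩
  obtain ⟨k, hk⟩ := (hs.mono (V := ball 0 R ∩ {z : ℂ | 0 < z.im})
    fun z hz => ⟨hz.1, (hU z (ne_of_gt (show 0 < z.im from hz.2))).1⟩).unique (ht.mono
      fun z hz => ⟨hz.1, (hU z (ne_of_gt (show 0 < z.im from hz.2))).2⟩)
      ((convex_ball (0:ℂ) R).inter (convex_halfSpace_im_gt 0)).isPreconnected
  obtain ⟨l, hl⟩ := (hs.mono (V := ball 0 R ∩ {z : ℂ | z.im < 0})
    fun z hz => ⟨hz.1, (hU z (ne_of_lt (show z.im < 0 from hz.2))).1⟩).unique (ht.mono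
      fun z hz => ⟨hz.1, (hU z (ne_of_lt (show z.im < 0 from hz.2))).2⟩)
      ((convex_ball (0:ℂ) R).inter (convex_halfSpace_im_lt 0)).isPreconnected
  have him : ∀ z ∈ A, z ∈ B → 0 < z.im ∨ z.im < 0 := by
    rintro z ⟨-, h1⟩ ⟨-, h2⟩
    simp only [mem_ofPred_eq, Complex.mem_slitPlane_iff, Complex.neg_re, Complex.neg_im] at h1 h2
    by_contra! h
    have : z.im = 0 := le_antisymm h.1 h.2
    simp [this] at h1 h2
    linarith
  rw [hAB]
  rcases zmod_cases (k + l) with h | h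
  · left
    have h : l = k := by grind
    subst h
    refine ⟨A.piecewise s (fun x => t x + l), SecOn.open_union hAo hBo ?_ ?_⟩
    · exact hs.congr fun z hz => by simp [hz]
    · refine (ht.add_const l).congr fun z hz => ?_
      by_cases hzA : z ∈ A
      · have : t z = s z + l := (him z hzA hz).elim (fun h => hk z ⟨hz.1, h⟩)
          fun h => hl z ⟨hz.1, h⟩
        simp [hzA, this]
        grind
      · simp [hzA]
  · right
    have h : k = l + 1 := by grind
    subst h
    have hs' : SecOn (c + E0) (s + uH) A := hs.add (secOn_of_nhds fun z hz => E0_uH hz.2)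
    have ht' : SecOn (c + E0) (t + 0) B := ht.add (secOn_of_nhds fun z hz => E0_zero hz.2)
    refine ⟨A.piecewise (s + uH) (fun x => (t + 0) x + l), SecOn.open_union hAo hBo ?_ ?_⟩
    · exact hs'.congr fun z hz => by simp [hz]
    · refine (ht'.add_const l).congr fun z hz => ?_
      by_cases hzA : z ∈ A
      · have : t z = s z + uH z + l := by
          rcases him z hzA hz with h | h
          · rw [hk z ⟨hz.1, h⟩]; simp [uH, h.le]; grind
          · rw [hl z ⟨hz.1, h⟩]; simp [uH, not_le.2 h]
        simp [hzA, this]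
        grind
      · simp [hzA]

end Plane

section Surfaces

/-- A Hausdorff space that is locally homeomorphic to the plane. -/
class Surf (S : Type*) [TopologicalSpace S] : Prop where
  chart : ∀ x : S, ∀ U ∈ 𝓝 x, ∃ j : ℂ → S, IsOpenEmbedding j ∧ j 0 = x ∧ range j ⊆ U

theorem exists_embed_ball (x : ℂ) {r : ℝ} (hr : 0 < r) :
    ∃ j : ℂ → ℂ, IsOpenEmbedding j ∧ j 0 = x ∧ range j = ball x r := by
  refine ⟨OpenPartialHomeomorph.univBall x r,
    OpenPartialHomeomorph.isOpenEmbedding _ (OpenPartialHomeomorph.univBall_source x r),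
    OpenPartialHomeomorph.univBall_apply_zero x r, ?_⟩
  rw [← image_univ, ← OpenPartialHomeomorph.univBall_source x r,
    OpenPartialHomeomorph.image_source_eq_target, OpenPartialHomeomorph.univBall_target x hr]

instance : Surf ℂ where
  chart x U hU := by
    obtain ⟨r, hr, h⟩ := Metric.mem_nhds_iff.1 hU
    obtain ⟨j, h1, h2, h3⟩ := exists_embed_ball x hr
    exact ⟨j, h1, h2, h3 ▸ h⟩

variable {S : Type*} [MetricSpace S] [Surf S]

theorem PCoc.dichotomy {j : ℂ → S} (hj : IsOpenEmbedding j) {c : S → S → ZMod 2}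
    (h : PCoc c (j 0)) :
    LTr c (j 0) ∨ LTr (_root_.pull j c + E0) 0 := by
  obtain ⟨V, hV, H⟩ := h.pull hj.continuous hj.injective
  obtain ⟨r, hr, hV⟩ := Metric.mem_nhds_iff.1 hV
  refine (_root_.dichotomy hr (H.mono (sdiff_subset_sdiff_left hV))).imp (fun h => ?_) (fun h => ?_)
  · exact (lt_pull hj).1 ⟨_, ball_mem_nhds _ hr, h⟩
  · exact ⟨_, ball_mem_nhds _ hr, h⟩

theorem lam_add {c d : S → S → ZMod 2} {v : S} (hc : PCoc c v) (hd : PCoc d v) :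
    lam (c + d) v = lam c v + lam d v := by
  obtain ⟨j, hj, rfl, -⟩ := Surf.chart v univ univ_mem
  by_cases h1 : LTr c (j 0)
  · rw [lam_eq_zero.2 h1, zero_add]
    refine lam_congr ?_
    rwa [coch_add_cancel]
  by_cases h2 : LTr d (j 0)
  · rw [lam_eq_zero.2 h2, add_zero]
    refine lam_congr ?_
    rwa [add_comm c d, coch_add_cancel]
  rw [lam_eq_one.2 h1, lam_eq_one.2 h2, show (1 + 1 : ZMod 2) = 0 from rfl, lam_eq_zero]
  have := ((hc.dichotomy hj).resolve_left h1).add ((hd.dichotomy hj).resolve_left h2)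
  rw [← lt_pull hj]
  convert this using 1
  funext x y
  simp only [pull, Pi.add_apply]
  grind

/-- A cocycle all of whose branchings at the finite set `Q` are trivial agrees with an unbranched
cocycle up to a trivial one. -/
theorem exists_unbranched {c : S → S → ZMod 2} {U : Set S} (hU : IsOpen U) (Q : Finset S)
    (hc : Coc c (U \ Q)) (hQ : ∀ q ∈ Q, q ∈ U → LTr c q) :
    ∃ c', Coc c' U ∧ Triv (c + c') (U \ Q) := by
  classical
  induction Q using Finset.induction_on generalizing c with
  | empty => exact ⟨c, by simpa using hc, by rw [coch_add_self]; exact triv_zero _⟩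
  | insert q Q hq ih =>
    by_cases hqU : q ∈ U
    · set U1 := U \ (Q : Set S) with hU1
      have hU1o : IsOpen U1 := hU.sdiff Q.finite_toSet.isClosed
      have hqU1 : q ∈ U1 := ⟨hqU, by simpa using hq⟩
      have hUd : U \ (insert q Q : Finset S) = U1 \ {q} := by
        ext x; simp [hU1]; tauto
      rw [hUd] at hc
      obtain ⟨V, hV, s, hs⟩ := hQ q (Finset.mem_insert_self _ _) hqU
      obtain ⟨ε, hε, hεV⟩ := Metric.mem_nhds_iff.1 hV
      set c1 : S → S → ZMod 2 := fun y z => if y ∈ ball q (ε / 2) ∧ z ∈ ball q (ε / 2) then 0 else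
        c y z + ((ball q ε).indicator s y + (ball q ε).indicator s z) with hc1
      have hs' : SecOn c s (ball q ε \ {q}) := hs.mono (sdiff_subset_sdiff_left hεV)
      have hbo : IsOpen (ball q ε \ {q}) := isOpen_ball.sdiff isClosed_singleton
      have key : ∀ x ∈ U1 \ {q}, ∀ᶠ V in (𝓝 x).smallSets, ∀ y ∈ V, ∀ z ∈ V,
          (c + cobd ((ball q ε).indicator s)) y z = c1 y z := by
        rintro x ⟨hx, hxq⟩
        by_cases hxe : x ∈ ball q ε
        · filter_upwards [hs'.secF hbo ⟨hxe, hxq⟩, Eventually.smallSets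
            (isOpen_ball.mem_nhds hxe)] with V hV hV' y hy z hz
          have h1 := hV y hy z hz
          have h2 : y ∈ ball q ε := hV' y hy
          have h3 : z ∈ ball q ε := hV' z hz
          simp only [hc1, Pi.add_apply, cobd, indicator_of_mem h2, indicator_of_mem h3, h1]
          split_ifs <;> grind
        · have : (closedBall q (ε/2))ᶜ ∈ 𝓝 x := by
            refine isClosed_closedBall.isOpen_compl.mem_nhds ?_
            simp only [mem_ball, not_lt] at hxe
            simp only [mem_compl_iff, mem_closedBall, not_le]
            linarith
          filter_upwards [Eventually.smallSets this] with V hV y hy z hz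
          have h1 : y ∉ ball q (ε/2) := fun h => hV y hy (ball_subset_closedBall h)
          simp only [hc1, h1, cobd, false_and, if_false, Pi.add_apply]
      have hc1U : Coc c1 U1 := by
        intro x hx
        by_cases hxq : x = q
        · subst hxq
          refine (cocF_zero _).congr ?_
          filter_upwards [Eventually.smallSets (ball_mem_nhds x (half_pos hε))] with V hV y hy z hz
          have h2 : y ∈ ball x (ε/2) := hV y hy
          have h3 : z ∈ ball x (ε/2) := hV z hz
          simp only [hc1, h2, h3, and_self, if_true, Pi.zero_apply]
        · exact ((hc x ⟨hx, hxq⟩).add (secF_cobd _ _).cocF).congr (key x ⟨hx, hxq⟩)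
      have ht1 : Triv (c + c1) (U1 \ {q}) := by
        refine ⟨(ball q ε).indicator s, secOn_of_nhds fun x hx => ?_⟩
        filter_upwards [key x hx] with V hV y hy z hz
        have := hV y hy z hz
        simp only [Pi.add_apply, cobd] at this ⊢
        grind
      obtain ⟨c', h1, h2⟩ := ih hc1U (fun p hp hpU => by
        have hpq : p ≠ q := fun h => hq (h ▸ hp)
        have h3 := hQ p (Finset.mem_insert_of_mem hp) hpU
        have h4 : LTr (c + c1) p := by
          refine ⟨U \ ((Q.erase p ∪ {q} : Finset S) : Set S), (hU.sdiff
            (Finset.finite_toSet _).isClosed).mem_nhds ⟨hpU, by simp [hpq]⟩, ht1.mono ?_⟩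
          intro x hx
          simp only [Finset.coe_union, Finset.coe_erase, Finset.coe_singleton, union_singleton,
            Set.mem_sdiff, mem_insert_iff, mem_singleton_iff, hU1, Finset.mem_coe] at hx ⊢
          tauto
        have := h3.add h4
        rwa [← add_assoc, coch_add_self, zero_add] at this)
      refine ⟨c', h1, ?_⟩
      rw [hUd]
      have := ht1.add (h2.mono (V := U1 \ {q}) sdiff_subset)
      convert this using 1
      funext x y
      simp only [Pi.add_apply]
      grind
    · have : U \ (insert q Q : Finset S) = U \ Q := by
        ext x; simp; intro hx h h'; exact hqU (h' ▸ hx)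
      rw [this] at hc ⊢
      exact ih hc fun p hp => hQ p (Finset.mem_insert_of_mem hp)

end Surfaces

section SegmentClass

def rect : Set ℂ := Ioo 0 1 ×ℂ Ioo (-1) 1

theorem isOpen_rect : IsOpen rect := isOpen_Ioo.reProdIm isOpen_Ioo

theorem isCompact_closure_rect : IsCompact (closure rect) := by
  unfold rect
  rw [Complex.closure_reProdIm]
  exact (isCompact_of_isClosed_isBounded isClosed_closure (isBounded_Ioo 0 1).closure).reProdIm
    (isCompact_of_isClosed_isBounded isClosed_closure (isBounded_Ioo (-1) 1).closure)

theorem closure_rect_subset : closure rect ⊆ {z | 0 ≤ z.re ∧ z.re ≤ 1} := by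
  refine closure_minimal ?_ ?_
  · intro z hz
    have hz : z.re ∈ Ioo (0:ℝ) 1 ∧ z.im ∈ Ioo (-1:ℝ) 1 := hz
    exact ⟨hz.1.1.le, hz.1.2.le⟩
  · exact (isClosed_le continuous_const Complex.continuous_re).inter
      (isClosed_le Complex.continuous_re continuous_const)

theorem mem_segment_zero_one {z : ℂ} : z ∈ segment ℝ (0:ℂ) 1 ↔ z.im = 0 ∧ 0 ≤ z.re ∧ z.re ≤ 1 := by
  rw [segment_eq_image_lineMap]
  constructor
  · rintro ⟨t, ht, rfl⟩
    simpa [AffineMap.lineMap_apply] using ht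
  · rintro ⟨h1, h2⟩
    exact ⟨z.re, h2, Complex.ext (by simp [AffineMap.lineMap_apply])
      (by simp [AffineMap.lineMap_apply, h1])⟩

/-- The plane cocycle branched exactly at `0` and `1`. -/
noncomputable abbrev E1 : ℂ → ℂ → ZMod 2 := slit rect

theorem E1_zero {z : ℂ} (hz : z ∉ segment ℝ (0:ℂ) 1) : SecF E1 0 (𝓝 z) := by
  by_cases h : z.im = 0
  · exact slit_zero fun h' => hz (mem_segment_zero_one.2 ⟨h, closure_rect_subset h'⟩)
  · exact slit_zero_of_im h

theorem E1_uH {z : ℂ} (hz : z.im ≠ 0 ∨ 0 < z.re ∧ z.re < 1) : SecF E1 uH (𝓝 z) := by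
  by_cases h : z.im = 0
  · refine slit_uH isOpen_rect ?_
    change z.re ∈ Ioo (0:ℝ) 1 ∧ z.im ∈ Ioo (-1:ℝ) 1
    simp only [ne_eq, h, not_true_eq_false, false_or, mem_Ioo] at hz ⊢
    exact ⟨hz, by norm_num, by norm_num⟩
  · exact slit_uH_of_im h

theorem coc_E1 : Coc E1 {0, 1}ᶜ := by
  intro z hz
  by_cases h : z ∈ segment ℝ (0:ℂ) 1
  · rw [mem_segment_zero_one] at h
    refine (E1_uH (Or.inr ⟨lt_of_le_of_ne h.2.1 fun h' => hz (Or.inl ?_),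
      lt_of_le_of_ne h.2.2 fun h' => hz (Or.inr ?_)⟩)).cocF
    · exact Complex.ext h'.symm h.1
    · exact Complex.ext h' h.1
  · exact (E1_zero h).cocF

theorem re_sub_lt_of_sphere {v z : ℂ} {r : ℝ} (hz : z ∈ sphere v r) (hr : r < 1) :
    |z.re - v.re| < 1 := by
  rw [mem_sphere_iff_norm] at hz
  have := Complex.abs_re_le_norm (z - v)
  rw [Complex.sub_re] at this
  linarith

theorem lam_E1_zero : lam E1 0 = 1 := by
  rw [lam_eq_one]
  refine not_lt_of_spheres one_pos fun r hr hr1 => not_triv_sphere (e := 1) (by simp) hr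
    (by norm_num) (fun z hz h => E1_uH ?_) (fun z hz h => E1_zero ?_)
  · have := abs_lt.1 (re_sub_lt_of_sphere hz hr1)
    simp only [Complex.zero_re, sub_zero, one_mul] at this h
    exact h.imp_right fun h => ⟨h, this.2⟩
  · simp only [Complex.zero_re, sub_zero, one_mul] at h
    rw [mem_segment_zero_one]
    rintro ⟨h1, h2, h3⟩
    exact h.elim (fun h => h h1) (fun h => by linarith)

theorem lam_E1_one : lam E1 1 = 1 := by
  rw [lam_eq_one]
  refine not_lt_of_spheres one_pos fun r hr hr1 => not_triv_sphere (e := -1) (by simp) hr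
    (by norm_num) (fun z hz h => E1_uH ?_) (fun z hz h => E1_zero ?_)
  · have := abs_lt.1 (re_sub_lt_of_sphere hz hr1)
    simp only [Complex.one_re] at this h
    exact h.imp_right fun h => ⟨by linarith, by linarith⟩
  · simp only [Complex.one_re] at h
    rw [mem_segment_zero_one]
    rintro ⟨h1, h2, h3⟩
    exact h.elim (fun h => h h1) (fun h => by linarith)

/-- The affine homeomorphism of the plane taking `z` to `0` and `w` to `1`. -/
noncomputable def normSeg (z w : ℂ) (h : z ≠ w) : ℂ ≃ₜ ℂ :=
  (Homeomorph.subRight z).trans (Homeomorph.mulRight₀ (w - z)⁻¹ (inv_ne_zero (sub_ne_zero.2 h.symm)))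

theorem normSeg_apply (z w : ℂ) (h : z ≠ w) (x : ℂ) : normSeg z w h x = (x - z) * (w - z)⁻¹ := rfl

theorem normSeg_left (z w : ℂ) (h : z ≠ w) : normSeg z w h z = 0 := by simp [normSeg_apply]

theorem normSeg_right (z w : ℂ) (h : z ≠ w) : normSeg z w h w = 1 := by
  simp [normSeg_apply, sub_ne_zero.2 h.symm]

theorem normSeg_mem {z w : ℂ} (h : z ≠ w) {x : ℂ} (hx : normSeg z w h x ∈ segment ℝ (0:ℂ) 1) :
    x ∈ segment ℝ z w := by
  rw [segment_eq_image_lineMap] at hx ⊢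
  obtain ⟨t, ht, hx⟩ := hx
  refine ⟨t, ht, ?_⟩
  rw [normSeg_apply] at hx
  have h' := sub_ne_zero.2 h.symm
  simp only [AffineMap.lineMap_apply, vsub_eq_sub, sub_zero, vadd_eq_add, add_zero,
    Complex.real_smul, mul_one] at hx ⊢
  rw [hx]
  field_simp
  ring

variable {S : Type*} [MetricSpace S]

open Classical in
/-- Extension by zero of a plane cochain. -/
noncomputable def pushZ (j : ℂ → S) (e : ℂ → ℂ → ZMod 2) : S → S → ZMod 2 := fun x y =>
  if x ∈ range j ∧ y ∈ range j then e (Function.invFun j x) (Function.invFun j y) else 0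

theorem pull_pushZ {j : ℂ → S} (hj : Function.Injective j) (e : ℂ → ℂ → ZMod 2) :
    pull j (pushZ j e) = e := by
  funext x y
  simp [pull, pushZ, Function.leftInverse_invFun hj _]

theorem SecF.of_pull {X Y : Type*} [TopologicalSpace X] [TopologicalSpace Y]
    {c : X → X → ZMod 2} {j : Y → X} (hj : IsOpenEmbedding j) {s : X → ZMod 2}
    {y : Y} (h : SecF (_root_.pull j c) (s ∘ j) (𝓝 y)) : SecF c s (𝓝 (j y)) := by
  obtain ⟨V, hV, H⟩ := secF_iff.1 h
  refine secF_iff.2 ⟨j '' V, hj.isOpenMap.image_mem_nhds hV, ?_⟩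
  rintro _ ⟨z, hz, rfl⟩ _ ⟨w, hw, rfl⟩
  exact H z hz w hw

theorem CocF.of_pull {X Y : Type*} [TopologicalSpace X] [TopologicalSpace Y]
    {c : X → X → ZMod 2} {j : Y → X} (hj : IsOpenEmbedding j)
    {y : Y} (h : CocF (_root_.pull j c) (𝓝 y)) : CocF c (𝓝 (j y)) := by
  obtain ⟨V, hV, H⟩ := cocF_iff.1 h
  refine cocF_iff.2 ⟨j '' V, hj.isOpenMap.image_mem_nhds hV, ?_⟩
  rintro _ ⟨z, hz, rfl⟩ _ ⟨w, hw, rfl⟩ _ ⟨u, hu, rfl⟩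
  exact H z hz w hw u hu

/-- The cocycle on `S` branched exactly at `j z` and `j w`, supported near `j [z, w]`. -/
noncomputable def segE (j : ℂ → S) (z w : ℂ) (h : z ≠ w) : S → S → ZMod 2 :=
  pushZ j (pull (normSeg z w h) E1)

variable {j : ℂ → S} {z w : ℂ}

theorem segE_zero (hj : IsOpenEmbedding j) (h : z ≠ w) {x : S} (hx : x ∉ j '' segment ℝ z w) :
    SecF (segE j z w h) 0 (𝓝 x) := by
  by_cases hxj : x ∈ range j
  · obtain ⟨y, rfl⟩ := hxj
    refine SecF.of_pull hj ?_
    rw [segE, pull_pushZ hj.injective]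
    exact (E1_zero fun h' => hx ⟨y, normSeg_mem h h', rfl⟩).pull (normSeg z w h).continuous.continuousAt
  · set C := j '' (normSeg z w h ⁻¹' closure rect) with hC
    have hCc : IsCompact C :=
      ((normSeg z w h).isCompact_preimage.2 isCompact_closure_rect).image hj.continuous
    have hxC : Cᶜ ∈ 𝓝 x := hCc.isClosed.isOpen_compl.mem_nhds
      fun h => hxj (image_subset_range _ _ h)
    filter_upwards [Eventually.smallSets hxC] with V hV y hy u hu
    simp only [segE, pushZ, Pi.zero_apply, add_zero]
    split_ifs with hr
    · obtain ⟨⟨y, rfl⟩, -⟩ := hr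
      have : normSeg z w h y ∉ rect := fun h' => hV _ hy ⟨y, subset_closure h', rfl⟩
      simp [pull, slit, Function.leftInverse_invFun hj.injective _, this]
    · rfl

theorem coc_segE (hj : IsOpenEmbedding j) (h : z ≠ w) : Coc (segE j z w h) {j z, j w}ᶜ := by
  intro x hx
  by_cases hxs : x ∈ j '' segment ℝ z w
  · obtain ⟨y, hy, rfl⟩ := hxs
    refine CocF.of_pull hj ?_
    rw [segE, pull_pushZ hj.injective]
    refine (coc_E1 (normSeg z w h y) ?_).pull (normSeg z w h).continuous.continuousAt
    rintro (h' | h')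
    · rw [← normSeg_left z w h] at h'
      exact hx (Or.inl (by rw [(normSeg z w h).injective h']))
    · rw [← normSeg_right z w h] at h'
      exact hx (Or.inr (by rw [(normSeg z w h).injective h']; rfl))
  · exact (segE_zero hj h hxs).cocF

theorem lam_segE_left (hj : IsOpenEmbedding j) (h : z ≠ w) : lam (segE j z w h) (j z) = 1 := by
  rw [← lam_pull hj, segE, pull_pushZ hj.injective, lam_pull (normSeg z w h).isOpenEmbedding,
    normSeg_left, lam_E1_zero]

theorem lam_segE_right (hj : IsOpenEmbedding j) (h : z ≠ w) : lam (segE j z w h) (j w) = 1 := by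
  rw [← lam_pull hj, segE, pull_pushZ hj.injective, lam_pull (normSeg z w h).isOpenEmbedding,
    normSeg_right, lam_E1_one]

end SegmentClass

section Mesh

noncomputable def ptAt (t : ℝ) : ℂ := Complex.exp (t * Complex.I)

theorem norm_ptAt (t : ℝ) : ‖ptAt t‖ = 1 := Complex.norm_exp_ofReal_mul_I t

theorem ptAt_ne (t : ℝ) : ptAt t ≠ 0 := Complex.exp_ne_zero _

theorem ptAt_re (t : ℝ) : (ptAt t).re = Real.cos t := Complex.exp_ofReal_mul_I_re t

theorem ptAt_im (t : ℝ) : (ptAt t).im = Real.sin t := Complex.exp_ofReal_mul_I_im t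

theorem ptAt_two_pi (t : ℝ) : ptAt (t + 2 * Real.pi) = ptAt t :=
  Complex.ext (by simp [ptAt_re]) (by simp [ptAt_im])

theorem ptAt_pi : ptAt Real.pi = -1 := by simp [ptAt]

theorem dist_ptAt (a b : ℝ) : dist (ptAt a) (ptAt b) ≤ |a - b| := by
  have : ptAt a - ptAt b = ptAt b * (Complex.exp (Complex.I * ((a - b : ℝ) : ℂ)) - 1) := by
    rw [mul_sub, ptAt, ptAt, ← Complex.exp_add, mul_one]
    congr 2
    push_cast; ring
  rw [dist_eq_norm, this, norm_mul, norm_ptAt, one_mul]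
  exact Real.norm_exp_I_mul_ofReal_sub_one_le

theorem arg_ptAt {t : ℝ} (h : t ∈ Ioc (-Real.pi) Real.pi) : (ptAt t).arg = t :=
  Complex.arg_exp_mul_I t |>.trans (by
    rw [toIocMod_eq_self]; convert h using 1; ring_nf)

theorem eq_ptAt_arg {x : ℂ} (h : ‖x‖ = 1) : x = ptAt x.arg := by
  have := Complex.norm_mul_exp_arg_mul_I x
  rw [h] at this
  simpa [ptAt] using this.symm

theorem im_div_ptAt (y : ℂ) (b : ℝ) : (y / ptAt b).im = ‖y‖ * Real.sin (y.arg - b) := by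
  have h1 := Complex.norm_mul_exp_arg_mul_I y
  have h2 : y / ptAt b = ‖y‖ * ptAt (y.arg - b) := by
    rw [div_eq_iff (ptAt_ne b), mul_assoc, ptAt, ptAt, ← Complex.exp_add]
    conv_lhs => rw [← h1]
    congr 2
    push_cast; ring
  rw [h2, Complex.im_ofReal_mul, ptAt_im]

/-- The angle of `y`, normalized to lie in `(0, n]`. -/
noncomputable def turn (n : ℕ) (y : ℂ) : ℝ := (y.arg + Real.pi) * n / (2 * Real.pi)

theorem turn_mem {n : ℕ} (hn : 0 < n) (y : ℂ) : turn n y ∈ Ioc (0:ℝ) n := by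
  have h1 := Complex.neg_pi_lt_arg y
  have h2 := Complex.arg_le_pi y
  have hp := Real.pi_pos
  have hn' : (0:ℝ) < n := Nat.cast_pos.2 hn
  unfold turn
  constructor
  · apply div_pos (mul_pos (by linarith) hn') (by linarith)
  · rw [div_le_iff₀ (by linarith)]
    nlinarith

/-- The angle with normalized value `t`. -/
noncomputable def ang (n : ℕ) (t : ℝ) : ℝ := -Real.pi + 2 * Real.pi * t / n

theorem ang_turn {n : ℕ} (hn : 0 < n) (y : ℂ) : ang n (turn n y) = y.arg := by
  have hp := Real.pi_pos
  have hn' : (0:ℝ) < n := Nat.cast_pos.2 hn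
  unfold ang turn
  field_simp
  ring

theorem turn_ptAt {n : ℕ} (hn : 0 < n) {t : ℝ} (ht : t ∈ Ioc (0:ℝ) n) :
    turn n (ptAt (ang n t)) = t := by
  have hp := Real.pi_pos
  have hn' : (0:ℝ) < n := Nat.cast_pos.2 hn
  unfold turn
  rw [arg_ptAt]
  · unfold ang; field_simp; ring
  · unfold ang
    constructor
    · have : 0 < 2 * Real.pi * t / n := div_pos (mul_pos (by linarith) ht.1) hn'
      linarith
    · have : 2 * Real.pi * t / n ≤ 2 * Real.pi := by
        rw [div_le_iff₀ hn']; nlinarith [ht.2]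
      linarith

theorem ang_add (n : ℕ) (hn : 0 < n) (t : ℝ) : ang n (t + n) = ang n t + 2 * Real.pi := by
  have hn' : (0:ℝ) < n := Nat.cast_pos.2 hn
  unfold ang
  field_simp
  ring

theorem ang_sub (n : ℕ) (s t : ℝ) : ang n s - ang n t = 2 * Real.pi / n * (s - t) := by
  unfold ang; ring

/-- Finite subdivision of the unit circle. -/
structure CircMesh (ε : ℝ) where
  n : ℕ
  v : ℕ → ℂ
  m : ℕ → ℂ
  M : ℂ → ℂ
  hn : 0 < n
  v_inj : ∀ k < n, ∀ l < n, v k = v l → k = l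
  v_norm : ∀ k, ‖v k‖ = 1
  m_norm : ∀ k, ‖m k‖ = 1
  m_per : m n = m 0
  dist_l : ∀ k, dist (m k) (v k) < ε
  dist_r : ∀ k, dist (m (k + 1)) (v k) < ε
  M_const : ∀ x, ‖x‖ = 1 → (∀ k < n, x ≠ v k) → (∀ᶠ y in 𝓝 x, M y = M x)
  M_dist : ∀ x, ‖x‖ = 1 → dist (M x) x < ε
  M_vert : ∀ k < n, ∀ᶠ y in 𝓝 (v k), M y = if 0 < (y / v k).im then m (k + 1) else m k
  sum_E0 : ∑ k ∈ Finset.range n, E0 (m k) (m (k + 1)) = 1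

theorem continuousAt_turn (n : ℕ) {x : ℂ} (hx : x ∈ Complex.slitPlane) :
    ContinuousAt (turn n) x := by
  unfold turn
  exact (((Complex.continuousAt_arg hx).add continuousAt_const).mul continuousAt_const).div_const _

theorem sum_E0_mesh (N : ℕ) (hN : 2 ≤ N) : ∑ k ∈ Finset.range (2 * N),
    E0 (ptAt (ang (2 * N) (k + 1 / 2))) (ptAt (ang (2 * N) ((k + 1 : ℕ) + 1 / 2))) = 1 := by
  have hp := Real.pi_pos
  have hN' : (2:ℝ) ≤ N := by exact_mod_cast hN
  have key : ∀ t : ℝ, ang (2 * N) t = Real.pi * (t - N) / N := by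
    intro t; unfold ang; push_cast; field_simp; ring
  have hpos : ∀ k : ℕ, N ≤ k → k < 2 * N → uH (ptAt (ang (2 * N) (k + 1 / 2))) = 1 := by
    intro k h1 h2
    have h1 : (N:ℝ) ≤ k := by exact_mod_cast h1
    have h2 : (k:ℝ) + 1 ≤ 2 * N := by exact_mod_cast h2
    have : 0 ≤ (ptAt (ang (2 * N) (k + 1 / 2))).im := by
      rw [ptAt_im, key]
      apply Real.sin_nonneg_of_nonneg_of_le_pi
      · apply div_nonneg (mul_nonneg hp.le (by linarith)) (by linarith)
      · rw [div_le_iff₀ (by linarith)]; nlinarith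
    rw [uH, if_pos this]
  have hneg : ∀ k : ℕ, k < N → uH (ptAt (ang (2 * N) (k + 1 / 2))) = 0 := by
    intro k h1
    have h1 : (k:ℝ) + 1 ≤ N := by exact_mod_cast h1
    have : (ptAt (ang (2 * N) (k + 1 / 2))).im < 0 := by
      rw [ptAt_im, key]
      apply Real.sin_neg_of_neg_of_neg_pi_lt
      · apply div_neg_of_neg_of_pos _ (by linarith)
        exact mul_neg_of_pos_of_neg hp (by linarith)
      · rw [lt_div_iff₀ (by linarith)]; nlinarith [(Nat.cast_nonneg k : (0:ℝ) ≤ k)]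
    rw [uH, if_neg (not_le.2 this)]
  rw [Finset.sum_eq_single (N - 1)]
  · have h1 : N - 1 + 1 = N := by omega
    have hre : 0 < (ptAt (ang (2 * N) ((N - 1 : ℕ) + 1 / 2))).re := by
      rw [ptAt_re, key]
      push_cast [Nat.cast_sub (show 1 ≤ N by omega)]
      apply Real.cos_pos_of_mem_Ioo
      constructor
      · rw [lt_div_iff₀ (by linarith)]; nlinarith
      · rw [div_lt_iff₀ (by linarith)]; nlinarith
    have h2 := hpos N le_rfl (by omega)
    have h3 := hneg (N - 1) (by omega)
    simp only [E0, slit, h1]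
    rw [if_pos (show _ ∈ rightHalf from hre), h2, h3, zero_add]
  · intro k hk hkN
    rw [Finset.mem_range] at hk
    simp only [E0, slit]
    rcases lt_or_ge (k + 1) N with h | h
    · rw [hneg k (by omega), hneg (k + 1) h]; simp
    · rcases lt_or_ge (k + 1) (2 * N) with h' | h'
      · rw [hpos k (by omega) hk, hpos (k + 1) h h', zmod_add_self]; simp
      · obtain rfl : k = 2 * N - 1 := by omega
        rw [if_neg]
        change ¬ (0 < (ptAt _).re)
        rw [not_lt, ptAt_re, key]
        push_cast [Nat.cast_sub (show 1 ≤ 2 * N by omega)]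
        apply Real.cos_nonpos_of_pi_div_two_le_of_le
        · rw [le_div_iff₀ (by linarith)]; nlinarith
        · rw [div_le_iff₀ (by linarith)]; nlinarith
  · intro h; exact absurd (Finset.mem_range.2 (by omega)) h

theorem exists_mesh {ε : ℝ} (hε : 0 < ε) : Nonempty (CircMesh ε) := by
  have hp := Real.pi_pos
  obtain ⟨N, hN⟩ := exists_nat_gt (2 + 2 * Real.pi / ε)
  have hN2 : 2 ≤ N := by
    have : (2:ℝ) < N := by
      have : 0 < 2 * Real.pi / ε := by positivity
      linarith
    exact_mod_cast this.le
  set n := 2 * N with hn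
  have hn0 : 0 < n := by omega
  have hn' : (0:ℝ) < n := Nat.cast_pos.2 hn0
  have hnε : 2 * Real.pi / n < ε := by
    rw [div_lt_iff₀ hn', ← div_lt_iff₀' hε]
    push_cast [hn]; linarith
  have hd : ∀ s t : ℝ, |s - t| ≤ 1 → dist (ptAt (ang n s)) (ptAt (ang n t)) < ε := by
    intro s t h
    refine (dist_ptAt _ _).trans_lt ?_
    rw [ang_sub, abs_mul, abs_of_nonneg (by positivity)]
    calc _ ≤ 2 * Real.pi / n * 1 := by gcongr
      _ < ε := by linarith
  set M : ℂ → ℂ := fun y => ptAt (ang n (⌈turn n y⌉₊ - 1 / 2)) with hM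
  have hMq : ∀ (y : ℂ) (k : ℕ), (k:ℝ) < turn n y → turn n y ≤ k + 1 →
      M y = ptAt (ang n (k + 1 / 2)) := by
    intro y k h1 h2
    have : ⌈turn n y⌉₊ = k + 1 := by
      rw [Nat.ceil_eq_iff (by omega)]
      push_cast
      exact ⟨by simpa using h1, h2⟩
    simp only [hM, this]
    congr 2; push_cast; ring
  have hslit : ∀ t ∈ Ioo (0:ℝ) n, ptAt (ang n t) ∈ Complex.slitPlane := by
    intro t ht
    rw [Complex.mem_slitPlane_iff_arg]
    refine ⟨fun h => ?_, ptAt_ne _⟩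
    have := turn_ptAt hn0 (Ioo_subset_Ioc_self ht)
    rw [turn, h] at this
    field_simp at this
    linarith [ht.2]
  refine ⟨⟨n, fun k => ptAt (ang n (k + 1)), fun k => ptAt (ang n (k + 1 / 2)), M, hn0, ?_,
    fun k => norm_ptAt _, fun k => norm_ptAt _, ?_, fun k => hd _ _ ?_, fun k => hd _ _ ?_,
    ?_, ?_, ?_, sum_E0_mesh N hN2⟩⟩
  · intro k hk l hl h
    have hk : (k:ℝ) + 1 ≤ n := by exact_mod_cast hk
    have hl : (l:ℝ) + 1 ≤ n := by exact_mod_cast hl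
    have h1 := turn_ptAt hn0 (t := k + 1) ⟨by positivity, hk⟩
    have h2 := turn_ptAt hn0 (t := l + 1) ⟨by positivity, hl⟩
    rw [h, h2] at h1
    exact_mod_cast (by linarith : (k:ℝ) = l)
  · have := ptAt_two_pi (ang n (1 / 2))
    rw [← ang_add n hn0] at this
    simp only [Nat.cast_zero, zero_add]
    rw [← this]; congr 2; ring
  · rw [abs_le]; constructor <;> linarith
  · push_cast; rw [abs_le]; constructor <;> linarith
  · intro x hx hv
    obtain ⟨h0, h1⟩ := turn_mem hn0 x
    have hxe : x = ptAt (ang n (turn n x)) := by rw [ang_turn hn0]; exact eq_ptAt_arg hx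
    set q := ⌈turn n x⌉₊ with hq
    have hq0 : q ≠ 0 := by rw [hq]; exact (Nat.ceil_pos.2 h0).ne'
    obtain ⟨k, hk⟩ := Nat.exists_eq_succ_of_ne_zero hq0
    have hqn : q ≤ n := Nat.ceil_le.2 h1
    have hlo : (k:ℝ) < turn n x := by
      have := Nat.lt_ceil.1 (show k < ⌈turn n x⌉₊ by omega)
      exact this
    have hhi : turn n x < k + 1 := by
      have : turn n x ≤ (q:ℝ) := Nat.le_ceil _
      rw [hk] at this
      push_cast at this
      refine lt_of_le_of_ne this fun h => hv k (by omega) ?_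
      rw [← h]; exact hxe
    have hkn : (k:ℝ) + 1 ≤ n := by
      have : k + 1 ≤ n := by omega
      exact_mod_cast this
    have hs : x ∈ Complex.slitPlane := by
      rw [hxe]; exact hslit _ ⟨h0, hhi.trans_le hkn⟩
    filter_upwards [(continuousAt_turn n hs).eventually (Ioo_mem_nhds hlo hhi)] with y hy
    rw [hMq y k hy.1 hy.2.le, hMq x k hlo hhi.le]
  · intro x hx
    obtain ⟨h0, h1⟩ := turn_mem hn0 x
    have hxe : x = ptAt (ang n (turn n x)) := by rw [ang_turn hn0]; exact eq_ptAt_arg hx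
    conv_lhs => rw [hxe]
    simp only [hM]
    rw [← hxe]
    conv_lhs => arg 2; rw [hxe]
    apply hd
    have h2 := Nat.le_ceil (turn n x)
    have h3 := Nat.ceil_lt_add_one h0.le
    rw [abs_le]; constructor <;> linarith
  · intro k hk
    rcases Nat.lt_or_ge (k + 1) n with h | h
    · have h' : (k:ℝ) + 1 < n := by exact_mod_cast h
      have hs := hslit (k + 1) ⟨by positivity, h'⟩
      have ht := turn_ptAt hn0 (t := k + 1) ⟨by positivity, h'.le⟩
      have hc := continuousAt_turn n hs
      rw [ContinuousAt, ht] at hc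
      have hne : ∀ᶠ y in 𝓝 (ptAt (ang n (k + 1))), y ≠ 0 := isOpen_ne.mem_nhds (ptAt_ne _)
      filter_upwards [hc.eventually (Ioo_mem_nhds (show (k:ℝ) < k + 1 by linarith)
        (show (k:ℝ) + 1 < k + 1 + 1 by linarith)), hne] with y hy hy0
      have hsin : 0 < (y / ptAt (ang n (k + 1))).im ↔ (k:ℝ) + 1 < turn n y := by
        rw [im_div_ptAt, ← ang_turn hn0 y, mul_pos_iff_of_pos_left (norm_pos_iff.2 hy0), ang_sub]
        have hle : 2 * Real.pi / n ≤ Real.pi / 2 := by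
          rw [div_le_iff₀ hn']
          have : (4:ℝ) ≤ n := by
            have : 4 ≤ n := by omega
            exact_mod_cast this
          nlinarith
        have hpn : 0 < 2 * Real.pi / n := by positivity
        constructor
        · intro hh
          by_contra! hcon
          have := Real.sin_nonpos_of_nonpos_of_neg_pi_le
            (x := 2 * Real.pi / n * (turn n y - (k + 1))) (by nlinarith) (by nlinarith [hy.1])
          linarith
        · intro hh
          apply Real.sin_pos_of_pos_of_lt_pi (mul_pos hpn (by linarith))
          nlinarith [hy.2]
      split_ifs with h2
      · rw [hMq y (k + 1) (by push_cast; exact hsin.1 h2) (by push_cast; exact hy.2.le)]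
      · rw [hMq y k hy.1 (not_lt.1 (mt hsin.2 h2))]
    · have hkn : k + 1 = n := by omega
      have hkn' : (k:ℝ) + 1 = n := by exact_mod_cast hkn
      have hv : ptAt (ang n (k + 1)) = -1 := by
        rw [hkn', ← ptAt_pi, ang]; congr 1; field_simp; ring
      have hm : ptAt (ang n ((k + 1 : ℕ) + 1 / 2)) = ptAt (ang n ((0:ℕ) + 1 / 2)) := by
        rw [← ptAt_two_pi (ang n ((0:ℕ) + 1 / 2)), ← ang_add n hn0, hkn]; congr 2; push_cast; ring
      rw [hv, hm]
      have h1 := Complex.tendsto_arg_nhdsWithin_im_neg_of_re_neg_of_im_zero (z := -1)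
        (by simp) (by simp)
      have h2 := Complex.continuousWithinAt_arg_of_re_neg_of_im_zero (z := -1) (by simp) (by simp)
      rw [ContinuousWithinAt, Complex.arg_neg_one] at h2
      have hlt1 : -Real.pi < -Real.pi + 2 * Real.pi / n := by
        have : 0 < 2 * Real.pi / n := by positivity
        linarith
      have hlt2 : Real.pi - 2 * Real.pi / n < Real.pi := by
        have : 0 < 2 * Real.pi / n := by positivity
        linarith
      have e1 := eventually_nhdsWithin_iff.1 (h1.eventually (Iio_mem_nhds hlt1))
      have e2 := eventually_nhdsWithin_iff.1 (h2.eventually (Ioi_mem_nhds hlt2))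
      filter_upwards [e1, e2] with y h1 h2
      have ha := ang_turn hn0 y
      have htm := turn_mem hn0 y
      have hpn : 0 < 2 * Real.pi / n := by positivity
      split_ifs with h3
      · have h3 : y.im < 0 := by rw [div_neg, div_one] at h3; simpa using h3
        have h1 := h1 h3
        rw [← ha, ang, add_lt_add_iff_left, mul_div_right_comm] at h1
        rw [hMq y 0 (by simpa using htm.1) (by push_cast; nlinarith)]
      · have h3 : 0 ≤ y.im := by rw [div_neg, div_one] at h3; simpa using h3
        have h2 := h2 h3
        have h4 : Real.pi = ang n n := by rw [ang]; field_simp; ring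
        have h5 := ang_sub n n (turn n y)
        rw [← ha] at h2
        simp only [← h4] at h5
        have : 2 * Real.pi / n * (n - turn n y) < 2 * Real.pi / n * 1 := by linarith
        have := lt_of_mul_lt_mul_left this hpn.le
        rw [hMq y k (by linarith) (by linarith [htm.2])]

end Mesh

section LamSum

variable {S : Type*} [MetricSpace S] [Surf S]

theorem PCoc.smul {c : S → S → ZMod 2} {v : S} (h : PCoc c v) (a : ZMod 2) : PCoc (a • c) v := by
  rcases zmod_cases a with rfl | rfl
  · rw [zero_smul]; exact (cocF_zero _).pcoc
  · rwa [one_smul]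

theorem lam_zero (v : S) : lam (0 : S → S → ZMod 2) v = 0 := lam_eq_zero.2 (cocF_zero _).lt

theorem lam_smul (c : S → S → ZMod 2) (v : S) (a : ZMod 2) : lam (a • c) v = a * lam c v := by
  rcases zmod_cases a with rfl | rfl
  · rw [zero_smul, lam_zero, zero_mul]
  · rw [one_smul, one_mul]

theorem PCoc.sum {ι : Type*} {T : Finset ι} {f : ι → S → S → ZMod 2} {v : S}
    (h : ∀ i ∈ T, PCoc (f i) v) : PCoc (∑ i ∈ T, f i) v := by
  classical
  induction T using Finset.induction_on with
  | empty => exact (cocF_zero _).pcoc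
  | insert i T hi ih =>
    rw [Finset.sum_insert hi]
    exact (h i (Finset.mem_insert_self _ _)).add
      (ih fun k hk => h k (Finset.mem_insert_of_mem hk))

theorem lam_sum {ι : Type*} {T : Finset ι} {f : ι → S → S → ZMod 2} {v : S}
    (h : ∀ i ∈ T, PCoc (f i) v) : lam (∑ i ∈ T, f i) v = ∑ i ∈ T, lam (f i) v := by
  classical
  induction T using Finset.induction_on with
  | empty => exact lam_zero v
  | insert i T hi ih =>
    have h' : ∀ k ∈ T, PCoc (f k) v := fun k hk => h k (Finset.mem_insert_of_mem hk)
    rw [Finset.sum_insert hi, Finset.sum_insert hi,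
      lam_add (h i (Finset.mem_insert_self _ _)) (PCoc.sum h'), ih h']

theorem Triv.smul {c : S → S → ZMod 2} {K : Set S} (h : Triv c K) (a : ZMod 2) :
    Triv (a • c) K := by
  rcases zmod_cases a with rfl | rfl
  · rw [zero_smul]; exact triv_zero _
  · rwa [one_smul]

theorem Triv.sum {ι : Type*} {T : Finset ι} {f : ι → S → S → ZMod 2} {K : Set S}
    (h : ∀ i ∈ T, Triv (f i) K) : Triv (∑ i ∈ T, f i) K := by
  classical
  induction T using Finset.induction_on with
  | empty => exact triv_zero _
  | insert i T hi ih =>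
    rw [Finset.sum_insert hi]
    exact (h i (Finset.mem_insert_self _ _)).add
      (ih fun k hk => h k (Finset.mem_insert_of_mem hk))

theorem PCoc.of_coc {c : S → S → ZMod 2} {U : Set S} (hU : IsOpen U) {Q : Finset S}
    (h : Coc c (U \ Q)) {v : S} (hv : v ∈ U) : PCoc c v := by
  classical
  refine Coc.pcoc (U := U \ (Q.erase v : Finset S)) (hU.sdiff (Finset.finite_toSet _).isClosed)
    ⟨hv, by simp⟩ (h.mono ?_)
  rintro x ⟨⟨hx, hxQ⟩, hxv⟩
  exact ⟨hx, fun h => hxQ (by simpa [show x ≠ v from hxv] using h)⟩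

theorem lam_eq_zero_of_coc {c : S → S → ZMod 2} {U : Set S} (h : Coc c U) {v : S} (hv : v ∈ U) :
    lam c v = 0 := lam_eq_zero.2 (h v hv).lt

end LamSum

section Monodromy

noncomputable def Eat (q : ℂ) : ℂ → ℂ → ZMod 2 := pull (fun z => z - q) E0

theorem coc_Eat (q : ℂ) : Coc (Eat q) {q}ᶜ :=
  coc_E0.pull (by fun_prop) fun z hz => by simpa [sub_eq_zero] using hz

theorem pcoc_Eat (q v : ℂ) : PCoc (Eat q) v :=
  PCoc.of_coc (Q := {q}) isOpen_univ ((coc_Eat q).mono (by simp)) (mem_univ v)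

theorem lam_E0 : lam E0 0 = 1 :=
  lam_eq_one.2 (not_lt_of_spheres one_pos fun r hr _ => not_triv_E0 hr)

theorem lam_Eat (q v : ℂ) : lam (Eat q) v = if v = q then 1 else 0 := by
  split_ifs with h
  · subst h
    have := lam_pull (c := E0) (Homeomorph.subRight v).isOpenEmbedding (y := v)
    rw [Homeomorph.coe_subRight, show (fun x => x - v) v = 0 from sub_self v, lam_E0] at this
    exact this
  · exact lam_eq_zero_of_coc (coc_Eat q) h

/-- A cocycle on a disc without branching at points of the finite set `Q` is trivial. -/
theorem triv_ball_of_lam {c : ℂ → ℂ → ZMod 2} {R : ℝ} (hR : 0 < R) {Q : Finset ℂ}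
    (hc : Coc c (ball 0 R \ Q)) (hQ : ∀ q ∈ Q, q ∈ ball (0:ℂ) R → lam c q = 0) :
    Triv c (ball 0 R \ Q) := by
  obtain ⟨c', h1, h2⟩ := exists_unbranched isOpen_ball Q hc fun q h h' => lam_eq_zero.1 (hQ q h h')
  have h3 := triv_starConvex isOpen_ball (mem_ball_self hR)
    ((convex_ball (0:ℂ) R).starConvex (mem_ball_self hR)) h1
  have := h2.add (h3.mono sdiff_subset)
  rwa [coch_add_cancel] at this

/-- Moving the branch points of a cocycle to the origin. -/
theorem triv_sphere_of_lam {c : ℂ → ℂ → ZMod 2} {R : ℝ} (hR : 1 < R) {Q : Finset ℂ}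
    (hc : Coc c (ball 0 R \ Q)) (hQ : ∀ q ∈ Q, ‖q‖ < 1) :
    Triv (c + (∑ q ∈ Q, lam c q) • E0) (sphere 0 1) := by
  classical
  have hR0 : 0 < R := by linarith
  have hQR : ∀ q ∈ Q, q ∈ ball (0:ℂ) R := fun q h => mem_ball_zero_iff.2 ((hQ q h).trans hR)
  have hsub : ∀ P : Finset ℂ, (∀ q ∈ P, ‖q‖ < 1) → sphere (0:ℂ) 1 ⊆ ball 0 R \ P := by
    intro P hP z hz
    rw [mem_sphere_zero_iff_norm] at hz
    refine ⟨mem_ball_zero_iff.2 (hz ▸ hR), fun h => ?_⟩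
    have := hP z h
    rw [hz] at this
    exact lt_irrefl _ this
  have h1 : Triv (c + ∑ q ∈ Q, lam c q • Eat q) (sphere 0 1) := by
    refine (triv_ball_of_lam hR0 (Q := Q) ?_ ?_).mono (hsub Q hQ)
    · refine hc.add fun x hx => ?_
      have : ∀ P ⊆ Q, CocF (∑ q ∈ P, lam c q • Eat q) (𝓝 x) := by
        intro P
        induction P using Finset.induction_on with
        | empty => intro _; exact cocF_zero _
        | insert i T hi ih =>
          intro h
          rw [Finset.sum_insert hi]
          refine CocF.add ?_ (ih ((Finset.subset_insert _ _).trans h))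
          rcases zmod_cases (lam c i) with h' | h' <;> rw [h']
          · rw [zero_smul]; exact cocF_zero _
          · rw [one_smul]
            exact coc_Eat i x fun h'' => hx.2 (by rw [h'']; exact h (Finset.mem_insert_self _ _))
      exact this Q subset_rfl
    · intro q hq hqR
      rw [lam_add (PCoc.of_coc isOpen_ball hc hqR) (PCoc.sum fun i _ => (pcoc_Eat i q).smul _),
        lam_sum fun i _ => (pcoc_Eat i q).smul _]
      simp only [lam_smul, lam_Eat, mul_ite, mul_one, mul_zero]
      rw [Finset.sum_ite_eq, if_pos hq, zmod_add_self]
  have h2 : ∀ q ∈ Q, Triv (Eat q + E0) (sphere 0 1) := by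
    intro q hq
    by_cases hq0 : q = 0
    · subst hq0
      have : Eat 0 = E0 := by funext x y; simp [Eat, pull]
      rw [this, coch_add_self]
      exact triv_zero _
    have hseg := coc_segE (IsOpenEmbedding.id (X := ℂ)) hq0
    have hE0 : ∀ v, PCoc E0 v := fun v =>
      PCoc.of_coc (Q := {0}) isOpen_univ (coc_E0.mono (by simp)) (mem_univ v)
    have hps : ∀ v, PCoc (segE id q 0 hq0) v := fun v =>
      PCoc.of_coc (Q := {q, 0}) isOpen_univ (hseg.mono (by simp [compl_eq_univ_sdiff])) (mem_univ v)
    have h3 : Triv (Eat q + E0 + segE id q 0 hq0) (sphere 0 1) := by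
      refine (triv_ball_of_lam hR0 (Q := {q, 0}) ?_ ?_).mono (hsub {q, 0} ?_)
      · refine (Coc.add ?_ ?_).add ?_
        · exact (coc_Eat q).mono fun x hx h => hx.2 (by simp [mem_singleton_iff.1 h])
        · exact coc_E0.mono fun x hx h => hx.2 (by simp [mem_singleton_iff.1 h])
        · exact hseg.mono fun x hx h => hx.2 (by simpa using h)
      · intro v hv _
        rw [lam_add ((pcoc_Eat q v).add (hE0 v)) (hps v), lam_add (pcoc_Eat q v) (hE0 v), lam_Eat]
        simp only [Finset.mem_insert, Finset.mem_singleton] at hv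
        rcases hv with rfl | rfl
        · have := lam_segE_left (IsOpenEmbedding.id (X := ℂ)) hq0
          simp only [id] at this
          rw [this, if_pos rfl, lam_eq_zero_of_coc coc_E0 hq0]; decide
        · have := lam_segE_right (IsOpenEmbedding.id (X := ℂ)) hq0
          simp only [id] at this
          rw [this, if_neg (Ne.symm hq0), lam_E0]; decide
      · simp [hQ q hq]
    have h4 : Triv (segE id q 0 hq0) (sphere 0 1) := by
      refine ⟨0, secOn_of_nhds fun x hx => segE_zero IsOpenEmbedding.id hq0 ?_⟩
      rw [image_id]
      intro h
      have := (convex_ball (0:ℂ) 1).segment_subset (mem_ball_zero_iff.2 (hQ q hq))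
        (mem_ball_self one_pos) h
      rw [mem_sphere_zero_iff_norm] at hx
      rw [mem_ball_zero_iff] at this
      linarith
    have := h3.add h4
    rwa [coch_add_cancel] at this
  have h3 := h1.add (Triv.sum fun q hq => (h2 q hq).smul (lam c q))
  convert h3 using 1
  rw [Finset.sum_smul, add_assoc, ← Finset.sum_add_distrib]
  congr 1
  refine Finset.sum_congr rfl fun q _ => ?_
  rw [smul_add, ← add_assoc, coch_add_self, zero_add]

end Monodromy

section Collapse

variable {X : Type*} [MetricSpace X]

theorem uniform_of_smallSets {P : Set X → Prop} (hP : ∀ U V, U ⊆ V → P V → P U) {K : Set X}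
    (hK : IsCompact K) (h : ∀ x ∈ K, ∀ᶠ V in (𝓝 x).smallSets, P V) :
    ∃ δ > 0, ∀ x ∈ K, P (ball x δ) := by
  have h' : ∀ x : K, ∃ V, IsOpen V ∧ x.1 ∈ V ∧ P V := fun x => by
    obtain ⟨V, hV, H⟩ := (eventually_smallSets' fun U V => hP U V).1 (h x x.2)
    obtain ⟨W, hWV, hW, hx⟩ := _root_.mem_nhds_iff.1 hV
    exact ⟨W, hW, hx, hP _ _ hWV H⟩
  choose V hV hx H using h'
  obtain ⟨δ, hδ, h⟩ := lebesgue_number_lemma_of_metric hK hV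
    fun x hx' => mem_iUnion.2 ⟨⟨x, hx'⟩, hx _⟩
  exact ⟨δ, hδ, fun x hx => (h x hx).elim fun i hi => hP _ _ hi (H i)⟩

/-- The cochain obtained from `c` by collapsing the unit disc along `M`. -/
noncomputable def collapse (c : ℂ → ℂ → ZMod 2) (M : ℂ → ℂ) : ℂ → ℂ → ZMod 2 := fun x y =>
  if ‖x‖ ≤ 1 ∧ ‖y‖ ≤ 1 then 0
  else c (if ‖x‖ ≤ 1 then M x else x) (if ‖y‖ ≤ 1 then M y else y)

/-- The correction term near the unit circle. -/
noncomputable def collapseK (c : ℂ → ℂ → ZMod 2) (M : ℂ → ℂ) : ℂ → ℂ → ZMod 2 := fun x y =>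
  if ‖x‖ ≤ 1 ∧ ‖y‖ ≤ 1 then c (M x) (M y) else 0

theorem collapse_sec {c : ℂ → ℂ → ZMod 2} {M : ℂ → ℂ} {x : ℂ} {V : Set ℂ} (hxV : x ∈ V)
    (hc : ∀ y ∈ V, ∀ z ∈ V, ∀ w ∈ V, c y z + c z w = c y w) (hV : V ∈ 𝓝 x)
    (hM : ∀ᶠ y in 𝓝 x, M y ∈ V) :
    SecF (collapse c M + collapseK c M) (fun y => c x (if ‖y‖ ≤ 1 then M y else y)) (𝓝 x) := by
  refine secF_iff.2 ⟨V ∩ {y | M y ∈ V}, inter_mem hV hM, ?_⟩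
  intro y hy z hz
  have key : ∀ u ∈ V ∩ {y | M y ∈ V}, (if ‖u‖ ≤ 1 then M u else u) ∈ V := by
    intro u hu; split_ifs; exacts [hu.2, hu.1]
  have h1 := hc _ (key y hy) _ hxV _ (key z hz)
  have h2 := hc _ (key y hy) _ hxV _ (key y hy)
  have h3 := hc _ (key y hy) _ (key y hy) _ (key y hy)
  have h4 : (collapse c M + collapseK c M) y z =
      c (if ‖y‖ ≤ 1 then M y else y) (if ‖z‖ ≤ 1 then M z else z) := by
    simp only [Pi.add_apply, collapse, collapseK]
    split_ifs <;> simp_all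
  rw [h4]
  grind

theorem collapseK_zero {c : ℂ → ℂ → ZMod 2} {M : ℂ → ℂ} {x : ℂ}
    (hM : ∀ᶠ y in 𝓝 x, M y = M x) (hc : c (M x) (M x) = 0) : SecF (collapseK c M) 0 (𝓝 x) := by
  filter_upwards [hM.smallSets] with V hV y hy z hz
  simp [collapseK, hV y hy, hV z hz, hc]

noncomputable def vertH (v : ℂ) (hv : v ≠ 0) : ℂ ≃ₜ ℂ :=
  (Homeomorph.mulRight₀ v⁻¹ (inv_ne_zero hv)).trans (Homeomorph.subLeft 1)

theorem vertH_apply (v : ℂ) (hv : v ≠ 0) (y : ℂ) : vertH v hv y = 1 - y / v := rfl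

theorem lam_vertH (v : ℂ) (hv : v ≠ 0) : lam (pull (vertH v hv) E0) v = 1 := by
  rw [lam_pull (vertH v hv).isOpenEmbedding, vertH_apply, div_self hv, sub_self, lam_E0]

theorem lam_collapseK {c : ℂ → ℂ → ZMod 2} {M : ℂ → ℂ} {v p q : ℂ} (hv : ‖v‖ = 1)
    (hM : ∀ᶠ y in 𝓝 v, M y = if 0 < (y / v).im then p else q) (hpp : c p p = 0) (hqq : c q q = 0)
    (hpq : c q p = c p q) : lam (collapseK c M) v = c q p := by
  have hv0 : v ≠ 0 := fun h => by simp [h] at hv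
  obtain ⟨W, hW, hWo, hvW⟩ := _root_.eventually_nhds_iff.1 (hM.and (show ∀ᶠ y in 𝓝 v, 0 < (y / v).re from
    ((Complex.continuous_re.comp (continuous_id.div_const v)).continuousAt).eventually
      (Ioi_mem_nhds (by simp [hv0]))))
  have himc : Continuous fun y : ℂ => (y / v).im :=
    Complex.continuous_im.comp (continuous_id.div_const v)
  have hrec : Continuous fun y : ℂ => (y / v).re :=
    Complex.continuous_re.comp (continuous_id.div_const v)
  have hnorm : ∀ y : ℂ, ‖y‖ = ‖y / v‖ := fun y => by rw [norm_div, hv, div_one]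
  have hval : ∀ y ∈ W, ∀ z ∈ W, c (M y) (M z) = c q p *
      ((if 0 < (y / v).im then 1 else 0) + (if 0 < (z / v).im then 1 else 0)) := by
    intro y hy z hz
    rw [(hW y hy).1, (hW z hz).1]
    split_ifs <;> simp [hpp, hqq, hpq, zmod_add_self]
  have hE : ∀ y z, pull (vertH v hv0) E0 y z = if (y / v).re < 1 then
      ((if 0 < (y / v).im then 1 else 0) + (if 0 < (z / v).im then 1 else 0)) else 0 := by
    intro y z
    have h1 : vertH v hv0 y ∈ rightHalf ↔ (y / v).re < 1 := by
      change 0 < (1 - y / v).re ↔ _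
      simp
    have h2 : ∀ y, uH (vertH v hv0 y) = 1 + if 0 < (y / v).im then 1 else 0 := by
      intro y
      rw [uH, vertH_apply]
      by_cases h : 0 < (y / v).im
      · rw [if_pos h, if_neg (by simpa using h)]; decide
      · rw [if_neg h, if_pos (by simpa using h)]; decide
    simp only [pull, slit, h1, h2]
    refine if_congr Iff.rfl ?_ rfl
    grind
  have hloc : ∀ a : ZMod 2, a = c q p → Triv (collapseK c M + a • pull (vertH v hv0) E0) (W \ {v}) := by
    intro a ha
    refine ⟨0, secOn_of_nhds fun x hx => ?_⟩
    suffices ∀ᶠ V in (𝓝 x).smallSets, ∀ y ∈ V, ∀ z ∈ V,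
        collapseK c M y z = a * pull (vertH v hv0) E0 y z by
      filter_upwards [this] with V hV y hy z hz
      simp only [Pi.add_apply, Pi.smul_apply, smul_eq_mul, hV y hy z hz, zmod_add_self, Pi.zero_apply]
    have hWx : W ∈ 𝓝 x := hWo.mem_nhds hx.1
    by_cases him : (x / v).im = 0
    · have hne : (x / v).re ≠ 1 := fun h => hx.2 <| by
        have : x / v = 1 := Complex.ext h him
        rwa [div_eq_one_iff_eq hv0] at this
      have habs : ‖x‖ = (x / v).re := by
        rw [hnorm, show x / v = ((x / v).re : ℂ) from Complex.ext rfl (by simpa using him)]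
        rw [Complex.norm_real, Complex.ofReal_re, Real.norm_of_nonneg (hW x hx.1).2.le]
      rcases lt_or_gt_of_ne hne with h | h
      · have h1 : ∀ᶠ y in 𝓝 x, ‖y‖ < 1 :=
          (isOpen_lt continuous_norm continuous_const).mem_nhds (show ‖x‖ < 1 by rwa [habs])
        have h2 : ∀ᶠ y in 𝓝 x, (y / v).re < 1 := (isOpen_lt hrec continuous_const).mem_nhds h
        filter_upwards [h1.smallSets, h2.smallSets, Eventually.smallSets hWx] with V h1 h2 hV y hy z hz
        rw [hE, if_pos (h2 y hy), collapseK, if_pos ⟨(h1 y hy).le, (h1 z hz).le⟩,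
          hval y (hV y hy) z (hV z hz), ha]
      · have h1 : ∀ᶠ y in 𝓝 x, 1 < ‖y‖ :=
          (isOpen_lt continuous_const continuous_norm).mem_nhds (show 1 < ‖x‖ by rwa [habs])
        have h2 : ∀ᶠ y in 𝓝 x, 1 < (y / v).re := (isOpen_lt continuous_const hrec).mem_nhds h
        filter_upwards [h1.smallSets, h2.smallSets] with V h1 h2 y hy z hz
        rw [hE, if_neg (h2 y hy).not_gt, collapseK, if_neg fun h => (h1 y hy).not_ge h.1, mul_zero]
    · have h1 : ∀ᶠ y in 𝓝 x, (0 < (y / v).im ↔ 0 < (x / v).im) := by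
        rcases lt_or_gt_of_ne him with h | h
        · filter_upwards [(isOpen_lt himc continuous_const).mem_nhds h] with y hy
          exact iff_of_false (not_lt.2 (le_of_lt hy)) h.not_gt
        · filter_upwards [(isOpen_lt continuous_const himc).mem_nhds h] with y hy
          exact iff_of_true hy h
      filter_upwards [h1.smallSets, Eventually.smallSets hWx] with V h1 hV y hy z hz
      rw [hE, collapseK, hval y (hV y hy) z (hV z hz)]
      simp only [h1 y hy, h1 z hz, zmod_add_self, mul_zero, ite_self]
  have hWv : W ∈ 𝓝 v := hWo.mem_nhds hvW
  have := hloc (c q p) rfl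
  rw [lam_congr (d := c q p • pull (vertH v hv0) E0) ⟨W, hWv, this⟩, lam_smul, lam_vertH, mul_one]

theorem exists_collapse {c : ℂ → ℂ → ZMod 2} {R : ℝ} (hR : 1 < R) {Q : Finset ℂ}
    (hc : Coc c (ball 0 R \ Q)) (hQ : ∀ q ∈ Q, ‖q‖ < 1) {K : Set ℂ} (hK : IsClosed K)
    (hK0 : ∀ x ∈ K, SecF c 0 (𝓝 x)) :
    ∃ (c' : ℂ → ℂ → ZMod 2) (P : Finset ℂ), (∀ x y, 1 < ‖x‖ → 1 < ‖y‖ → c' x y = c x y) ∧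
      (∀ p ∈ P, ‖p‖ = 1) ∧ (∀ x, ‖x‖ ≤ 1 → x ∉ P → CocF c' (𝓝 x)) ∧
      (∀ x, ‖x‖ < 1 → SecF c' 0 (𝓝 x)) ∧ (∀ x ∈ K, ‖x‖ ≤ 1 → SecF c' 0 (𝓝 x)) ∧
      ∑ p ∈ P, lam c' p = ∑ q ∈ Q, lam c q := by
  classical
  have hcirc : Coc c (sphere 0 1) := hc.mono fun z hz => by
    rw [mem_sphere_zero_iff_norm] at hz
    exact ⟨mem_ball_zero_iff.2 (hz ▸ hR), fun h => (hQ z h).ne hz⟩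
  have hcs : IsCompact (sphere (0:ℂ) 1) := isCompact_sphere _ _
  obtain ⟨δ₁, hδ₁, h1⟩ := hcirc.uniform hcs
  obtain ⟨δ₂, hδ₂, h2⟩ := uniform_of_smallSets
    (P := fun V => ∀ y ∈ V, ∀ z ∈ V, c y z = 0)
    (fun U V h H y hy z hz => H y (h hy) z (h hz)) (hcs.inter_right hK) (fun x hx => by
      filter_upwards [hK0 x hx.2] with V hV y hy z hz
      simpa using hV y hy z hz)
  obtain ⟨s, hs⟩ := triv_sphere_of_lam hR hc hQ
  obtain ⟨δ₃, hδ₃, h3⟩ := hs.uniform hcs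
  set ε := min δ₁ (min δ₂ δ₃) with hε
  have hε0 : 0 < ε := by positivity
  obtain ⟨μ⟩ := exists_mesh hε0
  have hε1 : ε ≤ δ₁ := min_le_left _ _
  have hε2 : ε ≤ δ₂ := (min_le_right _ _).trans (min_le_left _ _)
  have hε3 : ε ≤ δ₃ := (min_le_right _ _).trans (min_le_right _ _)
  have hvS : ∀ k, μ.v k ∈ sphere (0:ℂ) 1 := fun k => mem_sphere_zero_iff_norm.2 (μ.v_norm k)
  have hmS : ∀ k, μ.m k ∈ sphere (0:ℂ) 1 := fun k => mem_sphere_zero_iff_norm.2 (μ.m_norm k)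
  have hl : ∀ k, μ.m k ∈ ball (μ.v k) ε := fun k => μ.dist_l k
  have hr : ∀ k, μ.m (k + 1) ∈ ball (μ.v k) ε := fun k => μ.dist_r k
  have hMnear : ∀ x, ‖x‖ = 1 → ∀ᶠ y in 𝓝 x, μ.M y ∈ ball x ε := by
    intro x hx
    by_cases h : ∃ k < μ.n, x = μ.v k
    · obtain ⟨k, hk, rfl⟩ := h
      filter_upwards [μ.M_vert k hk] with y hy
      rw [hy]
      split_ifs
      exacts [hr k, hl k]
    · push Not at h
      filter_upwards [μ.M_const x hx h] with y hy
      rw [hy]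
      exact μ.M_dist x hx
  have hcoc : ∀ x, ‖x‖ = 1 → ∀ y ∈ ball x ε, ∀ z ∈ ball x ε, ∀ w ∈ ball x ε,
      c y z + c z w = c y w := fun x hx y hy z hz w hw =>
    h1 x (mem_sphere_zero_iff_norm.2 hx) y (ball_subset_ball hε1 hy) z (ball_subset_ball hε1 hz)
      w (ball_subset_ball hε1 hw)
  have hself : ∀ x, ‖x‖ = 1 → c x x = 0 := fun x hx => by
    have h := mem_ball_self (x := x) hε0
    have := hcoc x hx x h x h x h
    grind
  have hsec : ∀ x, ‖x‖ = 1 → CocF (collapse c μ.M + collapseK c μ.M) (𝓝 x) := fun x hx =>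
    (collapse_sec (mem_ball_self hε0) (hcoc x hx) (ball_mem_nhds x hε0) (hMnear x hx)).cocF
  have hinn : ∀ x : ℂ, ‖x‖ < 1 → SecF (collapse c μ.M) 0 (𝓝 x) := by
    intro x hx
    have : ∀ᶠ y : ℂ in 𝓝 x, ‖y‖ < 1 := (isOpen_lt continuous_norm continuous_const).mem_nhds hx
    filter_upwards [this.smallSets] with V hV y hy z hz
    simp [collapse, (hV y hy).le, (hV z hz).le]
  refine ⟨collapse c μ.M, (Finset.range μ.n).image μ.v, ?_, ?_, ?_, hinn, ?_, ?_⟩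
  · intro x y hx hy
    simp [collapse, hx.not_ge, hy.not_ge]
  · intro p hp
    obtain ⟨k, -, rfl⟩ := Finset.mem_image.1 hp
    exact μ.v_norm k
  · intro x hx hxP
    rcases hx.lt_or_eq with hx | hx
    · exact (hinn x hx).cocF
    · have hconst := μ.M_const x hx fun k hk h =>
        hxP (Finset.mem_image.2 ⟨k, Finset.mem_range.2 hk, h.symm⟩)
      have hMx : c (μ.M x) (μ.M x) = 0 := by
        have h := (hMnear x hx).self_of_nhds
        have := hcoc x hx _ h _ h _ h
        grind
      have := (hsec x hx).add (collapseK_zero hconst hMx).cocF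
      rwa [coch_add_cancel] at this
  · intro x hxK hx
    rcases hx.lt_or_eq with hx | hx
    · exact hinn x hx
    · refine secF_iff.2 ⟨ball x ε ∩ {y | μ.M y ∈ ball x ε},
        inter_mem (ball_mem_nhds x hε0) (hMnear x hx), ?_⟩
      intro y hy z hz
      have key : ∀ u ∈ ball x ε ∩ {y | μ.M y ∈ ball x ε},
          (if ‖u‖ ≤ 1 then μ.M u else u) ∈ ball x δ₂ := by
        intro u hu; split_ifs; exacts [ball_subset_ball hε2 hu.2, ball_subset_ball hε2 hu.1]
      have := h2 x ⟨mem_sphere_zero_iff_norm.2 hx, hxK⟩ _ (key y hy) _ (key z hz)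
      simp only [collapse, this, ite_self, Pi.zero_apply, add_zero]
  · have hlam : ∀ k ∈ Finset.range μ.n, lam (collapse c μ.M) (μ.v k) =
        (∑ q ∈ Q, lam c q) * E0 (μ.m k) (μ.m (k + 1)) + (s (μ.m k) + s (μ.m (k + 1))) := by
      intro k hk
      have hk := Finset.mem_range.1 hk
      have hn := μ.v_norm k
      rw [lam_congr (hsec _ hn).lt, lam_collapseK hn (μ.M_vert k hk) (hself _ (μ.m_norm _))
        (hself _ (μ.m_norm _))]
      · have := h3 (μ.v k) (hvS k) (μ.m k) ⟨ball_subset_ball hε3 (hl k), hmS k⟩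
          (μ.m (k + 1)) ⟨ball_subset_ball hε3 (hr k), hmS _⟩
        simp only [Pi.add_apply, Pi.smul_apply, smul_eq_mul] at this
        grind
      · have h4 := hcoc _ hn _ (hl k) _ (hr k) _ (hl k)
        have h5 := hself _ (μ.m_norm k)
        grind
    rw [Finset.sum_image fun k hk l hl h => μ.v_inj k (Finset.mem_range.1 hk) l
      (Finset.mem_range.1 hl) h, Finset.sum_congr rfl hlam, Finset.sum_add_distrib,
      ← Finset.mul_sum, μ.sum_E0, mul_one]
    have htel : ∀ n, ∑ k ∈ Finset.range n, (s (μ.m k) + s (μ.m (k + 1))) = s (μ.m 0) + s (μ.m n) := by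
      intro n
      induction n with
      | zero => simp [zmod_add_self]
      | succ n ih => rw [Finset.sum_range_succ, ih]; grind
    rw [htel, μ.m_per, zmod_add_self, add_zero]

end Collapse

section Parity

variable {S : Type*} [MetricSpace S] [Surf S]

open Classical in
noncomputable def graft (j : ℂ → S) (e : ℂ → ℂ → ZMod 2) (c : S → S → ZMod 2) :
    S → S → ZMod 2 := fun x y =>
  if x ∈ range j ∧ y ∈ range j then e (Function.invFun j x) (Function.invFun j y) else c x y

theorem pull_graft {j : ℂ → S} (hj : Function.Injective j) (e : ℂ → ℂ → ZMod 2)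
    (c : S → S → ZMod 2) : pull j (graft j e c) = e := by
  funext x y
  simp [pull, graft, Function.leftInverse_invFun hj _]

theorem isCompact_disc {j : ℂ → S} (hj : IsOpenEmbedding j) (r : ℝ) :
    IsCompact (j '' closedBall 0 r) := (isCompact_closedBall 0 r).image hj.continuous

theorem parity_step_aux {c : S → S → ZMod 2} {Q : Finset S} (hc : Coc c (Q : Set S)ᶜ) {j : ℂ → S}
    (hj : IsOpenEmbedding j) (hQ : ∀ z : ℂ, ‖z‖ = 1 → j z ∉ Q) {K : Set S} (hK : IsClosed K)
    (hK0 : ∀ x ∈ K, SecF c 0 (𝓝 x)) :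
    ∃ (c' : S → S → ZMod 2) (Q' : Finset S), Coc c' (Q' : Set S)ᶜ ∧
      ∑ v ∈ Q', lam c' v = ∑ v ∈ Q, lam c v ∧ (∀ x ∈ K, SecF c' 0 (𝓝 x)) ∧
      (∀ x ∈ j '' ball 0 1, SecF c' 0 (𝓝 x)) := by
  classical
  set Qp : Finset ℂ := Q.preimage j hj.injective.injOn with hQp
  have hmemp : ∀ z, z ∈ Qp ↔ j z ∈ Q := fun z => Finset.mem_preimage
  obtain ⟨ε, hε, hεQ⟩ : ∃ ε > 0, ∀ z ∈ Qp, ε ≤ |‖z‖ - 1| := by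
    have h1 : (1:ℝ) ∈ ((Qp.image norm : Finset ℝ) : Set ℝ)ᶜ := by
      intro h
      obtain ⟨z, hz, h⟩ := Finset.mem_image.1 (Finset.mem_coe.1 h)
      exact hQ z h ((hmemp z).1 hz)
    obtain ⟨ε, hε, h⟩ := Metric.isOpen_iff.1 (Finset.finite_toSet _).isClosed.isOpen_compl 1 h1
    refine ⟨ε, hε, fun z hz => ?_⟩
    by_contra! hlt
    exact h (show ‖z‖ ∈ ball 1 ε by rwa [mem_ball, Real.dist_eq])
      (Finset.mem_coe.2 (Finset.mem_image_of_mem _ hz))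
  set Qi : Finset ℂ := Qp.filter (fun z => ‖z‖ < 1) with hQi
  have hcp : Coc (pull j c) (ball 0 (1 + ε) \ Qi) := by
    refine hc.pull hj.continuous fun z hz h => hz.2 ?_
    have h1 := hεQ z ((hmemp z).2 h)
    have h2 := mem_ball_zero_iff.1 hz.1
    refine Finset.mem_coe.2 (Finset.mem_filter.2 ⟨(hmemp z).2 h, ?_⟩)
    by_contra! h3
    rw [abs_of_nonneg (by linarith)] at h1
    linarith
  obtain ⟨e, P, he, hP, hcoc, hinn, hKe, hsum⟩ := exists_collapse (by linarith) hcp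
    (fun q hq => (Finset.mem_filter.1 hq).2) (hK.preimage hj.continuous)
    (fun x hx => (hK0 _ hx).pull hj.continuous.continuousAt)
  have hout : ∀ x ∉ j '' closedBall 0 1, SecF (graft j e c + c) 0 (𝓝 x) := by
    intro x hx
    filter_upwards [Eventually.smallSets
      ((isCompact_disc hj 1).isClosed.isOpen_compl.mem_nhds hx)] with V hV y hy z hz
    have : graft j e c y z = c y z := by
      rw [graft]
      split_ifs with h
      · obtain ⟨⟨a, rfl⟩, b, rfl⟩ := h
        rw [Function.leftInverse_invFun hj.injective, Function.leftInverse_invFun hj.injective]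
        refine he a b ?_ ?_
        · by_contra! h; exact hV _ hy ⟨a, mem_closedBall_zero_iff.2 h, rfl⟩
        · by_contra! h; exact hV _ hz ⟨b, mem_closedBall_zero_iff.2 h, rfl⟩
      · rfl
    simp [this, zmod_add_self]
  have hpg := pull_graft hj.injective e c
  have hin : ∀ z, SecF e 0 (𝓝 z) → SecF (graft j e c) 0 (𝓝 (j z)) := fun z hz =>
    SecF.of_pull hj (by rw [hpg]; exact hz)
  refine ⟨graft j e c, P.image j ∪ Q.filter (fun q => q ∉ j '' closedBall 0 1), ?_, ?_, ?_, ?_⟩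
  · intro x hx
    simp only [Finset.coe_union, Finset.coe_image, Finset.coe_filter, mem_compl_iff, mem_union,
      not_or] at hx
    by_cases h : x ∈ j '' closedBall 0 1
    · obtain ⟨z, hz, rfl⟩ := h
      refine CocF.of_pull hj ?_
      rw [hpg]
      exact hcoc z (mem_closedBall_zero_iff.1 hz) fun h => hx.1 ⟨z, h, rfl⟩
    · have := (hout x h).cocF.add (hc x fun h' => hx.2 ⟨h', h⟩)
      rwa [coch_add_cancel] at this
  · rw [Finset.sum_union, Finset.sum_image hj.injective.injOn,
      ← Finset.sum_filter_add_sum_filter_not Q (fun q => q ∈ j '' closedBall 0 1)]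
    · congr 1
      · have : Q.filter (fun q => q ∈ j '' closedBall 0 1) = Qi.image j := by
          ext x
          simp only [Finset.mem_filter, Finset.mem_image, hQi, hmemp]
          constructor
          · rintro ⟨h, z, hz, rfl⟩
            exact ⟨z, ⟨h, lt_of_le_of_ne (mem_closedBall_zero_iff.1 hz) fun h' => hQ z h' h⟩, rfl⟩
          · rintro ⟨z, ⟨h, h'⟩, rfl⟩
            exact ⟨h, z, mem_closedBall_zero_iff.2 h'.le, rfl⟩
        rw [this, Finset.sum_image hj.injective.injOn]
        calc _ = ∑ p ∈ P, lam e p :=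
              Finset.sum_congr rfl fun p _ => by rw [← lam_pull hj, hpg]
          _ = _ := by rw [hsum]; exact Finset.sum_congr rfl fun p _ => lam_pull hj
      · refine Finset.sum_congr rfl fun q hq => ?_
        exact lam_congr (hout q (Finset.mem_filter.1 hq).2).cocF.lt
    · rw [Finset.disjoint_left]
      intro x hx hx'
      obtain ⟨p, hp, rfl⟩ := Finset.mem_image.1 hx
      exact (Finset.mem_filter.1 hx').2 ⟨p, mem_closedBall_zero_iff.2 (hP p hp).le, rfl⟩
  · intro x hx
    by_cases h : x ∈ j '' closedBall 0 1
    · obtain ⟨z, hz, rfl⟩ := h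
      exact hin z (hKe z hx (mem_closedBall_zero_iff.1 hz))
    · have := (hout x h).add (hK0 x hx)
      rwa [coch_add_cancel, add_zero] at this
  · rintro _ ⟨z, hz, rfl⟩
    exact hin z (hinn z (mem_ball_zero_iff.1 hz))

/-- Rescaling a chart. -/
theorem isOpenEmbedding_scale {j : ℂ → S} (hj : IsOpenEmbedding j) {r : ℝ} (hr : r ≠ 0) :
    IsOpenEmbedding (fun z : ℂ => j (z * r)) :=
  hj.comp (Homeomorph.mulRight₀ (r : ℂ) (by exact_mod_cast hr)).isOpenEmbedding

theorem parity_step {c : S → S → ZMod 2} {Q : Finset S} (hc : Coc c (Q : Set S)ᶜ) {j : ℂ → S}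
    (hj : IsOpenEmbedding j) {K : Set S} (hK : IsClosed K)
    (hK0 : ∀ x ∈ K, SecF c 0 (𝓝 x)) :
    ∃ (c' : S → S → ZMod 2) (Q' : Finset S), Coc c' (Q' : Set S)ᶜ ∧
      ∑ v ∈ Q', lam c' v = ∑ v ∈ Q, lam c v ∧ (∀ x ∈ K, SecF c' 0 (𝓝 x)) ∧
      (∀ x ∈ j '' closedBall 0 1, SecF c' 0 (𝓝 x)) := by
  classical
  obtain ⟨r, ⟨hr1, hr2⟩, hr⟩ := ((Ioo_infinite (show (1:ℝ) < 2 by norm_num)).sdiff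
    (Finset.finite_toSet ((Q.preimage j hj.injective.injOn).image norm))).nonempty
  have hr0 : 0 < r := by linarith
  have hn : ∀ z : ℂ, ‖z * r‖ = ‖z‖ * r := fun z => by
    rw [norm_mul, Complex.norm_real, Real.norm_of_nonneg hr0.le]
  obtain ⟨c', Q', h1, h2, h3, h4⟩ := parity_step_aux hc (isOpenEmbedding_scale hj hr0.ne')
    (fun z hz h => hr (Finset.mem_coe.2 (Finset.mem_image.2
      ⟨z * r, Finset.mem_preimage.2 h, by rw [hn, hz, one_mul]⟩))) hK hK0
  refine ⟨c', Q', h1, h2, h3, ?_⟩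
  rintro _ ⟨z, hz, rfl⟩
  rw [mem_closedBall_zero_iff] at hz
  have hz' : z / r * r = z := div_mul_cancel₀ z (by exact_mod_cast hr0.ne')
  refine h4 _ ⟨z / r, ?_, by simp only [hz']⟩
  rw [mem_ball_zero_iff, norm_div, Complex.norm_real, Real.norm_of_nonneg hr0.le, div_lt_one hr0]
  linarith

/-- The number of branch points of a cocycle on a closed surface is even. -/
theorem parity [CompactSpace S] {c : S → S → ZMod 2} {Q : Finset S}
    (hc : Coc c (Q : Set S)ᶜ) : ∑ v ∈ Q, lam c v = 0 := by
  classical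
  choose j hj hj0 _ using fun x : S => Surf.chart x univ univ_mem
  obtain ⟨T, hT⟩ := isCompact_univ.elim_finite_subcover (fun x : S => j x '' ball 0 1)
    (fun x => (hj x).isOpenMap _ isOpen_ball)
    (fun x _ => mem_iUnion.2 ⟨x, 0, mem_ball_self one_pos, hj0 x⟩)
  have key : ∀ T : Finset S, ∃ (c' : S → S → ZMod 2) (Q' : Finset S), Coc c' (Q' : Set S)ᶜ ∧
      ∑ v ∈ Q', lam c' v = ∑ v ∈ Q, lam c v ∧
      ∀ x ∈ ⋃ i ∈ T, j i '' closedBall 0 1, SecF c' 0 (𝓝 x) := by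
    intro T
    induction T using Finset.induction_on with
    | empty => exact ⟨c, Q, hc, rfl, by simp⟩
    | insert i T hi ih =>
      obtain ⟨c', Q', h1, h2, h3⟩ := ih
      obtain ⟨c'', Q'', g1, g2, g3, g4⟩ := parity_step h1 (hj i)
        (T.finite_toSet.isClosed_biUnion fun i _ => (isCompact_disc (hj i) 1).isClosed) h3
      refine ⟨c'', Q'', g1, g2.trans h2, fun x hx => ?_⟩
      rw [Finset.set_biUnion_insert] at hx
      exact hx.elim (g4 x) (g3 x)
  obtain ⟨c', Q', h1, h2, h3⟩ := key T
  rw [← h2]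
  refine Finset.sum_eq_zero fun v _ => lam_eq_zero.2 (h3 v ?_).cocF.lt
  have := hT (mem_univ v)
  simp only [mem_iUnion] at this ⊢
  obtain ⟨i, hi, h⟩ := this
  exact ⟨i, hi, image_mono ball_subset_closedBall h⟩

end Parity

section Cup

variable {S : Type*} [MetricSpace S]

/-- `G` bounds the cup product of `c` and `d` on small sets of `l`. -/
def CupF (c d G : S → S → ZMod 2) (l : Filter S) : Prop :=
  ∀ᶠ V in l.smallSets, ∀ y ∈ V, ∀ z ∈ V, ∀ w ∈ V, c y z * d z w = G y z + G z w + G y w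

theorem CupF.add {c d G d' G' : S → S → ZMod 2} {l : Filter S} (h : CupF c d G l)
    (h' : CupF c d' G' l) : CupF c (d + d') (G + G') l := by
  filter_upwards [h, h'] with V h h' y hy z hz w hw
  have h1 := h y hy z hz w hw
  have h2 := h' y hy z hz w hw
  simp only [Pi.add_apply, mul_add, h1, h2]
  ring

/-- The function `y ↦ c v y` times a cochain. -/
def wt (a : S → ZMod 2) (d : S → S → ZMod 2) : S → S → ZMod 2 := fun y z => a y * d y z

theorem wt_add (a : S → ZMod 2) (d d' : S → S → ZMod 2) : wt a (d + d') = wt a d + wt a d' := by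
  funext y z; simp [wt, mul_add]

theorem cocF_wt {c d G : S → S → ZMod 2} {v : S} {V : Set S} {x : S} (hV : V ∈ 𝓝 x) (hv : v ∈ V)
    (hc : ∀ y ∈ V, ∀ z ∈ V, ∀ w ∈ V, c y z + c z w = c y w) (hd : CocF d (𝓝 x))
    (hG : CupF c d G (𝓝 x)) : CocF (G + wt (c v) d) (𝓝 x) := by
  filter_upwards [hd, hG, Eventually.smallSets hV] with W hd hG hW y hy z hz w hw
  have h1 := hd y hy z hz w hw
  have h2 := hG y hy z hz w hw
  have h3 := hc v hv y (hW _ hy) z (hW _ hz)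
  simp only [Pi.add_apply, wt]
  rw [← h3, ← h1]
  grind

theorem exists_nhd_cocycle {c : S → S → ZMod 2} (hc : Coc c univ) (v : S) :
    ∃ V, IsOpen V ∧ v ∈ V ∧ ∀ y ∈ V, ∀ z ∈ V, ∀ w ∈ V, c y z + c z w = c y w := by
  obtain ⟨V, hV, H⟩ := cocF_iff.1 (hc v (mem_univ v))
  obtain ⟨W, hWV, hW, hx⟩ := _root_.mem_nhds_iff.1 hV
  exact ⟨W, hW, hx, fun y hy z hz w hw => H y (hWV hy) z (hWV hz) w (hWV hw)⟩

theorem lam_wt_eq_zero {c d G : S → S → ZMod 2} (hc : Coc c univ) {v : S} (hd : CocF d (𝓝 v))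
    (hG : CupF c d G (𝓝 v)) : lam (G + wt (c v) d) v = 0 := by
  obtain ⟨V, hV, hv, H⟩ := exists_nhd_cocycle hc v
  exact lam_eq_zero.2 (cocF_wt (hV.mem_nhds hv) hv H hd hG).lt

variable [Surf S]

theorem pcoc_wt {c d G : S → S → ZMod 2} (hc : Coc c univ) {Q : Finset S}
    (hd : Coc d (Q : Set S)ᶜ) (hG : ∀ x ∉ Q, CupF c d G (𝓝 x)) (v : S) :
    PCoc (G + wt (c v) d) v := by
  obtain ⟨V, hV, hv, H⟩ := exists_nhd_cocycle hc v
  refine PCoc.of_coc (Q := Q) hV (fun x hx => ?_) hv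
  exact cocF_wt (hV.mem_nhds hx.1) hv H (hd x hx.2) (hG x hx.2)

/-- Chains from `x₀` to `x` with holonomy `h`. -/
def Chn (c : S → S → ZMod 2) (x₀ x : S) (h : ZMod 2) : Prop :=
  ∃ (Q : Finset S) (d G : S → S → ZMod 2), Coc d (Q : Set S)ᶜ ∧ (∀ v ∉ Q, CupF c d G (𝓝 v)) ∧
    (∀ v, lam d v = Set.indicator {x₀} 1 v + Set.indicator {x} 1 v) ∧
    ∑ v ∈ Q, lam (G + wt (c v) d) v = h

theorem chn_enlarge {c d G : S → S → ZMod 2} (hc : Coc c univ) {Q Q' : Finset S} (hQ : Q ⊆ Q')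
    (hd : Coc d (Q : Set S)ᶜ) (hG : ∀ x ∉ Q, CupF c d G (𝓝 x)) :
    ∑ v ∈ Q', lam (G + wt (c v) d) v = ∑ v ∈ Q, lam (G + wt (c v) d) v :=
  (Finset.sum_subset hQ fun v _ hv => lam_wt_eq_zero hc (hd v hv) (hG v hv)).symm

theorem chn_refl (c : S → S → ZMod 2) (x₀ : S) : Chn c x₀ x₀ 0 := by
  refine ⟨∅, 0, 0, fun _ _ => cocF_zero _, fun v _ => ?_, fun v => ?_, by simp⟩
  · exact Eventually.of_forall fun V y _ z _ w _ => by simp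
  · rw [zmod_add_self]; exact lam_eq_zero.2 (cocF_zero _).lt

theorem chn_sum_add {c d G d' G' : S → S → ZMod 2} (hc : Coc c univ) {Q Q' : Finset S}
    (hd : Coc d (Q : Set S)ᶜ) (hG : ∀ x ∉ Q, CupF c d G (𝓝 x))
    (hd' : Coc d' (Q' : Set S)ᶜ) (hG' : ∀ x ∉ Q', CupF c d' G' (𝓝 x)) [DecidableEq S] :
    Coc (d + d') ((Q ∪ Q' : Finset S) : Set S)ᶜ ∧
    (∀ x ∉ Q ∪ Q', CupF c (d + d') (G + G') (𝓝 x)) ∧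
    (∀ v, lam (d + d') v = lam d v + lam d' v) ∧
    ∑ v ∈ Q ∪ Q', lam (G + G' + wt (c v) (d + d')) v =
      ∑ v ∈ Q, lam (G + wt (c v) d) v + ∑ v ∈ Q', lam (G' + wt (c v) d') v := by
  refine ⟨?_, ?_, ?_, ?_⟩
  · exact (hd.mono (by simp)).add (hd'.mono (by simp))
  · intro x hx
    rw [Finset.mem_union, not_or] at hx
    exact (hG x hx.1).add (hG' x hx.2)
  · intro v
    exact lam_add (PCoc.of_coc isOpen_univ (by rwa [← compl_eq_univ_sdiff]) (mem_univ v))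
      (PCoc.of_coc isOpen_univ (by rwa [← compl_eq_univ_sdiff]) (mem_univ v))
  · rw [← chn_enlarge hc Finset.subset_union_left hd hG,
      ← chn_enlarge hc Finset.subset_union_right hd' hG', ← Finset.sum_add_distrib]
    refine Finset.sum_congr rfl fun v _ => ?_
    rw [← lam_add (pcoc_wt hc hd hG v) (pcoc_wt hc hd' hG' v), wt_add, add_add_add_comm]

theorem lam_segE {j : ℂ → S} (hj : IsOpenEmbedding j) {z w : ℂ} (h : z ≠ w) (v : S) :
    lam (segE j z w h) v = Set.indicator {j z} 1 v + Set.indicator {j w} 1 v := by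
  have hne : j z ≠ j w := fun h' => h (hj.injective h')
  by_cases h1 : v = j z
  · subst h1
    rw [lam_segE_left hj]
    simp [hne]
  · by_cases h2 : v = j w
    · subst h2
      rw [lam_segE_right hj]
      simp [hne.symm]
    · rw [lam_eq_zero_of_coc (coc_segE hj h) (by simp [h1, h2])]
      simp [h1, h2]

theorem triv_range {c : S → S → ZMod 2} {j : ℂ → S} (hj : IsOpenEmbedding j)
    (hc : Coc c (range j)) : Triv c (range j) := by
  rw [← image_univ]
  refine Triv.push hj.isEmbedding (triv_starConvex isOpen_univ (mem_univ 0)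
    (convex_univ.starConvex (mem_univ _)) (hc.pull hj.continuous fun z _ => ⟨z, rfl⟩))

theorem chn_step {c : S → S → ZMod 2} (hc : Coc c univ) {x₀ x y : S} {h : ZMod 2}
    (H : Chn c x₀ x h) {j : ℂ → S} (hj : IsOpenEmbedding j) (hx : x ∈ range j) (hy : y ∈ range j)
    {s : S → ZMod 2} (hs : SecOn c s (range j)) : Chn c x₀ y (h + s x + s y) := by
  classical
  obtain ⟨z, rfl⟩ := hx
  obtain ⟨w, rfl⟩ := hy
  by_cases hzw : z = w
  · subst hzw
    rwa [add_assoc, zmod_add_self, add_zero]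
  obtain ⟨Q, d, G, h1, h2, h3, h4⟩ := H
  have he := coc_segE hj hzw
  have hsF : ∀ v ∈ range j, SecF c s (𝓝 v) := fun v hv => hs.secF hj.isOpen_range hv
  have hcup : ∀ v ∉ ({j z, j w} : Finset S), CupF c (segE j z w hzw) (wt s (segE j z w hzw)) (𝓝 v) := by
    intro v hv
    by_cases hvs : v ∈ j '' segment ℝ z w
    · have hvr := image_subset_range _ _ hvs
      filter_upwards [hsF v hvr, he v (by simpa using hv)] with V hV hV' a ha b hb t ht
      have e1 := hV a ha b hb
      have e2 := hV' a ha b hb t ht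
      simp only [wt]
      rw [e1, ← e2]
      grind
    · filter_upwards [segE_zero hj hzw hvs] with V hV a ha b hb t ht
      simp [wt, hV a ha b hb, hV b hb t ht, hV a ha t ht]
  have he' : Coc (segE j z w hzw) (({j z, j w} : Finset S) : Set S)ᶜ := he.mono (by simp)
  obtain ⟨g1, g2, g3, g4⟩ := chn_sum_add hc h1 h2 he' hcup
  refine ⟨_, _, _, g1, g2, fun v => ?_, ?_⟩
  · rw [g3, h3, lam_segE hj]
    generalize Set.indicator {x₀} (1 : S → ZMod 2) v = a
    generalize Set.indicator {j z} (1 : S → ZMod 2) v = b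
    generalize Set.indicator {j w} (1 : S → ZMod 2) v = e
    revert a b e; decide
  · have hkey : ∀ v ∈ range j, lam (wt s (segE j z w hzw) + wt (c v) (segE j z w hzw)) v =
        s v * lam (segE j z w hzw) v := by
      intro v hv
      rw [← lam_smul]
      refine lam_congr (SecF.cocF (s := 0) ?_).lt
      obtain ⟨V, hV, H⟩ := secF_iff.1 (hsF v hv)
      refine secF_iff.2 ⟨V, hV, fun a ha b hb => ?_⟩
      simp only [Pi.add_apply, wt, Pi.smul_apply, smul_eq_mul, Pi.zero_apply]
      rw [H v (mem_of_mem_nhds hV) a ha]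
      grind
    rw [g4, h4, Finset.sum_pair (fun h => hzw (hj.injective h)), hkey _ ⟨z, rfl⟩, hkey _ ⟨w, rfl⟩,
      lam_segE_left hj, lam_segE_right hj, mul_one, mul_one, add_assoc]

end Cup

section CupTriv

variable {S : Type*} [MetricSpace S] [Surf S]

theorem exists_nhd_sdiff (Q : Finset S) (v : S) : ((Q : Set S) \ {v})ᶜ ∈ 𝓝 v :=
  ((Q.finite_toSet.sdiff).isClosed.isOpen_compl).mem_nhds (by simp)

theorem sum_lam_wt_eq_zero [CompactSpace S] {c D G : S → S → ZMod 2} (hc : Coc c univ)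
    (H : ∀ d, Coc d univ → ∃ F, ∀ v, CupF c d F (𝓝 v)) {Q : Finset S}
    (hD : Coc D (Q : Set S)ᶜ) (hG : ∀ v ∉ Q, CupF c D G (𝓝 v)) (hl : ∀ v, lam D v = 0) :
    ∑ v ∈ Q, lam (G + wt (c v) D) v = 0 := by
  obtain ⟨D', hD', s, hs⟩ := exists_unbranched isOpen_univ Q (by rwa [← compl_eq_univ_sdiff])
    (fun q _ _ => lam_eq_zero.1 (hl q))
  obtain ⟨F, hF⟩ := H D' hD'
  rw [← compl_eq_univ_sdiff] at hs
  have hQo : IsOpen ((Q : Set S)ᶜ) := Q.finite_toSet.isClosed.isOpen_compl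
  let M : S → S → ZMod 2 := fun y z => c y z * s z
  have hK : Coc (F + G + M) (Q : Set S)ᶜ := by
    intro x hx
    filter_upwards [hF x, hG x hx, hs.secF hQo hx, hc x (mem_univ x)] with V h1 h2 h3 h4 y hy z hz w hw
    have e1 := h1 y hy z hz w hw
    have e2 := h2 y hy z hz w hw
    have e3 := h3 z hz w hw
    have e4 := h4 y hy z hz w hw
    simp only [Pi.add_apply, M] at *
    have e5 : c y z * D z w + c y z * D' z w = c y z * s z + c y z * s w := by
      rw [← mul_add, e3, mul_add]
    have e6 : c y w * s w = c y z * s w + c z w * s w := by rw [← e4, add_mul]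
    grind
  rw [← parity hK]
  refine Finset.sum_congr rfl fun v _ => (lam_congr ?_).symm
  obtain ⟨V, hV, hv, hVc⟩ := exists_nhd_cocycle hc v
  have hA : LTr (F + wt (c v) D') v :=
    (cocF_wt (hV.mem_nhds hv) hv hVc (hD' v (mem_univ v)) (hF v)).lt
  have hB : LTr (M + wt (c v) (D + D')) v := by
    refine ⟨V ∩ ((Q : Set S) \ {v})ᶜ, inter_mem (hV.mem_nhds hv) (exists_nhd_sdiff Q v),
      fun y => c v y * s y, secOn_of_nhds fun x hx => ?_⟩
    have hxQ : x ∈ (Q : Set S)ᶜ := fun h => hx.1.2 ⟨h, hx.2⟩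
    filter_upwards [hs.secF hQo hxQ, Eventually.smallSets (hV.mem_nhds hx.1.1)]
      with W h1 hW y hy z hz
    have e1 := h1 y hy z hz
    have e2 := hVc v hv y (hW _ hy) z (hW _ hz)
    simp only [Pi.add_apply, wt, M] at *
    rw [e1, ← e2]
    grind
  have e : F + G + M + (G + wt (c v) D) = (F + wt (c v) D') + (M + wt (c v) (D + D')) := by
    funext y z
    simp only [Pi.add_apply, wt]
    grind
  rw [e]
  exact hA.add hB

theorem triv_of_cup [CompactSpace S] [ConnectedSpace S] {c : S → S → ZMod 2} (hc : Coc c univ)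
    (H : ∀ d, Coc d univ → ∃ F, ∀ v, CupF c d F (𝓝 v)) : Triv c univ := by
  classical
  obtain ⟨x₀⟩ : Nonempty S := inferInstance
  have hall : ∀ x, ∃ h, Chn c x₀ x h := by
    have hloc : ∀ x, ∃ U ∈ 𝓝 x, ∀ y ∈ U, ∀ z ∈ U, (∃ h, Chn c x₀ y h) → ∃ h, Chn c x₀ z h := by
      intro x
      obtain ⟨j, hj, rfl, -⟩ := Surf.chart x univ univ_mem
      obtain ⟨s, hs⟩ := triv_range hj (hc.mono (subset_univ _))
      refine ⟨range j, hj.isOpen_range.mem_nhds ⟨0, rfl⟩, fun y hy z hz ⟨h, hh⟩ => ?_⟩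
      exact ⟨_, chn_step hc hh hj hy hz hs⟩
    have hcl : IsClopen {x | ∃ h, Chn c x₀ x h} := by
      constructor
      · rw [← isOpen_compl_iff, isOpen_iff_mem_nhds]
        intro x hx
        obtain ⟨U, hU, h⟩ := hloc x
        filter_upwards [hU] with y hy hy'
        exact hx (h y hy x (mem_of_mem_nhds hU) hy')
      · rw [isOpen_iff_mem_nhds]
        intro x hx
        obtain ⟨U, hU, h⟩ := hloc x
        filter_upwards [hU] with y hy
        exact h x (mem_of_mem_nhds hU) y hy hx
    have := hcl.eq_univ ⟨x₀, 0, chn_refl c x₀⟩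
    exact fun x => eq_univ_iff_forall.1 this x
  have huniq : ∀ x h h', Chn c x₀ x h → Chn c x₀ x h' → h = h' := by
    rintro x h h' ⟨Q, d, G, h1, h2, h3, h4⟩ ⟨Q', d', G', h1', h2', h3', h4'⟩
    obtain ⟨g1, g2, g3, g4⟩ := chn_sum_add hc h1 h2 h1' h2'
    rw [h4, h4', sum_lam_wt_eq_zero hc H g1 g2 (fun v => by rw [g3, h3, h3', zmod_add_self])] at g4
    exact zmod_eq_iff.2 g4.symm
  choose s hs using hall
  refine ⟨s, secOn_of_nhds fun x _ => ?_⟩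
  obtain ⟨j, hj, hj0, -⟩ := Surf.chart x univ univ_mem
  obtain ⟨t, ht⟩ := triv_range hj (hc.mono (subset_univ _))
  have hx : x ∈ range j := ⟨0, hj0⟩
  filter_upwards [ht.secF hj.isOpen_range hx, Eventually.smallSets (hj.isOpen_range.mem_nhds hx)]
    with V hV hW y hy z hz
  rw [hV y hy z hz, huniq z _ _ (hs z) (chn_step hc (hs y) hj (hW _ hy) (hW _ hz) ht)]
  grind

end CupTriv

section Holonomy

variable {X : Type*} [TopologicalSpace X]

theorem SecOn.congr_cochain {c d : X → X → ZMod 2} {s : X → ZMod 2} {K : Set X}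
    (h : SecOn c s K) (e : ∀ x ∈ K, ∀ y ∈ K, c x y = d x y) : SecOn d s K := fun x hx =>
  (h x hx).congr (by
    filter_upwards [Eventually.smallSets (self_mem_nhdsWithin (a := x) (s := K))] with V hV y hy z hz
    exact e y (hV _ hy) z (hV _ hz))

theorem exists_section_path {c : X → X → ZMod 2} (hc : Coc c univ) {x y : X} (γ : Path x y) :
    ∃ s, SecOn (pull γ.extend c) s univ :=
  triv_starConvex isOpen_univ (mem_univ 0) (convex_univ.starConvex (mem_univ _))
    (hc.pull γ.continuous_extend fun _ _ => mem_univ _)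

open Classical in
/-- Holonomy of a cocycle along a path. -/
noncomputable def hol (c : X → X → ZMod 2) {x y : X} (γ : Path x y) : ZMod 2 :=
  if h : ∃ s, SecOn (pull γ.extend c) s (Icc 0 1) then h.choose 0 + h.choose 1 else 0

theorem hol_eq {c : X → X → ZMod 2} {x y : X} {γ : Path x y} {s : ℝ → ZMod 2}
    (hs : SecOn (pull γ.extend c) s (Icc 0 1)) : hol c γ = s 0 + s 1 := by
  have h : ∃ s, SecOn (pull γ.extend c) s (Icc 0 1) := ⟨s, hs⟩
  rw [hol, dif_pos h]
  obtain ⟨k, hk⟩ := hs.unique h.choose_spec isPreconnected_Icc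
  rw [hk 0 (by simp), hk 1 (by simp)]
  grind

theorem hol_trans {c : X → X → ZMod 2} (hc : Coc c univ) {x y z : X} (γ : Path x y)
    (δ : Path y z) : hol c (γ.trans δ) = hol c γ + hol c δ := by
  obtain ⟨r, hr⟩ := exists_section_path hc (γ.trans δ)
  have h1 : SecOn (pull γ.extend c) (r ∘ fun t => t / 2) (Icc 0 1) := by
    refine (hr.pull (f := fun t : ℝ => t / 2) (by fun_prop) fun _ _ => mem_univ _).congr_cochain ?_
    have : ∀ t ∈ Icc (0:ℝ) 1, (γ.trans δ).extend (t / 2) = γ.extend t := by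
      intro t ht
      rw [Path.extend_apply _ ⟨by linarith [ht.1], by linarith [ht.2]⟩, Path.trans_apply,
        dif_pos (by simpa using by linarith [ht.2]), Path.extend_apply _ ht]
      congr 2
      simp; ring
    intro s hs t ht
    simp only [pull, this s hs, this t ht]
  have h2 : SecOn (pull δ.extend c) (r ∘ fun t => (t + 1) / 2) (Icc 0 1) := by
    refine (hr.pull (f := fun t : ℝ => (t + 1) / 2) (by fun_prop) fun _ _ => mem_univ _).congr_cochain ?_
    have : ∀ t ∈ Icc (0:ℝ) 1, (γ.trans δ).extend ((t + 1) / 2) = δ.extend t := by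
      intro t ht
      rw [Path.extend_apply _ ⟨by linarith [ht.1], by linarith [ht.2]⟩, Path.trans_apply]
      split_ifs with h
      · have : t = 0 := le_antisymm (by simp at h; linarith) ht.1
        subst this
        simp
      · rw [Path.extend_apply _ ht]
        congr 2
        simp; ring
    intro s hs t ht
    simp only [pull, this s hs, this t ht]
  rw [hol_eq (hr.mono (subset_univ _)), hol_eq h1, hol_eq h2]
  simp
  grind

theorem hol_eq_of_subset {c : X → X → ZMod 2} {V : Set X}
    (h : ∀ y ∈ V, ∀ z ∈ V, ∀ w ∈ V, c y z + c z w = c y w) {x y : X} (γ : Path x y)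
    (hγ : range γ ⊆ V) : hol c γ = c x y := by
  have hm : ∀ t, γ.extend t ∈ V := fun t => hγ (by rw [← γ.extend_range]; exact ⟨t, rfl⟩)
  have hx : x ∈ V := by simpa using hm 0
  have : SecOn (pull γ.extend c) (fun t => c x (γ.extend t)) (Icc 0 1) :=
    secOn_of_nhds fun t _ => Eventually.of_forall fun W a _ b _ => by
      have := h x hx _ (hm a) _ (hm b)
      simp only [_root_.pull]
      grind
  have h0 := h x hx x hx x hx
  rw [hol_eq this]
  simp
  grind

theorem Coc.self {c : X → X → ZMod 2} (hc : Coc c univ) (x : X) : c x x = 0 :=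
  (hc x (mem_univ x)).self.self_of_nhds

theorem hol_refl {c : X → X → ZMod 2} (hc : Coc c univ) (x : X) : hol c (Path.refl x) = 0 := by
  rw [hol_eq_of_subset (V := {x}) (by simp [hc.self]) _ (by simp), hc.self]

theorem hol_homotopic {c : X → X → ZMod 2} (hc : Coc c univ) {x y : X} {γ δ : Path x y}
    (h : γ.Homotopic δ) : hol c γ = hol c δ := by
  obtain ⟨F⟩ := h
  let G : ℝ × ℝ → X := fun p => F (projIcc 0 1 zero_le_one p.1, projIcc 0 1 zero_le_one p.2)
  have hG : Continuous G := F.continuous.comp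
    ((continuous_projIcc.comp continuous_fst).prodMk (continuous_projIcc.comp continuous_snd))
  obtain ⟨s, hs⟩ := triv_starConvex isOpen_univ (mem_univ 0) (convex_univ.starConvex (mem_univ _))
    (hc.pull hG fun _ _ => mem_univ _)
  have key : ∀ (a b : X) (p : Path a b) (f : ℝ → ℝ × ℝ), Continuous f →
      (∀ t, G (f t) = p.extend t) → hol c p = s (f 0) + s (f 1) := by
    intro a b p f hf e
    refine hol_eq (s := s ∘ f) ((hs.pull hf.continuousOn fun _ _ => mem_univ _).congr_cochain ?_)
    intro t _ u _
    simp only [_root_.pull, e]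
  have e1 := key _ _ γ (fun t => (0, t)) (by fun_prop) fun t => by simp [G, Path.extend, IccExtend]
  have e2 := key _ _ δ (fun t => (1, t)) (by fun_prop) fun t => by simp [G, Path.extend, IccExtend]
  have e3 := key _ _ (Path.refl x) (fun t => (t, 0)) (by fun_prop) fun t => by
    simp [G, Path.extend, IccExtend]
  have e4 := key _ _ (Path.refl y) (fun t => (t, 1)) (by fun_prop) fun t => by
    simp [G, Path.extend, IccExtend]
  rw [hol_refl hc] at e3 e4
  rw [e1, e2]
  grind

/-- Holonomy on homotopy classes. -/
noncomputable def holQ {c : X → X → ZMod 2} (hc : Coc c univ) {x y : X}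
    (p : Path.Homotopic.Quotient x y) : ZMod 2 :=
  Quotient.lift (hol c) (fun _ _ h => hol_homotopic hc h) p

theorem holQ_trans {c : X → X → ZMod 2} (hc : Coc c univ) {x y z : X}
    (p : Path.Homotopic.Quotient x y) (q : Path.Homotopic.Quotient y z) :
    holQ hc (p.trans q) = holQ hc p + holQ hc q := by
  induction p using Path.Homotopic.Quotient.ind with | mk p =>
  induction q using Path.Homotopic.Quotient.ind with | mk q =>
  exact hol_trans hc p q

end Holonomy

section Short

variable {S : Type*} [MetricSpace S] [Surf S]

theorem homotopic_in_chart {j : ℂ → S} (hj : IsOpenEmbedding j) {x y : S} (γ δ : Path x y)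
    (hγ : range γ ⊆ range j) (hδ : range δ ⊆ range j) : γ.Homotopic δ := by
  let e := hj.isEmbedding.toHomeomorph
  have hx : x ∈ range j := hγ ⟨0, by simp⟩
  have hy : y ∈ range j := hγ ⟨1, by simp⟩
  let lift : ∀ p : Path x y, range p ⊆ range j → Path (⟨x, hx⟩ : range j) ⟨y, hy⟩ :=
    fun p hp => ⟨⟨fun t => ⟨p t, hp ⟨t, rfl⟩⟩, by fun_prop⟩, by simp, by simp⟩
  have : ContractibleSpace (range j) := e.symm.contractibleSpace
  have h := (SimplyConnectedSpace.paths_homotopic (lift γ hγ) (lift δ hδ)).map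
    (⟨Subtype.val, continuous_subtype_val⟩ : C(range j, S))
  exact h

theorem exists_path_chart {j : ℂ → S} (hj : IsOpenEmbedding j) {x y : S} (hx : x ∈ range j)
    (hy : y ∈ range j) : ∃ γ : Path x y, range γ ⊆ range j := by
  obtain ⟨z, rfl⟩ := hx
  obtain ⟨w, rfl⟩ := hy
  refine ⟨(PathConnectedSpace.somePath z w).map hj.continuous, ?_⟩
  rintro _ ⟨t, rfl⟩
  exact ⟨_, rfl⟩

instance Surf.locallyPathConnectedSpace : LocallyPathConnectedSpace S where
  path_connected_basis x := ⟨fun U => by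
    refine ⟨fun hU => ?_, fun ⟨V, hV, h⟩ => mem_of_superset hV.1 h⟩
    obtain ⟨j, hj, hx, hjU⟩ := Surf.chart x U hU
    exact ⟨range j, ⟨hj.isOpen_range.mem_nhds ⟨0, hx⟩, isPathConnected_range hj.continuous⟩, hjU⟩⟩

theorem exists_short [CompactSpace S] [ConnectedSpace S] {c d : S → S → ZMod 2} (hc : Coc c univ) (hd : Coc d univ) :
    ∃ sh : ∀ y z : S, Path.Homotopic.Quotient y z, ∀ v : S, ∃ V ∈ 𝓝 v,
      ∀ y ∈ V, ∀ z ∈ V, holQ hc (sh y z) = c y z ∧ holQ hd (sh y z) = d y z ∧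
        ∀ w ∈ V, (sh y z).trans (sh z w) = sh y w := by
  classical
  choose j hj hj0 _ using fun x : S => Surf.chart x univ univ_mem
  obtain ⟨δ₁, hδ₁, H₁⟩ := lebesgue_number_lemma_of_metric (s := univ) (c := fun x : S => range (j x))
    isCompact_univ (fun x => (hj x).isOpen_range) (fun x _ => mem_iUnion.2 ⟨x, 0, hj0 x⟩)
  obtain ⟨δ₂, hδ₂, H₂⟩ := hc.uniform isCompact_univ
  obtain ⟨δ₃, hδ₃, H₃⟩ := hd.uniform isCompact_univ
  obtain ⟨η, hη, h1, h2, h3⟩ : ∃ η > 0, 2 * η ≤ δ₁ ∧ 2 * η ≤ δ₂ ∧ 2 * η ≤ δ₃ :=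
    ⟨min δ₁ (min δ₂ δ₃) / 2, by positivity,
      by linarith [min_le_left δ₁ (min δ₂ δ₃)],
      by linarith [min_le_right δ₁ (min δ₂ δ₃), min_le_left δ₂ δ₃],
      by linarith [min_le_right δ₁ (min δ₂ δ₃), min_le_right δ₂ δ₃]⟩
  have : PathConnectedSpace S := pathConnectedSpace_iff_connectedSpace.2 inferInstance
  let P : ∀ y z : S, Path y z := fun y z =>
    if h : ∃ γ : Path y z, range γ ⊆ ball y η then h.choose else PathConnectedSpace.somePath y z
  refine ⟨fun y z => .mk (P y z), fun v => ?_⟩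
  obtain ⟨k, hk, hkv, hkr⟩ := Surf.chart v _ (ball_mem_nhds v (half_pos hη))
  have hb : ∀ y ∈ range k, range k ⊆ ball y η := fun y hy w hw => by
    have h1 := mem_ball.1 (hkr hy)
    have h2 := mem_ball.1 (hkr hw)
    rw [mem_ball]
    linarith [dist_triangle_right w y v]
  have hP : ∀ y ∈ range k, ∀ z ∈ range k, range (P y z) ⊆ ball v (2 * η) := by
    intro y hy z hz
    have h : ∃ γ : Path y z, range γ ⊆ ball y η := by
      obtain ⟨γ, hγ⟩ := exists_path_chart hk hy hz
      exact ⟨γ, hγ.trans (hb y hy)⟩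
    simp only [P, dif_pos h]
    refine h.choose_spec.trans (ball_subset_ball' ?_)
    linarith [mem_ball.1 (hkr hy)]
  have hv : v ∈ range k := ⟨0, hkv⟩
  refine ⟨range k, hk.isOpen_range.mem_nhds hv, fun y hy z hz => ⟨?_, ?_, fun w hw => ?_⟩⟩
  · exact hol_eq_of_subset (H₂ v (mem_univ v)) _ ((hP y hy z hz).trans (ball_subset_ball h2))
  · exact hol_eq_of_subset (H₃ v (mem_univ v)) _ ((hP y hy z hz).trans (ball_subset_ball h3))
  · obtain ⟨i, hi⟩ := H₁ v (mem_univ v)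
    have hi' := (ball_subset_ball h1).trans hi
    rw [← Path.Homotopic.Quotient.mk_trans, Path.Homotopic.Quotient.eq]
    refine homotopic_in_chart (hj i) _ _ ?_ ((hP y hy w hw).trans hi')
    rw [Path.trans_range]
    exact union_subset ((hP y hy z hz).trans hi') ((hP z hz w hw).trans hi')

theorem exists_cup_of_not_surfaceLike [CompactSpace S] [ConnectedSpace S] {x₀ : S}
    (h : ∀ φ ψ : FundamentalGroup S x₀ → ZMod 2, (∀ a b, φ (a * b) = φ a + φ b) →
      (∀ a b, ψ (a * b) = ψ a + ψ b) → ∃ f : FundamentalGroup S x₀ → ZMod 2,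
        ∀ a b, φ a * ψ b = f a + f b + f (a * b)) {c d : S → S → ZMod 2} (hc : Coc c univ)
    (hd : Coc d univ) : ∃ F, ∀ v, CupF c d F (𝓝 v) := by
  have hpc : PathConnectedSpace S := pathConnectedSpace_iff_connectedSpace.2 inferInstance
  obtain ⟨sh, hsh⟩ := exists_short hc hd
  let p : ∀ y, Path.Homotopic.Quotient x₀ y := fun y => .mk (PathConnectedSpace.somePath x₀ y)
  obtain ⟨f, hf⟩ := h (fun a => holQ hd a) (fun a => holQ hc a)
    (fun a b => (holQ_trans hd _ _).trans (add_comm _ _))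
    (fun a b => (holQ_trans hc _ _).trans (add_comm _ _))
  let l : S → S → FundamentalGroup S x₀ := fun y z => ((p y).trans (sh y z)).trans (p z).symm
  have hsymm : ∀ {e : S → S → ZMod 2} (he : Coc e univ) (y : S),
      holQ he (p y).symm = holQ he (p y) := by
    intro e he y
    have h1 := holQ_trans he (p y).symm (p y)
    have h2 : holQ he ((p y).symm.trans (p y)) = 0 := by
      rw [Path.Homotopic.Quotient.symm_trans]
      exact hol_refl he y
    rw [h2] at h1
    grind
  let u := fun y => holQ hc (p y)
  let t := fun y => holQ hd (p y)
  refine ⟨fun y z => f (l y z) + u y * d y z + (c y z + u y + u z) * t z, fun v => ?_⟩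
  obtain ⟨V, hV, H⟩ := hsh v
  filter_upwards [hd v (mem_univ v), hc v (mem_univ v), Eventually.smallSets hV]
    with W h1 h2 hW y hy z hz w hw
  have e1 := h1 y hy z hz w hw
  have e2 := h2 y hy z hz w hw
  have hl : l z w * l y z = l y w := by
    show ((((p y).trans (sh y z)).trans (p z).symm).trans
      (((p z).trans (sh z w)).trans (p w).symm)) = ((p y).trans (sh y w)).trans (p w).symm
    rw [← (H y (hW _ hy) z (hW _ hz)).2.2 w (hW _ hw)]
    simp only [Path.Homotopic.Quotient.trans_assoc]
    rw [← Path.Homotopic.Quotient.trans_assoc (p z).symm, Path.Homotopic.Quotient.symm_trans,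
      Path.Homotopic.Quotient.refl_trans]
  have e3 := hf (l z w) (l y z)
  have e4 : holQ hd (l z w) = t z + d z w + t w := by
    show holQ hd (((p z).trans (sh z w)).trans (p w).symm) = _
    rw [holQ_trans, holQ_trans, hsymm, (H z (hW _ hz) w (hW _ hw)).2.1]
  have e5 : holQ hc (l y z) = u y + c y z + u z := by
    show holQ hc (((p y).trans (sh y z)).trans (p z).symm) = _
    rw [holQ_trans, holQ_trans, hsymm, (H y (hW _ hy) z (hW _ hz)).1]
  simp only [hl, e4, e5] at e3
  rw [← e1, ← e2]
  generalize f (l y z) = a1 at *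
  generalize f (l z w) = a2 at *
  generalize f (l y w) = a3 at *
  generalize u y = u1 at *
  generalize u z = u2 at *
  generalize u w = u3 at *
  generalize t y = t1 at *
  generalize t z = t2 at *
  generalize t w = t3 at *
  generalize c y z = c1 at *
  generalize c z w = c2 at *
  generalize d y z = d1 at *
  generalize d z w = d2 at *
  have : a3 = a2 + a1 + (t2 + d2 + t3) * (u1 + c1 + u2) := by grind
  subst this
  clear e1 e2 e3 e4 e5 hl
  grind

end Short

/-- Every Alexander–Spanier cocycle on `S` is trivial. -/
class CocTriv (S : Type*) [TopologicalSpace S] : Prop where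
  triv : ∀ c : S → S → ZMod 2, Coc c univ → Triv c univ

/-- `K` does not separate `p` from `q`. -/
def Jn {S : Type*} [TopologicalSpace S] (K : Set S) (p q : S) : Prop :=
  ∃ C, IsPreconnected C ∧ C ⊆ Kᶜ ∧ p ∈ C ∧ q ∈ C

section JnBasic

variable {S : Type*} [TopologicalSpace S] {K L : Set S} {p q r : S}

theorem Jn.symm (h : Jn K p q) : Jn K q p :=
  let ⟨C, h1, h2, h3, h4⟩ := h
  ⟨C, h1, h2, h4, h3⟩

theorem Jn.trans (h : Jn K p q) (h' : Jn K q r) : Jn K p r :=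
  let ⟨C, h1, h2, h3, h4⟩ := h
  let ⟨D, k1, k2, k3, k4⟩ := h'
  ⟨C ∪ D, h1.union q h4 k3 k1, union_subset h2 k2, Or.inl h3, Or.inr k4⟩

theorem Jn.mono (h : Jn K p q) (hL : L ⊆ K) : Jn L p q :=
  let ⟨C, h1, h2, h3, h4⟩ := h
  ⟨C, h1, h2.trans (compl_subset_compl.2 hL), h3, h4⟩

theorem Jn.left (h : Jn K p q) : p ∉ K :=
  let ⟨_, _, h2, h3, _⟩ := h
  h2 h3

theorem jn_iff (hp : p ∉ K) : Jn K p q ↔ q ∈ connectedComponentIn Kᶜ p := by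
  constructor
  · rintro ⟨C, h1, h2, h3, h4⟩
    exact h1.subset_connectedComponentIn h3 h2 h4
  · intro h
    exact ⟨_, isPreconnected_connectedComponentIn, connectedComponentIn_subset _ _,
      mem_connectedComponentIn hp, h⟩

end JnBasic

/-- `K` is closed, connected and carries no nontrivial cocycles. -/
structure Acyc {S : Type*} [TopologicalSpace S] (K : Set S) : Prop where
  conn : IsPreconnected K
  closed : IsClosed K
  triv : ∀ c, Coc c K → Triv c K

theorem coc_subset_open {X : Type*} [TopologicalSpace X] {c : X → X → ZMod 2} {K : Set X}
    (h : Coc c K) : ∃ U, IsOpen U ∧ K ⊆ U ∧ Coc c U := by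
  choose! V hV hc using fun x hx => cocF_iff.1 (h x hx)
  refine ⟨⋃ x ∈ K, interior (V x), isOpen_biUnion fun _ _ => isOpen_interior,
    fun x hx => mem_biUnion hx (mem_interior_iff_mem_nhds.2 (hV x hx)), fun y hy => ?_⟩
  obtain ⟨x, hx, hy⟩ := mem_iUnion₂.1 hy
  exact cocF_iff.2 ⟨V x, mem_interior_iff_mem_nhds.1 hy, hc x hx⟩

section Dipole

variable {S : Type*} [MetricSpace S] [Surf S]

/-- A cocycle with branching exactly `p + q`. -/
def Dip (e : S → S → ZMod 2) (p q : S) : Prop :=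
  Coc e {p, q}ᶜ ∧ ∀ v, lam e v = Set.indicator {p} 1 v + Set.indicator {q} 1 v

theorem acyc_arc {f : ℝ → S} {a b : ℝ} (hab : a ≤ b) (hf : ContinuousOn f (Icc a b))
    (hi : InjOn f (Icc a b)) : Acyc (f '' Icc a b) := by
  refine ⟨isPreconnected_Icc.image _ hf, (isCompact_Icc.image_of_continuousOn hf).isClosed,
    fun c hc => ?_⟩
  set g : Icc a b → S := (Icc a b).domRestrict f with hg
  have hgc : Continuous g := hf.domRestrict
  have hgi : Function.Injective g := injOn_iff_injective.1 hi
  have he : Topology.IsEmbedding g := (hgc.isClosedEmbedding hgi).isEmbedding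
  have hr : f '' Icc a b = g '' univ := by rw [image_univ, hg, range_domRestrict]
  rw [hr] at hc ⊢
  refine Triv.push he ?_
  have h1 : Coc (pull (g ∘ projIcc a b hab) c) (Icc a b) :=
    hc.pull (hgc.comp continuous_projIcc) fun x _ => mem_image_of_mem _ (mem_univ _)
  have h2 := (triv_Icc hab h1).pull (f := ((↑) : Icc a b → ℝ)) (L := univ)
    continuous_subtype_val.continuousOn (fun x _ => x.2)
  have : pull ((↑) : Icc a b → ℝ) (pull (g ∘ projIcc a b hab) c) = pull g c := by
    funext x y; simp [pull]
  rwa [this] at h2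

theorem acyc_disc {j : ℂ → S} (hj : IsOpenEmbedding j) {r : ℝ} (hr : 0 < r) :
    Acyc (j '' closedBall 0 r) := by
  refine ⟨(convex_closedBall (0:ℂ) r).isPreconnected.image _ hj.continuous.continuousOn,
    ((isCompact_closedBall (0:ℂ) r).image hj.continuous).isClosed, fun c hc => ?_⟩
  refine Triv.push hj.isEmbedding ?_
  have h1 : Coc (pull j c) (closedBall 0 r) :=
    hc.pull hj.continuous fun x hx => mem_image_of_mem _ hx
  obtain ⟨U, hU, hKU, h2⟩ := coc_subset_open h1
  obtain ⟨δ, hδ, h3⟩ := (isCompact_closedBall (0:ℂ) r).exists_thickening_subset_open hU hKU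
  rw [thickening_closedBall hδ hr.le] at h3
  have h0 : (0:ℂ) ∈ ball (0:ℂ) (δ + r) := mem_ball_self (by linarith)
  exact (triv_starConvex isOpen_ball h0 ((convex_ball _ _).starConvex h0) (h2.mono h3)).mono
    (closedBall_subset_ball (by linarith))

theorem triv_of_secF_zero {e : S → S → ZMod 2} {K : Set S} (h : ∀ x ∈ K, SecF e 0 (𝓝 x)) :
    Triv e K := ⟨0, secOn_of_nhds h⟩

/-- Dipoles supported in a connected open set. -/
theorem exists_chain {O : Set S} (hO : IsOpen O) (hc : IsPreconnected O) {p q : S} (hp : p ∈ O)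
    (hq : q ∈ O) : ∃ (e : S → S → ZMod 2) (Q : Finset S), (Q : Set S) ⊆ O ∧ Coc e (Q : Set S)ᶜ ∧
      (∀ v, lam e v = Set.indicator {p} 1 v + Set.indicator {q} 1 v) ∧
      ∀ x ∉ O, SecF e 0 (𝓝 x) := by
  classical
  refine hc.induction₂ (fun p q => ∃ (e : S → S → ZMod 2) (Q : Finset S), (Q : Set S) ⊆ O ∧
    Coc e (Q : Set S)ᶜ ∧ (∀ v, lam e v = Set.indicator {p} 1 v + Set.indicator {q} 1 v) ∧
      ∀ x ∉ O, SecF e 0 (𝓝 x)) ?_ ?_ ?_ hp hq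
  · intro x hx
    obtain ⟨j, hj, h0, hjO⟩ := Surf.chart x O (hO.mem_nhds hx)
    refine mem_nhdsWithin_of_mem_nhds (mem_of_superset
      (hj.isOpen_range.mem_nhds ⟨0, h0⟩) ?_)
    rintro _ ⟨w, rfl⟩
    by_cases hw : (0:ℂ) = w
    · subst hw
      refine ⟨0, ∅, by simp, fun x _ => cocF_zero _, fun v => ?_, fun x _ => ?_⟩
      · rw [h0, zmod_add_self, lam_eq_zero]
        exact (cocF_zero _).lt
      · exact secF_iff.2 ⟨univ, univ_mem, by simp⟩
    · refine ⟨segE j 0 w hw, {j 0, j w}, ?_, ?_, fun v => ?_, fun y hy => ?_⟩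
      · simp only [Finset.coe_insert, Finset.coe_singleton]
        rintro _ (rfl | rfl) <;> exact hjO (mem_range_self _)
      · simpa using coc_segE hj hw
      · rw [lam_segE hj, h0]
      · exact segE_zero hj hw fun ⟨z, _, hz⟩ => hy (hjO ⟨z, hz⟩)
  · rintro x y z - - - ⟨e, Q, h1, h2, h3, h4⟩ ⟨e', Q', h1', h2', h3', h4'⟩
    refine ⟨e + e', Q ∪ Q', by simp [h1, h1'], ?_, fun v => ?_, fun x hx => ?_⟩
    · rw [Finset.coe_union]
      exact (h2.mono (by simp)).add (h2'.mono (by simp))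
    · rw [lam_add (PCoc.of_coc (U := univ) isOpen_univ (by rwa [← compl_eq_univ_sdiff]) (mem_univ _))
        (PCoc.of_coc (U := univ) isOpen_univ (by rwa [← compl_eq_univ_sdiff]) (mem_univ _)), h3, h3']
      grind
    · simpa using (h4 x hx).add (h4' x hx)
  · rintro x y - - ⟨e, Q, h1, h2, h3, h4⟩
    exact ⟨e, Q, h1, h2, fun v => by rw [h3, add_comm], h4⟩

theorem pcoc_of_finset {e : S → S → ZMod 2} {Q : Finset S} (h : Coc e (Q : Set S)ᶜ) (v : S) :
    PCoc e v :=
  PCoc.of_coc (U := univ) isOpen_univ (by rwa [← compl_eq_univ_sdiff]) (mem_univ _)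

theorem exists_dip [ConnectedSpace S] (p q : S) : ∃ e, Dip e p q := by
  classical
  obtain ⟨e, Q, -, h1, h2, -⟩ := exists_chain isOpen_univ isPreconnected_univ (mem_univ p)
    (mem_univ q)
  have hU : IsOpen ({p, q}ᶜ : Set S) := ((finite_singleton q).insert p).isClosed.isOpen_compl
  obtain ⟨c', h3, h4⟩ := exists_unbranched hU Q (h1.mono (by simp))
    (fun v hv hvU => lam_eq_zero.1 <| by
      rw [h2]
      simp only [mem_compl_iff, mem_insert_iff, mem_singleton_iff, not_or] at hvU
      simp [hvU.1, hvU.2])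
  refine ⟨c', h3, fun v => ?_⟩
  by_cases hv : v ∈ ({p, q}ᶜ : Set S)
  · rw [lam_eq_zero_of_coc h3 hv]
    simp only [mem_compl_iff, mem_insert_iff, mem_singleton_iff, not_or] at hv
    simp [hv.1, hv.2]
  · rw [← h2 v]
    refine (lam_congr ⟨(({p, q} ∪ Q : Finset S) \ {v} : Set S)ᶜ, exists_nhd_sdiff _ _,
      h4.mono ?_⟩).symm
    rintro x ⟨hx, hxv⟩
    simp only [Finset.coe_union, Finset.coe_insert, Finset.coe_singleton, mem_compl_iff,
      Set.mem_sdiff, mem_union, not_and, not_not] at hx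
    exact ⟨fun h => hxv (hx (Or.inl h)), fun h => hxv (hx (Or.inr h))⟩

section Crit

variable [CompactSpace S] [ConnectedSpace S] {e : S → S → ZMod 2} {p q : S} {K : Set S}

theorem Dip.triv_of_jn [CocTriv S] (he : Dip e p q) (hK : IsClosed K) (h : Jn K p q) :
    Triv e K := by
  classical
  have hp := h.left
  rw [jn_iff hp] at h
  obtain ⟨e', Q, h1, h2, h3, h4⟩ := exists_chain
    (hK.isOpen_compl.connectedComponentIn (x := p)) isPreconnected_connectedComponentIn
    (mem_connectedComponentIn hp) h
  have hOK : connectedComponentIn Kᶜ p ⊆ Kᶜ := connectedComponentIn_subset _ _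
  have he1 : Coc e ((({p, q} : Finset S)) : Set S)ᶜ := by simpa using he.1
  obtain ⟨c', h5, h6⟩ := exists_unbranched (c := e + e') isOpen_univ ({p, q} ∪ Q) (by
      rw [← compl_eq_univ_sdiff, Finset.coe_union]
      exact (he1.mono (by simp)).add (h2.mono (by simp)))
    (fun v _ _ => lam_eq_zero.1 <| by
      rw [lam_add (pcoc_of_finset he1 v) (pcoc_of_finset h2 v), he.2, h3]
      exact zmod_add_self _)
  have h7 := (h6.add ((CocTriv.triv c' h5).mono sdiff_subset)).mono (V := K) (by
    intro x hx
    refine ⟨mem_univ _, fun hx' => ?_⟩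
    simp only [Finset.coe_union, Finset.coe_insert, Finset.coe_singleton, mem_union,
      mem_insert_iff, mem_singleton_iff] at hx'
    rcases hx' with (rfl | rfl) | h'
    · exact hp hx
    · exact hOK h hx
    · exact hOK (h1 h') hx)
  rw [coch_add_cancel] at h7
  have h8 := h7.add (triv_of_secF_zero (e := e') (K := K) fun x hx => h4 x fun h' => hOK h' hx)
  rwa [coch_add_cancel] at h8

theorem Dip.jn_of_triv (he : Dip e p q) (hK : IsClosed K) (hp : p ∉ K) (hq : q ∉ K)
    (h : Triv e K) : Jn K p q := by
  classical
  rw [jn_iff hp]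
  by_contra hqP
  set P := connectedComponentIn Kᶜ p with hP
  have hpP : p ∈ P := mem_connectedComponentIn hp
  have hPo : IsOpen P := hK.isOpen_compl.connectedComponentIn
  obtain ⟨U, hU, hKU, s, hs⟩ := h.extend hK.isCompact (he.1.mono fun x hx => by
    rintro (rfl | rfl)
    exacts [hp hx, hq hx])
  set e' := e + cobd s with he'
  have h1 : ∀ x ∈ U, SecF e' 0 (𝓝 x) := fun x hx => by
    have := (hs.secF hU hx).add (secF_cobd s (𝓝 x))
    refine this.congr' (Eventually.of_forall fun y => ?_)
    exact zmod_add_self _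
  have h2 : Coc e' {p, q}ᶜ := he.1.add (coc_cobd _ _)
  set d : S → S → ZMod 2 := wt (Set.indicator P 1) e' with hd
  have h3 : ∀ x ∈ P, ∀ᶠ V in (𝓝 x).smallSets, ∀ y ∈ V, ∀ z ∈ V, e' y z = d y z := fun x hx =>
    eventually_smallSets.2 ⟨P, hPo.mem_nhds hx, fun V hV y hy z _ => by simp [hd, wt, hV hy]⟩
  have h4 : ∀ x, ∀ V ∈ 𝓝 x, Disjoint V P → CocF d (𝓝 x) := fun x V hV hVP =>
    cocF_iff.2 ⟨V, hV, fun y hy z hz w _ => by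
      simp [hd, wt, disjoint_left.1 hVP hy, disjoint_left.1 hVP hz]⟩
  have h5 : Coc d (({p} : Finset S) : Set S)ᶜ := by
    intro x hx
    have hxp : x ≠ p := by simpa using hx
    by_cases hxP : x ∈ P
    · refine (h2 x ?_).congr (h3 x hxP)
      rintro (rfl | rfl)
      exacts [hxp rfl, hqP hxP]
    by_cases hxK : x ∈ K
    · obtain ⟨V, hV, hVs⟩ := secF_iff.1 (h1 x (hKU hxK))
      refine cocF_iff.2 ⟨V, hV, fun y hy z hz w hw => ?_⟩
      simp only [hd, wt, hVs y hy z hz, hVs z hz w hw, hVs y hy w hw]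
      simp
    · refine h4 x (connectedComponentIn Kᶜ x)
        (hK.isOpen_compl.connectedComponentIn.mem_nhds (mem_connectedComponentIn hxK)) ?_
      refine disjoint_left.2 fun y hy hy' => hxP ?_
      rw [hP, connectedComponentIn_eq hy', ← connectedComponentIn_eq hy]
      exact mem_connectedComponentIn hxK
  have h6 := parity h5
  rw [Finset.sum_singleton] at h6
  have h7 : lam d p = lam e' p := by
    refine lam_congr ⟨P, hPo.mem_nhds hpP, 0, ?_⟩
    refine SecOn.mono (U := P) (secOn_of_nhds fun x hx => secF_iff.2 ⟨P, hPo.mem_nhds hx, ?_⟩)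
      sdiff_subset
    intro y hy z _
    simp [hd, wt, hy, zmod_add_self]
  have h8 : lam e' p = lam e p := lam_congr (by
    rw [he', add_comm e, coch_add_cancel]; exact lt_cobd s p)
  rw [h7, h8, he.2] at h6
  have hpq : p ≠ q := fun h => hqP (h ▸ hpP)
  simp [hpq] at h6

variable [CocTriv S]

theorem Acyc.jn (hK : Acyc K) (hp : p ∉ K) (hq : q ∉ K) : Jn K p q := by
  obtain ⟨e, he⟩ := exists_dip p q
  refine he.jn_of_triv hK.closed hp hq (hK.triv e (he.1.mono fun x hx => ?_))
  rintro (rfl | rfl)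
  exacts [hp hx, hq hx]

theorem janiszewski {A B : Set S} (hA : IsClosed A) (hB : IsClosed B)
    (hAB : IsPreconnected (A ∩ B)) (h1 : Jn A p q) (h2 : Jn B p q) : Jn (A ∪ B) p q := by
  obtain ⟨e, he⟩ := exists_dip p q
  have hp : p ∉ A ∪ B := fun h => h.elim h1.left h2.left
  have hq : q ∉ A ∪ B := fun h => h.elim h1.symm.left h2.symm.left
  refine he.jn_of_triv (hA.union hB) hp hq ((he.triv_of_jn hA h1).closed_glue hA hB
    (he.triv_of_jn hB h2) (he.1.mono fun x hx => ?_) hAB)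
  rintro (rfl | rfl)
  exacts [hp (Or.inl hx.1), hq (Or.inl hx.1)]

end Crit

end Dipole

/-- An injectively parametrised closed curve, as a `1`-periodic map. -/
structure IsLoop {X : Type*} [TopologicalSpace X] (f : ℝ → X) : Prop where
  cont : Continuous f
  per : ∀ t, f (t + 1) = f t
  inj : ∀ s t, f s = f t → ∃ n : ℤ, t = s + n

/-- `A` is an arc with endpoints `u` and `v`. -/
def IsArc {X : Type*} [TopologicalSpace X] (A : Set X) (u v : X) : Prop :=
  ∃ γ : Path u v, Function.Injective γ ∧ range γ = A

section Curves

variable {X Y : Type*} [TopologicalSpace X] [TopologicalSpace Y] {f : ℝ → X} {A B : Set X} {u v : X}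

theorem IsArc.symm (h : IsArc A u v) : IsArc A v u :=
  let ⟨γ, h1, h2⟩ := h
  ⟨γ.symm, h1.comp unitInterval.symm_bijective.injective, by rw [Path.symm_range, h2]⟩

theorem IsArc.left_mem (h : IsArc A u v) : u ∈ A :=
  let ⟨γ, _, h2⟩ := h
  h2 ▸ ⟨0, γ.source⟩

theorem IsArc.right_mem (h : IsArc A u v) : v ∈ A := h.symm.left_mem

theorem IsArc.ne (h : IsArc A u v) : u ≠ v := by
  obtain ⟨γ, h1, -⟩ := h
  intro huv
  have := h1 ((γ.source.trans huv).trans γ.target.symm)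
  exact zero_ne_one this

theorem IsArc.isCompact (h : IsArc A u v) : IsCompact A := by
  obtain ⟨γ, -, rfl⟩ := h
  exact isCompact_range γ.continuous

theorem IsArc.isPreconnected (h : IsArc A u v) : IsPreconnected A := by
  obtain ⟨γ, -, rfl⟩ := h
  exact isPreconnected_range γ.continuous

theorem IsArc.image (h : IsArc A u v) {g : X → Y} (hg : ContinuousOn g A) (hi : InjOn g A) :
    IsArc (g '' A) (g u) (g v) := by
  obtain ⟨γ, h1, rfl⟩ := h
  refine ⟨⟨⟨fun t => g (γ t), hg.comp_continuous γ.continuous fun t => mem_range_self t⟩,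
    by simp, by simp⟩, fun s t hst => h1 (hi (mem_range_self s) (mem_range_self t) hst), ?_⟩
  exact range_comp g γ

/-- An arc parametrised by a real interval. -/
theorem isArc_of_injOn {a b : ℝ} (hab : a < b) (hf : ContinuousOn f (Icc a b))
    (hi : InjOn f (Icc a b)) : IsArc (f '' Icc a b) (f a) (f b) := by
  have h : ∀ t : I, a + t * (b - a) ∈ Icc a b := fun t =>
    ⟨by nlinarith [t.2.1, t.2.2], by nlinarith [t.2.1, t.2.2]⟩
  refine ⟨⟨⟨fun t => f (a + t * (b - a)), hf.comp_continuous (by fun_prop) h⟩, by simp, by simp⟩,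
    fun s t hst => ?_, ?_⟩
  · have := hi (h s) (h t) hst
    have hba : b - a ≠ 0 := by linarith
    exact Subtype.ext (mul_right_cancel₀ hba (by linarith))
  · apply Subset.antisymm
    · rintro _ ⟨t, rfl⟩
      exact mem_image_of_mem f (h t)
    · rintro _ ⟨x, hx, rfl⟩
      have hba : 0 < b - a := by linarith
      refine ⟨⟨(x - a) / (b - a), div_nonneg (by linarith [hx.1]) hba.le,
        (div_le_one hba).2 (by linarith [hx.2])⟩, ?_⟩
      show f (a + (x - a) / (b - a) * (b - a)) = f x
      rw [div_mul_cancel₀ _ hba.ne']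
      congr 1; ring

theorem IsLoop.image (h : IsLoop f) {g : X → Y} (hg : ContinuousOn g (range f))
    (hi : InjOn g (range f)) : IsLoop (g ∘ f) :=
  ⟨hg.comp_continuous h.cont mem_range_self, fun t => congrArg g (h.per t),
    fun s t hst => h.inj s t (hi (mem_range_self s) (mem_range_self t) hst)⟩

theorem IsLoop.add_int (h : IsLoop f) (t : ℝ) (n : ℤ) : f (t + n) = f t :=
  (show Function.Periodic f 1 from h.per).int_mul n t |>.symm ▸ by simp

theorem IsLoop.injOn (h : IsLoop f) {a b : ℝ} (hab : b < a + 1) : InjOn f (Icc a b) := by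
  intro s hs t ht hst
  obtain ⟨n, hn⟩ := h.inj s t hst
  have h1 : (n:ℝ) < 1 := by linarith [hs.1, ht.2]
  have h2 : (-1:ℝ) < n := by linarith [hs.2, ht.1]
  have : n = 0 := by
    have h3 : n < 1 := by exact_mod_cast h1
    have h4 : -1 < n := by exact_mod_cast h2
    omega
  subst this
  simpa using hn.symm

theorem IsLoop.injOn_Ico (h : IsLoop f) (a : ℝ) : InjOn f (Ico a (a + 1)) := by
  intro s hs t ht hst
  exact h.injOn (b := max s t) (a := a) (max_lt hs.2 ht.2) ⟨hs.1, le_max_left _ _⟩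
    ⟨ht.1, le_max_right _ _⟩ hst

theorem IsLoop.isArc (h : IsLoop f) {a b : ℝ} (hab : a < b) (hb : b < a + 1) :
    IsArc (f '' Icc a b) (f a) (f b) := isArc_of_injOn hab h.cont.continuousOn (h.injOn hb)

theorem IsLoop.exists_mem_Ico (h : IsLoop f) (a : ℝ) {x : X} (hx : x ∈ range f) :
    ∃ t ∈ Ico a (a + 1), f t = x := by
  obtain ⟨t, rfl⟩ := hx
  obtain ⟨y, hy, hy'⟩ := (show Function.Periodic f 1 from h.per).exists_mem_Ico one_pos t a
  exact ⟨y, hy, hy'.symm⟩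

theorem IsLoop.range_eq (h : IsLoop f) {a b : ℝ} (hab : a ≤ b) (hb : b ≤ a + 1) :
    range f = f '' Icc a b ∪ f '' Icc b (a + 1) := by
  rw [← image_union, Icc_union_Icc_eq_Icc hab hb]
  refine (image_subset_range _ _).antisymm' fun x hx => ?_
  obtain ⟨t, ht, rfl⟩ := h.exists_mem_Ico a hx
  exact mem_image_of_mem _ ⟨ht.1, ht.2.le⟩

theorem IsLoop.inter_eq (h : IsLoop f) {a b : ℝ} (hab : a < b) (hb : b < a + 1) :
    f '' Icc a b ∩ f '' Icc b (a + 1) = {f a, f b} := by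
  apply Subset.antisymm
  · rintro _ ⟨⟨s, hs, rfl⟩, t, ht, hst⟩
    rcases ht.2.lt_or_eq with h1 | h1
    · have := h.injOn_Ico a ⟨hab.le.trans ht.1, h1⟩ ⟨hs.1, hs.2.trans_lt hb⟩ hst
      right
      rw [show s = b from le_antisymm hs.2 (this ▸ ht.1)]
      rfl
    · left
      rw [← hst, h1, h.per]
  · rintro _ (rfl | rfl)
    · exact ⟨⟨a, ⟨le_rfl, hab.le⟩, rfl⟩, a + 1, ⟨hb.le, le_rfl⟩, h.per a⟩
    · exact ⟨⟨b, ⟨hab.le, le_rfl⟩, rfl⟩, b, ⟨le_rfl, hb.le⟩, rfl⟩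

/-- Two points split a closed curve into two arcs. -/
theorem IsLoop.split (h : IsLoop f) (hu : u ∈ range f) (hv : v ∈ range f) (huv : u ≠ v) :
    ∃ A B, IsArc A u v ∧ IsArc B u v ∧ A ∪ B = range f ∧ A ∩ B = {u, v} := by
  obtain ⟨a, rfl⟩ := hu
  obtain ⟨b, hb, rfl⟩ := h.exists_mem_Ico a hv
  have hab : a < b := hb.1.lt_of_ne (by rintro rfl; exact huv rfl)
  refine ⟨_, _, h.isArc hab hb.2, ?_, (h.range_eq hb.1 hb.2.le).symm, h.inter_eq hab hb.2⟩
  have := h.isArc hb.2 (b := a + 1) (by linarith)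
  rw [h.per] at this
  exact this.symm

/-- Two arcs meeting exactly at their endpoints form a closed curve. -/
theorem IsArc.loop (hA : IsArc A u v) (hB : IsArc B u v) (hAB : A ∩ B ⊆ {u, v}) :
    ∃ f, IsLoop f ∧ range f = A ∪ B := by
  have huv := hA.ne
  obtain ⟨α, ha, rfl⟩ := hA
  obtain ⟨β, hb, rfl⟩ := hB.symm
  set γ := α.trans β with hγ
  have h0 : γ.extend 0 = u := γ.extend_zero
  have h1 : γ.extend 1 = u := γ.extend_one
  have hcross : ∀ s t : I, α s = β t → (s = 0 ∧ t = 1) ∨ (s = 1 ∧ t = 0) := by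
    intro s t hst
    rcases hAB ⟨mem_range_self s, t, hst.symm⟩ with h | h
    · exact Or.inl ⟨ha (h.trans α.source.symm), hb (hst.symm.trans (h.trans β.target.symm))⟩
    · exact Or.inr ⟨ha (h.trans α.target.symm), hb (hst.symm.trans (h.trans β.source.symm))⟩
  have key : ∀ s t : ℝ, s ∈ Ico (0:ℝ) 1 → t ∈ Ico (0:ℝ) 1 → s ≤ t →
      γ.extend s = γ.extend t → s = t := by
    intro s t hs ht hle hst
    rcases le_total t (1/2) with h2 | h2
    · have h3 : s ≤ 1/2 := hle.trans h2
      rw [Path.extend_trans_of_le_half _ _ h2, Path.extend_trans_of_le_half _ _ h3,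
        Path.extend_apply _ ⟨by linarith [hs.1], by linarith⟩,
        Path.extend_apply _ ⟨by linarith [ht.1], by linarith⟩] at hst
      have := congrArg Subtype.val (ha hst)
      dsimp only at this; linarith
    · rcases le_total s (1/2) with h3 | h3
      · rw [Path.extend_trans_of_half_le _ _ h2, Path.extend_trans_of_le_half _ _ h3,
          Path.extend_apply _ ⟨by linarith [hs.1], by linarith⟩,
          Path.extend_apply _ ⟨by linarith [ht.1], by linarith [ht.2]⟩] at hst
        rcases hcross _ _ hst with ⟨-, h⟩ | ⟨h, h'⟩
        · have := congrArg Subtype.val h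
          simp only [Set.Icc.coe_one] at this
          linarith [ht.2]
        · have := congrArg Subtype.val h
          have h'' := congrArg Subtype.val h'
          simp only [Set.Icc.coe_one, Set.Icc.coe_zero] at this h''
          linarith
      · rw [Path.extend_trans_of_half_le _ _ h2, Path.extend_trans_of_half_le _ _ h3,
          Path.extend_apply _ ⟨by linarith [hs.1], by linarith [hs.2]⟩,
          Path.extend_apply _ ⟨by linarith [ht.1], by linarith [ht.2]⟩] at hst
        have := congrArg Subtype.val (hb hst)
        dsimp only at this; linarith
  refine ⟨γ.extend ∘ Int.fract, ⟨?_, fun t => by simp, fun s t hst => ?_⟩, ?_⟩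
  · exact ContinuousOn.comp_fract'' γ.continuous_extend.continuousOn (h0.trans h1.symm)
  · refine ⟨⌊t⌋ - ⌊s⌋, ?_⟩
    have hs : Int.fract s ∈ Ico (0:ℝ) 1 := ⟨Int.fract_nonneg s, Int.fract_lt_one s⟩
    have ht : Int.fract t ∈ Ico (0:ℝ) 1 := ⟨Int.fract_nonneg t, Int.fract_lt_one t⟩
    have : Int.fract s = Int.fract t := by
      rcases le_total (Int.fract s) (Int.fract t) with h | h
      · exact key _ _ hs ht h hst
      · exact (key _ _ ht hs h hst.symm).symm
    have e1 := Int.floor_add_fract s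
    have e2 := Int.floor_add_fract t
    push_cast
    linarith
  · rw [← Path.symm_range β] at *
    rw [Path.symm_range, ← Path.trans_range, ← hγ, ← γ.extend_range]
    refine (range_comp_subset_range _ _).antisymm ?_
    rw [γ.extend_range]
    rintro _ ⟨t, rfl⟩
    rcases t.2.2.lt_or_eq with h | h
    · refine ⟨t, ?_⟩
      rw [Function.comp_apply, Int.fract_eq_self.2 ⟨t.2.1, h⟩, Path.extend_extends']
    · refine ⟨0, ?_⟩
      rw [Function.comp_apply, Int.fract_zero, h0, show t = 1 from Subtype.ext h, γ.target]

end Curves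

theorem IsArc.acyc {S : Type*} [MetricSpace S] [Surf S] {A : Set S} {u v : S} (h : IsArc A u v) :
    Acyc A := by
  obtain ⟨γ, h1, rfl⟩ := h
  have : range γ = γ.extend '' Icc 0 1 := by
    rw [← γ.extend_range]
    refine (image_subset_range _ _).antisymm' ?_
    rw [γ.extend_range]
    rintro _ ⟨t, rfl⟩
    exact ⟨t, t.2, Path.extend_extends' _ _⟩
  rw [this]
  refine acyc_arc zero_le_one γ.continuous_extend.continuousOn fun s hs t ht hst => ?_
  rw [Path.extend_apply _ hs, Path.extend_apply _ ht] at hst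
  exact congrArg Subtype.val (h1 hst)

/-- `F` is a connected open set with frontier `J`. -/
structure Face {S : Type*} [TopologicalSpace S] (J F : Set S) : Prop where
  isOpen : IsOpen F
  conn : IsConnected F
  frontier : frontier F = J

section FaceBasic

variable {S : Type*} [TopologicalSpace S] {J F : Set S} {p q : S}

theorem Face.closure_eq (h : Face J F) : closure F = F ∪ J := by
  rw [← h.frontier, closure_eq_self_union_frontier]

theorem Face.disjoint (h : Face J F) : Disjoint F J := by
  rw [← h.frontier, h.isOpen.frontier_eq]
  exact disjoint_sdiff_right

theorem Face.isClosed (h : Face J F) : IsClosed J := h.frontier ▸ isClosed_frontier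

theorem Face.jn (h : Face J F) (hp : p ∈ F) (hq : q ∈ F) : Jn J p q :=
  ⟨F, h.conn.isPreconnected, disjoint_left.1 h.disjoint, hp, hq⟩

theorem Face.mem_of_jn (h : Face J F) (hp : p ∈ F) (hq : Jn J p q) : q ∈ F := by
  obtain ⟨C, h1, h2, h3, h4⟩ := hq
  refine h1.subset_of_closure_inter_subset h.isOpen ⟨p, h3, hp⟩ ?_ h4
  rw [h.closure_eq]
  rintro x ⟨hx | hx, hxC⟩
  exacts [hx, absurd hx (h2 hxC)]

theorem closure_component_subset [LocallyConnectedSpace S] {K : Set S} (hK : IsClosed K) (p : S) :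
    closure (connectedComponentIn Kᶜ p) ⊆ connectedComponentIn Kᶜ p ∪ K := by
  intro x hx
  by_contra hx'
  simp only [mem_union, not_or] at hx'
  obtain ⟨y, hy, hy'⟩ := mem_closure_iff.1 hx _ (hK.isOpen_compl.connectedComponentIn (x := x))
    (mem_connectedComponentIn hx'.2)
  apply hx'.1
  rw [connectedComponentIn_eq hy', ← connectedComponentIn_eq hy]
  exact mem_connectedComponentIn hx'.2

end FaceBasic

theorem IsLoop.isCompact {X : Type*} [TopologicalSpace X] {f : ℝ → X} (hf : IsLoop f) :
    IsCompact (range f) := by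
  rw [hf.range_eq (a := 0) (b := 0) le_rfl (by norm_num)]
  exact (isCompact_Icc.image hf.cont).union (isCompact_Icc.image hf.cont)

section Jordan

variable {S : Type*} [MetricSpace S] [Surf S]

theorem triv_add_of_two_arcs {A B : Set S} {a b : S} (hA : Acyc A) (hB : Acyc B)
    (hAB : A ∩ B = {a, b}) {e e' : S → S → ZMod 2} (he : Coc e (A ∪ B)) (he' : Coc e' (A ∪ B))
    (h : ¬ Triv e (A ∪ B)) (h' : ¬ Triv e' (A ∪ B)) : Triv (e + e') (A ∪ B) := by
  have key : ∀ e : S → S → ZMod 2, Coc e (A ∪ B) → ¬ Triv e (A ∪ B) → ∃ s t,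
      SecOn e s A ∧ SecOn e t B ∧ t a = s a ∧ t b = s b + 1 := by
    intro e he h
    obtain ⟨s, hs⟩ := hA.triv e (he.mono subset_union_left)
    obtain ⟨t, ht⟩ := hB.triv e (he.mono subset_union_right)
    refine ⟨s, _, hs, ht.add_const (s a + t a), by grind, ?_⟩
    rcases zmod_cases (t b + (s a + t a) + s b) with h0 | h1
    · exfalso
      apply h
      classical
      refine ⟨fun x => if x ∈ A then s x else t x + (s a + t a), SecOn.closed_union hA.closed
        hB.closed (hs.congr fun x hx => by simp [hx]) ((ht.add_const (s a + t a)).congr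
        fun x hx => ?_) (he.mono fun x hx => Or.inl hx.1)⟩
      by_cases hxA : x ∈ A
      · rw [if_pos hxA]
        have : x ∈ ({a, b} : Set S) := hAB ▸ ⟨hxA, hx⟩
        rcases this with rfl | rfl <;> grind
      · rw [if_neg hxA]
    · grind
  obtain ⟨s, t, h1, h2, h3, h4⟩ := key e he h
  obtain ⟨s', t', h1', h2', h3', h4'⟩ := key e' he' h'
  classical
  refine ⟨fun x => if x ∈ A then s x + s' x else t x + t' x, SecOn.closed_union hA.closed
        hB.closed ((h1.add h1').congr fun x hx => by simp [hx]) ((h2.add h2').congr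
        fun x hx => ?_) ((he.add he').mono fun x hx => Or.inl hx.1)⟩
  by_cases hxA : x ∈ A
  · rw [if_pos hxA]
    have : x ∈ ({a, b} : Set S) := hAB ▸ ⟨hxA, hx⟩
    simp only [Pi.add_apply]
    rcases this with rfl | rfl <;> grind
  · rw [if_neg hxA]; rfl

theorem triv_of_lam_eq_zero [CocTriv S] {c : S → S → ZMod 2} {Q : Finset S}
    (hc : Coc c (Q : Set S)ᶜ) (h : ∀ v, lam c v = 0) : Triv c (Q : Set S)ᶜ := by
  obtain ⟨c', h5, h6⟩ := exists_unbranched isOpen_univ Q (by rwa [← compl_eq_univ_sdiff])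
    (fun v _ _ => lam_eq_zero.1 (h v))
  have h7 := h6.add ((CocTriv.triv c' h5).mono sdiff_subset)
  rwa [coch_add_cancel, ← compl_eq_univ_sdiff] at h7

theorem not_jn_circle {j : ℂ → S} (hj : IsOpenEmbedding j) {r : ℝ} {p q : S}
    (hp : p ∈ j '' ball 0 r) (hq : q ∉ j '' closedBall 0 r) : ¬ Jn (j '' sphere 0 r) p q := by
  rintro ⟨C, h1, h2, h3, h4⟩
  refine hq (image_mono ball_subset_closedBall (h1.subset_of_closure_inter_subset
    (hj.isOpenMap _ isOpen_ball) ⟨p, h3, hp⟩ ?_ h4))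
  rintro x ⟨hx, hxC⟩
  have hcl : closure (j '' ball 0 r) ⊆ j '' closedBall 0 r :=
    closure_minimal (image_mono ball_subset_closedBall)
      ((isCompact_closedBall (0:ℂ) r).image hj.continuous).isClosed
  obtain ⟨z, hz, rfl⟩ := hcl hx
  refine ⟨z, ?_, rfl⟩
  rcases (mem_closedBall.1 hz).lt_or_eq with h | h
  · exact h
  · exact absurd ⟨z, h, rfl⟩ (h2 hxC)

theorem exists_compact_connected {U K : Set S} (hU : IsOpen U) (hc : IsPreconnected U)
    (hK : IsCompact K) (hKU : K ⊆ U) : ∃ L, IsCompact L ∧ IsPreconnected L ∧ K ⊆ L ∧ L ⊆ U := by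
  rcases K.eq_empty_or_nonempty with rfl | ⟨u, hu⟩
  · exact ⟨∅, isCompact_empty, isPreconnected_empty, Subset.rfl, empty_subset _⟩
  have hp : IsPathConnected U := hU.isConnected_iff_isPathConnected.1 ⟨⟨u, hKU hu⟩, hc⟩
  have key : ∀ x ∈ U, ∃ N, IsCompact N ∧ IsPreconnected N ∧ N ∈ 𝓝 x ∧ u ∈ N ∧ N ⊆ U := by
    intro x hx
    obtain ⟨j, hj, rfl, hjU⟩ := Surf.chart x U (hU.mem_nhds hx)
    obtain ⟨γ, hγ⟩ := hp.joinedIn u (hKU hu) (j 0) hx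
    have h0 : j 0 ∈ j '' closedBall 0 1 := ⟨0, by simp, rfl⟩
    refine ⟨range γ ∪ j '' closedBall 0 1, (isCompact_range γ.continuous).union
      ((isCompact_closedBall (0:ℂ) 1).image hj.continuous),
      (isPreconnected_range γ.continuous).union (j 0) ⟨1, γ.target⟩ h0
        (acyc_disc hj one_pos).conn,
      mem_of_superset ((hj.isOpenMap _ isOpen_ball).mem_nhds ⟨0, mem_ball_self one_pos, rfl⟩)
        ((image_mono ball_subset_closedBall).trans subset_union_right), Or.inl ⟨0, γ.source⟩,
      union_subset (range_subset_iff.2 hγ) ((image_subset_range _ _).trans hjU)⟩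
  choose! N h1 h2 h3 h4 h5 using key
  obtain ⟨T, hT, hKT⟩ := hK.elim_nhds_subcover N fun x hx => h3 x (hKU hx)
  refine ⟨⋃ x ∈ T, N x, T.isCompact_biUnion fun x hx => h1 x (hKU (hT x hx)), ?_, hKT,
    iUnion₂_subset fun x hx => h5 x (hKU (hT x hx))⟩
  refine isPreconnected_of_forall u fun y hy => ?_
  obtain ⟨x, hx, hy⟩ := mem_iUnion₂.1 hy
  exact ⟨N x, subset_biUnion_of_mem (u := N) (show x ∈ (T : Set S) from hx),
    h4 x (hKU (hT x hx)), hy, h2 x (hKU (hT x hx))⟩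

variable [CompactSpace S] [ConnectedSpace S] [CocTriv S] {f : ℝ → S} {p q r : S}

theorem jn_of_three {A B : Set S} {a b : S} (hA : Acyc A) (hB : Acyc B)
    (hAB : A ∩ B = {a, b}) (hp : p ∉ A ∪ B) (hq : q ∉ A ∪ B) (hr : r ∉ A ∪ B)
    (hpq : ¬ Jn (A ∪ B) p q) (hqr : ¬ Jn (A ∪ B) q r) : Jn (A ∪ B) p r := by
  classical
  obtain ⟨e₁, h1⟩ := exists_dip p q
  obtain ⟨e₂, h2⟩ := exists_dip q r
  obtain ⟨e₃, h3⟩ := exists_dip p r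
  have hc := hA.closed.union hB.closed
  have hoff : ∀ x ∈ A ∪ B, x ≠ p ∧ x ≠ q ∧ x ≠ r := fun x hx =>
    ⟨by rintro rfl; exact hp hx, by rintro rfl; exact hq hx, by rintro rfl; exact hr hx⟩
  have h4 : Triv (e₁ + e₂) (A ∪ B) := triv_add_of_two_arcs hA hB hAB
    (h1.1.mono fun x hx => by simp [hoff x hx]) (h2.1.mono fun x hx => by simp [hoff x hx])
    (fun h => hpq (h1.jn_of_triv hc hp hq h)) (fun h => hqr (h2.jn_of_triv hc hq hr h))
  have k1 : Coc e₁ (({p, q, r} : Finset S) : Set S)ᶜ := h1.1.mono fun x hx => by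
    simp_all
  have k2 : Coc e₂ (({p, q, r} : Finset S) : Set S)ᶜ := h2.1.mono fun x hx => by
    simp_all
  have k3 : Coc e₃ (({p, q, r} : Finset S) : Set S)ᶜ := h3.1.mono fun x hx => by
    simp_all
  have h5 := triv_of_lam_eq_zero (k3.add (k1.add k2)) fun v => by
    rw [lam_add (pcoc_of_finset k3 v) ((pcoc_of_finset k1 v).add (pcoc_of_finset k2 v)),
      lam_add (pcoc_of_finset k1 v) (pcoc_of_finset k2 v), h1.2, h2.2, h3.2]
    grind
  have h6 := (h5.mono (V := A ∪ B) fun x hx => by simp [hoff x hx]).add h4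
  rw [coch_add_cancel] at h6
  exact h3.jn_of_triv hc hp hr h6

theorem exists_not_jn {A B : Set S} {a b : S} (hA : IsArc A a b) (hB : IsArc B a b)
    (hAB : A ∩ B = {a, b}) : ∃ p q, p ∉ A ∪ B ∧ q ∉ A ∪ B ∧ ¬ Jn (A ∪ B) p q := by
  by_contra hcon
  push Not at hcon
  have hab := hA.ne
  obtain ⟨j, hj, rfl, hjU⟩ := Surf.chart a {b}ᶜ (isOpen_compl_singleton.mem_nhds hab)
  have hAc := hA.isCompact.isClosed
  have hBc := hB.isCompact.isClosed
  have hconn : IsPreconnected (A ∪ B)ᶜ := by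
    refine isPreconnected_of_forall_pair fun x hx y hy => ?_
    obtain ⟨C, h1, h2, h3, h4⟩ := hcon x y hx hy
    exact ⟨C, h2, h3, h4, h1⟩
  set κ := j '' sphere 0 1 with hκ
  have hκc : IsCompact κ := (isCompact_sphere _ _).image hj.continuous
  have hκab : ∀ x ∈ κ, x ≠ j 0 ∧ x ≠ b := by
    rintro _ ⟨z, hz, rfl⟩
    refine ⟨fun h => ?_, fun h => hjU (mem_range_self z) h⟩
    rw [hj.injective h] at hz
    simp at hz
  set K1 := {x ∈ κ | infDist x B ≤ infDist x A} with hK1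
  set K2 := {x ∈ κ | infDist x A ≤ infDist x B} with hK2
  have hc1 : IsCompact K1 := hκc.inter_right
    (isClosed_le (continuous_infDist_pt B) (continuous_infDist_pt A))
  have hc2 : IsCompact K2 := hκc.inter_right
    (isClosed_le (continuous_infDist_pt A) (continuous_infDist_pt B))
  have key : ∀ A B : Set S, IsClosed B → B.Nonempty → A ∩ B = {j 0, b} → ∀ x ∈ κ,
      infDist x B ≤ infDist x A → x ∉ A := by
    intro A B hB hBn hAB x hx hle hxA
    rw [infDist_zero_of_mem hxA] at hle
    have : x ∈ B := (hB.mem_iff_infDist_zero hBn).2 (le_antisymm hle infDist_nonneg)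
    have : x ∈ ({j 0, b} : Set S) := hAB ▸ ⟨hxA, this⟩
    rcases this with h | h
    exacts [(hκab x hx).1 h, (hκab x hx).2 h]
  have hK1A : ∀ x ∈ K1, x ∉ A := fun x hx => key A B hBc ⟨_, hB.left_mem⟩ hAB x hx.1 hx.2
  have hK2B : ∀ x ∈ K2, x ∉ B := fun x hx =>
    key B A hAc ⟨_, hA.left_mem⟩ (inter_comm A B ▸ hAB) x hx.1 hx.2
  obtain ⟨L, hL, hLc, hKL, hLU⟩ := exists_compact_connected (hAc.union hBc).isOpen_compl hconn
    (hc1.inter hc2) (fun x hx h => h.elim (hK1A x hx.1) (hK2B x hx.2))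
  obtain ⟨e, he⟩ := exists_dip (j 0) b
  have t1 : Triv e (K1 ∪ L) := he.triv_of_jn (hc1.union hL).isClosed ⟨A, hA.isPreconnected,
    fun x hx h => h.elim (fun h => hK1A x h hx) (fun h => hLU h (Or.inl hx)), hA.left_mem,
    hA.right_mem⟩
  have t2 : Triv e (K2 ∪ L) := he.triv_of_jn (hc2.union hL).isClosed ⟨B, hB.isPreconnected,
    fun x hx h => h.elim (fun h => hK2B x h hx) (fun h => hLU h (Or.inr hx)), hB.left_mem,
    hB.right_mem⟩
  have hI : (K1 ∪ L) ∩ (K2 ∪ L) = L := by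
    rw [← inter_union_distrib_right]
    exact union_eq_right.2 hKL
  have t3 := t1.closed_glue (hc1.union hL).isClosed (hc2.union hL).isClosed t2 (he.1.mono (by
      rw [hI]
      rintro x hx (rfl | rfl)
      exacts [hLU hx (Or.inl hA.left_mem), hLU hx (Or.inl hA.right_mem)])) (hI.symm ▸ hLc)
  have t4 : Triv e κ := t3.mono fun x hx => by
    rcases le_total (infDist x B) (infDist x A) with h | h
    exacts [Or.inl (Or.inl ⟨hx, h⟩), Or.inr (Or.inl ⟨hx, h⟩)]
  refine not_jn_circle hj (r := 1) ⟨0, mem_ball_self one_pos, rfl⟩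
    (fun ⟨z, _, hz⟩ => hjU (mem_range_self z) hz) (he.jn_of_triv hκc.isClosed
    (fun h => (hκab _ h).1 rfl) (fun h => (hκab _ h).2 rfl) t4)

/-- A complementary component of a closed curve that is not everything accumulates at every point of
the curve. -/
theorem IsLoop.subset_closure (hf : IsLoop f) (hp : p ∉ range f) (hq : q ∉ range f)
    (h : ¬ Jn (range f) p q) : range f ⊆ closure (connectedComponentIn (range f)ᶜ p) := by
  have hJ := hf.isCompact.isClosed
  set C := connectedComponentIn (range f)ᶜ p with hC
  rintro _ ⟨t, rfl⟩
  by_contra hx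
  have hV : (closure C)ᶜ ∈ 𝓝 (f t) := isClosed_closure.isOpen_compl.mem_nhds hx
  obtain ⟨δ, hδ, hδ2, hδV⟩ : ∃ δ > 0, δ < 1/2 ∧ f '' Icc (t - δ) (t + δ) ⊆ (closure C)ᶜ := by
    obtain ⟨ε, hε, h⟩ := Metric.mem_nhds_iff.1 (hf.cont.continuousAt hV)
    refine ⟨min (ε/2) (1/4), by positivity, lt_of_le_of_lt (min_le_right _ _) (by norm_num), ?_⟩
    rintro _ ⟨s, hs, rfl⟩
    refine h ?_
    rw [mem_ball, Real.dist_eq, abs_lt]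
    have := min_le_left (ε/2) (1/4)
    exact ⟨by linarith [hs.1], by linarith [hs.2]⟩
  have hA := (hf.isArc (a := t + δ) (b := t - δ + 1) (by linarith) (by linarith)).acyc
  have hJA : range f ⊆ (closure C)ᶜ ∪ f '' Icc (t + δ) (t - δ + 1) := by
    rw [hf.range_eq (a := t - δ) (b := t + δ) (by linarith) (by linarith)]
    exact union_subset_union_left _ hδV
  obtain ⟨D, h1, h2, h3, h4⟩ := hA.jn (fun h => hp (image_subset_range _ _ h))
    (fun h => hq (image_subset_range _ _ h))
  have := h1.subset_of_closure_inter_subset (hJ.isOpen_compl.connectedComponentIn (x := p))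
    ⟨p, h3, mem_connectedComponentIn hp⟩ fun x hx => by
      rcases closure_component_subset hJ p hx.1 with h | h
      · exact h
      · rcases hJA h with h' | h'
        exacts [absurd hx.1 h', absurd h' (h2 hx.2)]
  exact h ((jn_iff hp).2 (this h4))

theorem IsLoop.exists_arcs (hf : IsLoop f) : ∃ A B, IsArc A (f 0) (f (1/2)) ∧
    IsArc B (f 0) (f (1/2)) ∧ A ∪ B = range f ∧ A ∩ B = {f 0, f (1/2)} :=
  hf.split (mem_range_self _) (mem_range_self _) (hf.isArc (by norm_num) (by norm_num)).ne

theorem IsLoop.exists_other (hf : IsLoop f) (hp : p ∉ range f) :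
    ∃ q, q ∉ range f ∧ ¬ Jn (range f) p q := by
  obtain ⟨A, B, hA, hB, hU, hI⟩ := hf.exists_arcs
  obtain ⟨x, y, hx, hy, hxy⟩ := exists_not_jn hA hB hI
  rw [hU] at *
  by_cases h : Jn (range f) p x
  · exact ⟨y, hy, fun h' => hxy (h.symm.trans h')⟩
  · exact ⟨x, hx, h⟩

theorem IsLoop.jn_of_three (hf : IsLoop f) (hp : p ∉ range f) (hq : q ∉ range f)
    (hr : r ∉ range f) (hpq : ¬ Jn (range f) p q) (hqr : ¬ Jn (range f) q r) :
    Jn (range f) p r := by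
  obtain ⟨A, B, hA, hB, hU, hI⟩ := hf.exists_arcs
  rw [← hU] at hp hq hr hpq hqr ⊢
  exact _root_.jn_of_three hA.acyc hB.acyc hI hp hq hr hpq hqr

/-- The Jordan curve theorem: components of the complement. -/
theorem IsLoop.face (hf : IsLoop f) (hp : p ∉ range f) :
    Face (range f) (connectedComponentIn (range f)ᶜ p) := by
  obtain ⟨q, hq, hpq⟩ := hf.exists_other hp
  have hJ := hf.isCompact.isClosed
  have ho := hJ.isOpen_compl.connectedComponentIn (x := p)
  refine ⟨ho, ⟨⟨p, mem_connectedComponentIn hp⟩, isPreconnected_connectedComponentIn⟩, ?_⟩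
  rw [ho.frontier_eq]
  apply Subset.antisymm
  · rintro x ⟨hx, hx'⟩
    exact (closure_component_subset hJ p hx).resolve_left hx'
  · exact fun x hx => ⟨hf.subset_closure hp hq hpq hx,
      fun h => connectedComponentIn_subset _ _ h hx⟩

/-- The Jordan curve theorem: the other side of a face. -/
theorem IsLoop.other_face (hf : IsLoop f) {F : Set S} (hF : Face (range f) F) :
    Face (range f) (closure F)ᶜ := by
  obtain ⟨p, hp⟩ := hF.conn.nonempty
  have hp' := disjoint_left.1 hF.disjoint hp
  obtain ⟨q, hq, hpq⟩ := hf.exists_other hp'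
  have : (closure F)ᶜ = connectedComponentIn (range f)ᶜ q := by
    ext x
    rw [hF.closure_eq, mem_compl_iff, mem_union, not_or]
    constructor
    · rintro ⟨hx, hxJ⟩
      exact (jn_iff hq).1 (hf.jn_of_three hq hp' hxJ (fun h => hpq h.symm)
        fun h => hx (hF.mem_of_jn hp h))
    · intro hx
      have := (jn_iff hq).2 hx
      exact ⟨fun h => hpq ((hF.jn hp h).trans this.symm), this.symm.left⟩
  rw [this]
  exact hf.face hq

end Jordan

section Theta

variable {S : Type*} [MetricSpace S] [Surf S] [CompactSpace S] [ConnectedSpace S] [CocTriv S]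
  {f : ℝ → S} {F : Set S} {u v : S}

theorem IsArc.exists_interior {X : Type*} [TopologicalSpace X] {A : Set X} {u v : X}
    (h : IsArc A u v) : ∃ x ∈ A, x ≠ u ∧ x ≠ v := by
  obtain ⟨γ, h1, rfl⟩ := h
  refine ⟨γ ⟨1/2, by norm_num, by norm_num⟩, mem_range_self _, fun h => ?_, fun h => ?_⟩
  · have := congrArg Subtype.val (h1 (h.trans γ.source.symm))
    norm_num at this
  · have := congrArg Subtype.val (h1 (h.trans γ.target.symm))
    norm_num at this

/-- A crosscut divides a face of a closed curve into two faces. -/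
theorem theta (hf : IsLoop f) (hF : Face (range f) F) {A B C : Set S} (hA : IsArc A u v)
    (hB : IsArc B u v) (hU : A ∪ B = range f) (hI : A ∩ B = {u, v}) (hC : IsArc C u v)
    (hCF : C \ {u, v} ⊆ F) :
    ∃ F₁ F₂, Face (C ∪ A) F₁ ∧ Face (C ∪ B) F₂ ∧ Disjoint F₁ F₂ ∧ F₁ ∪ F₂ = F \ C := by
  have hE := hf.other_face hF
  obtain ⟨e, he⟩ := hE.conn.nonempty
  have hFJ := disjoint_left.1 hF.disjoint
  have huJ : u ∈ range f := hU ▸ Or.inl hA.left_mem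
  have hvJ : v ∈ range f := hU ▸ Or.inl hA.right_mem
  have hCFJ : C ⊆ closure F := fun x hx => by
    rw [hF.closure_eq]
    by_cases h : x ∈ ({u, v} : Set S)
    · right
      rcases h with rfl | rfl
      exacts [huJ, hvJ]
    · exact Or.inl (hCF ⟨hx, h⟩)
  have hCJ : ∀ x ∈ C, x ∈ range f → x ∈ ({u, v} : Set S) := fun x hx hxJ => by
    by_contra h
    exact hFJ (hCF ⟨hx, h⟩) hxJ
  have key : ∀ A, IsArc A u v → A ⊆ range f → ∃ F₁, Face (C ∪ A) F₁ ∧ F₁ ⊆ F \ C ∧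
      ∀ p ∉ C ∪ A, p ∉ F₁ → Jn (C ∪ A) p e := by
    intro A hA hAJ
    obtain ⟨g, hg, hgr⟩ := hC.loop hA fun x hx => hCJ x hx.1 (hAJ hx.2)
    have hd : closure F ⊇ range g := by
      rw [hgr]
      exact union_subset hCFJ (hAJ.trans (hF.closure_eq ▸ subset_union_right))
    have heg : e ∉ range g := fun h => he (hd h)
    have hG := hg.face heg
    have hF₁ := hg.other_face hG
    have hEG : (closure F)ᶜ ⊆ connectedComponentIn (range g)ᶜ e :=
      hE.conn.isPreconnected.subset_connectedComponentIn he (compl_subset_compl.2 hd)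
    rw [← hgr]
    refine ⟨_, hF₁, fun x hx => ⟨?_, fun h => ?_⟩, fun p hp hpF => ?_⟩
    · by_contra hxF
      apply hx
      by_cases hxJ : x ∈ range f
      · rw [← hE.frontier] at hxJ
        exact closure_mono hEG (frontier_subset_closure hxJ)
      · exact subset_closure (hEG fun h => (hF.closure_eq ▸ h).elim hxF hxJ)
    · exact disjoint_left.1 hF₁.disjoint hx (hgr ▸ Or.inl h)
    · rw [mem_compl_iff, not_not, hG.closure_eq] at hpF
      exact hG.jn (hpF.resolve_right hp) (mem_connectedComponentIn heg)
  obtain ⟨F₁, h1, h2, h3⟩ := key A hA (hU ▸ subset_union_left)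
  obtain ⟨F₂, k1, k2, k3⟩ := key B hB (hU ▸ subset_union_right)
  have hAF : ∀ x ∈ F, x ∉ A := fun x hx h => hFJ hx (hU ▸ Or.inl h)
  have hBF : ∀ x ∈ F, x ∉ B := fun x hx h => hFJ hx (hU ▸ Or.inr h)
  refine ⟨F₁, F₂, h1, k1, ?_, ?_⟩
  · rw [disjoint_iff_inter_eq_empty]
    by_contra hne
    obtain ⟨x, hx1, hx2⟩ := nonempty_iff_ne_empty.2 hne
    have e1 : F₂ ⊆ F₁ := k1.conn.isPreconnected.subset_of_closure_inter_subset h1.isOpen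
      ⟨x, hx2, hx1⟩ fun y hy => by
        rw [h1.closure_eq] at hy
        exact hy.1.resolve_right fun h => h.elim (k2 hy.2).2 (hAF y (k2 hy.2).1)
    have e2 : F₁ ⊆ F₂ := h1.conn.isPreconnected.subset_of_closure_inter_subset k1.isOpen
      ⟨x, hx1, hx2⟩ fun y hy => by
        rw [k1.closure_eq] at hy
        exact hy.1.resolve_right fun h => h.elim (h2 hy.2).2 (hBF y (h2 hy.2).1)
    have e3 : C ∪ A = C ∪ B := by rw [← h1.frontier, ← k1.frontier, e1.antisymm e2]
    obtain ⟨y, hy, hyu, hyv⟩ := hA.exists_interior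
    have hyuv : y ∉ ({u, v} : Set S) := by simp [hyu, hyv]
    rcases (e3 ▸ Or.inr hy : y ∈ C ∪ B) with h | h
    · exact hyuv (hCJ y h (hU ▸ Or.inl hy))
    · exact hyuv (hI ▸ ⟨hy, h⟩)
  · refine (union_subset h2 k2).antisymm fun p hp => ?_
    by_contra hpn
    rw [mem_union, not_or] at hpn
    have j1 := h3 p (fun h => h.elim hp.2 (hAF p hp.1)) hpn.1
    have j2 := k3 p (fun h => h.elim hp.2 (hBF p hp.1)) hpn.2
    have j3 := janiszewski h1.isClosed k1.isClosed (by
      rw [← union_inter_distrib_left, hI]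
      rw [union_eq_left.2 (by rintro x (rfl | rfl); exacts [hC.left_mem, hC.right_mem])]
      exact hC.isPreconnected) j1 j2
    have j4 : Jn (range f) p e := j3.mono (by
      rw [← hU]
      exact union_subset_union subset_union_right subset_union_right)
    exact he (subset_closure (hF.mem_of_jn hp.1 j4))

/-- A face of a closed curve is locally connected at its boundary points. -/
theorem Face.locally_joined (hf : IsLoop f) (hF : Face (range f) F) (hu : u ∈ range f) {V : Set S}
    (hV : V ∈ 𝓝 u) : ∃ W ∈ 𝓝 u, ∀ x ∈ F ∩ W, ∀ y ∈ F ∩ W, JoinedIn (F ∩ V) x y := by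
  obtain ⟨t, rfl⟩ := hu
  obtain ⟨j, hj, h0, hjV⟩ := Surf.chart (f t) V hV
  set D := j '' ball 0 1 with hD
  have hDo : IsOpen D := hj.isOpenMap _ isOpen_ball
  have hDu : D ∈ 𝓝 (f t) := hDo.mem_nhds ⟨0, mem_ball_self one_pos, h0⟩
  obtain ⟨δ, hδ, hδ2, hδV⟩ : ∃ δ > 0, δ < 1/2 ∧ f '' Icc (t - δ) (t + δ) ⊆ D := by
    obtain ⟨ε, hε, h⟩ := Metric.mem_nhds_iff.1 (hf.cont.continuousAt hDu)
    refine ⟨min (ε/2) (1/4), by positivity, lt_of_le_of_lt (min_le_right _ _) (by norm_num), ?_⟩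
    rintro _ ⟨s, hs, rfl⟩
    refine h ?_
    rw [mem_ball, Real.dist_eq, abs_lt]
    have := min_le_left (ε/2) (1/4)
    exact ⟨by linarith [hs.1], by linarith [hs.2]⟩
  set B := f '' Icc (t + δ) (t - δ + 1) with hB
  have hBa := hf.isArc (a := t + δ) (b := t - δ + 1) (by linarith) (by linarith)
  have hBc : IsClosed B := hBa.isCompact.isClosed
  have huB : f t ∉ B := by
    rintro ⟨s, hs, hst⟩
    have := hf.injOn (a := t) (b := t - δ + 1) (by linarith) ⟨by linarith [hs.1], hs.2⟩
      ⟨le_rfl, by linarith⟩ hst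
    linarith [hs.1]
  have hJB : range f ⊆ D ∪ B := by
    rw [hf.range_eq (a := t - δ) (b := t + δ) (by linarith) (by linarith)]
    exact union_subset_union_left _ hδV
  obtain ⟨r, hr, hrB⟩ : ∃ r > 0, ball 0 r ⊆ j ⁻¹' Bᶜ :=
    Metric.mem_nhds_iff.1 (hj.continuous.continuousAt (hBc.isOpen_compl.mem_nhds (h0 ▸ huB)))
  refine ⟨j '' ball 0 (min r 1), (hj.isOpenMap _ isOpen_ball).mem_nhds
    ⟨0, mem_ball_self (by positivity), h0⟩, ?_⟩
  rintro x ⟨hxF, hx⟩ y ⟨hyF, hy⟩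
  have hsub : j '' ball 0 (min r 1) ⊆ (B ∪ Dᶜ)ᶜ := by
    rintro _ ⟨z, hz, rfl⟩ (h | h)
    · exact hrB (ball_subset_ball (min_le_left _ _) hz) h
    · exact h ⟨z, ball_subset_ball (min_le_right _ _) hz, rfl⟩
  have h1 : Jn (B ∪ Dᶜ) x y := ⟨_, (convex_ball (0:ℂ) (min r 1)).isPreconnected.image _
    hj.continuous.continuousOn, hsub, hx, hy⟩
  have h2 := janiszewski hF.isClosed (hBc.union hDo.isClosed_compl) (by
    have : range f ∩ (B ∪ Dᶜ) = B := by
      apply Subset.antisymm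
      · rintro z ⟨hz, h | h⟩
        exacts [h, (hJB hz).resolve_left h]
      · exact fun z hz => ⟨image_subset_range _ _ hz, Or.inl hz⟩
    rw [this]
    exact hBa.isPreconnected) (hF.jn hxF hyF) h1
  obtain ⟨C, c1, c2, c3, c4⟩ := h2
  have hCF : C ⊆ F ∩ D := fun z hz => by
    refine ⟨hF.mem_of_jn hxF ⟨C, c1, fun w hw h => c2 hw (Or.inl h), c3, hz⟩, ?_⟩
    by_contra h
    exact c2 hz (Or.inr (Or.inr h))
  have ho : IsOpen (F ∩ D) := hF.isOpen.inter hDo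
  have hp := (ho.connectedComponentIn (x := x)).isConnected_iff_isPathConnected.1
    ⟨⟨x, mem_connectedComponentIn (hCF c3)⟩, isPreconnected_connectedComponentIn⟩
  refine (hp.joinedIn x (mem_connectedComponentIn (hCF c3)) y
    (c1.subset_connectedComponentIn c3 hCF c4)).mono ((connectedComponentIn_subset _ _).trans ?_)
  exact inter_subset_inter_right _ ((image_subset_range _ _).trans hjV)

end Theta

/-- Countable concatenation of paths converging to a point. -/
theorem joinedIn_of_seq {X : Type*} [TopologicalSpace X] [FirstCountableTopology X] {F : Set X}
    {u : X} (hu : u ∈ closure F)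
    (h : ∀ V ∈ 𝓝 u, ∃ W ∈ 𝓝 u, ∀ x ∈ F ∩ W, ∀ y ∈ F ∩ W, JoinedIn (F ∩ V) x y) :
    ∃ p ∈ F, JoinedIn (F ∪ {u}) p u := by
  obtain ⟨V, hV⟩ := (𝓝 u).exists_antitone_basis
  choose! W hW hWj using fun n => h (V n) (hV.mem n)
  have hW' : ∀ n, (⋂ k ∈ Iic n, W k) ∈ 𝓝 u := fun n =>
    (biInter_mem (finite_Iic n)).2 fun k _ => hW k
  choose p hp using fun n => mem_closure_iff_nhds.1 hu _ (hW' n)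
  have hj : ∀ n, JoinedIn (F ∩ V n) (p n) (p (n + 1)) := fun n =>
    hWj n _ ⟨(hp n).2, mem_iInter₂.1 (hp n).1 n (mem_Iic.2 le_rfl)⟩ _
      ⟨(hp (n + 1)).2, mem_iInter₂.1 (hp (n + 1)).1 n (mem_Iic.2 n.le_succ)⟩
  choose γ hγ using hj
  set g : ℝ → X := fun t => (γ ⌊t⌋₊).extend (t - ⌊t⌋₊) with hg
  have hgn : ∀ n : ℕ, EqOn g (fun t => (γ n).extend (t - n)) (Icc n (n + 1)) := by
    intro n t ht
    rcases ht.2.lt_or_eq with h1 | h1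
    · have : ⌊t⌋₊ = n := (Nat.floor_eq_iff (n.cast_nonneg.trans ht.1)).2 ⟨ht.1, h1⟩
      subst this
      rfl
    · have : ⌊t⌋₊ = n + 1 := by
        rw [h1]; exact_mod_cast Nat.floor_natCast (n + 1)
      simp [hg, h1]
      have h2 : ⌊(n:ℝ) + 1⌋₊ = n + 1 := by rw [← h1, this]
      rw [h2]
      simp
  have hgc : ∀ n : ℕ, ContinuousOn g (Icc 0 n) := by
    intro n
    induction n with
    | zero => simp
    | succ n ih =>
      have : Icc (0:ℝ) (n + 1 : ℕ) = Icc (0:ℝ) (n:ℝ) ∪ Icc (n:ℝ) (n + 1) := by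
        rw [Icc_union_Icc_eq_Icc (n.cast_nonneg) (by linarith)]
        push_cast; rfl
      rw [this]
      refine ih.union_of_isClosed ?_ isClosed_Icc isClosed_Icc
      exact (((γ n).continuous_extend.comp (by fun_prop)).continuousOn).congr (hgn n)
  have hgF : ∀ t, 0 ≤ t → g t ∈ F ∩ V ⌊t⌋₊ := by
    intro t ht
    have : g t ∈ range (γ ⌊t⌋₊) := by
      rw [← Path.extend_range]; exact mem_range_self _
    obtain ⟨s, hs⟩ := this
    rw [← hs]
    exact hγ _ s
  have hgt : Tendsto g atTop (𝓝 u) := by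
    refine hV.tendsto_right_iff.2 fun n _ => ?_
    filter_upwards [eventually_ge_atTop (n:ℝ)] with t ht
    exact hV.antitone (Nat.le_floor ht) (hgF t (n.cast_nonneg.trans ht)).2
  set k : ℝ → X := fun t => if t < 1 then g (t / (1 - t)) else u with hk
  have hkc : ContinuousOn k (Icc 0 1) := by
    intro t ht
    rcases ht.2.lt_or_eq with h1 | rfl
    · have hd : 0 < 1 - t := by linarith
      set n := ⌊t / (1 - t)⌋₊ + 1 with hn
      have hlt : t / (1 - t) < n := by
        rw [hn]; push_cast; exact Nat.lt_floor_add_one _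
      have h2 : ContinuousWithinAt (fun s : ℝ => s / (1 - s)) (Icc 0 1) t :=
        (continuousAt_id.div (continuousAt_const.sub continuousAt_id) hd.ne').continuousWithinAt
      have hev : ∀ᶠ s in 𝓝[Icc 0 1] t, s < 1 ∧ s / (1 - s) ∈ Icc (0:ℝ) n := by
        filter_upwards [self_mem_nhdsWithin, h2.eventually (gt_mem_nhds hlt),
          mem_nhdsWithin_of_mem_nhds (gt_mem_nhds h1)] with s hs hs2 hs3
        have hs3 : s < 1 := hs3
        exact ⟨hs3, div_nonneg hs.1 (by linarith), hs2.le⟩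
      have h3 : ContinuousWithinAt (fun s : ℝ => g (s / (1 - s))) (Icc 0 1) t := by
        have hmem : t / (1 - t) ∈ Icc (0:ℝ) n := ⟨div_nonneg ht.1 hd.le, hlt.le⟩
        refine Tendsto.comp (hgc n _ hmem) (tendsto_nhdsWithin_iff.2 ⟨h2, hev.mono fun s hs => hs.2⟩)
      refine h3.congr_of_eventuallyEq (hev.mono fun s hs => if_pos hs.1) (if_pos h1)
    · have hu1 : k 1 = u := if_neg (lt_irrefl _)
      rw [ContinuousWithinAt, hu1]
      have h2 : Tendsto (fun s : ℝ => s / (1 - s)) (𝓝[<] 1) atTop := by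
        have a1 : Tendsto (fun s : ℝ => 1 - s) (𝓝[<] 1) (𝓝[>] 0) := by
          refine tendsto_nhdsWithin_iff.2 ⟨?_, ?_⟩
          · have : Tendsto (fun s : ℝ => 1 - s) (𝓝 1) (𝓝 (1 - 1)) :=
              (continuous_const.sub continuous_id).tendsto 1
            rw [sub_self] at this
            exact this.mono_left nhdsWithin_le_nhds
          · filter_upwards [self_mem_nhdsWithin] with s hs
            exact sub_pos.2 (show s < 1 from hs)
        have a2 : Tendsto (fun s : ℝ => s) (𝓝[<] 1) (𝓝 1) := nhdsWithin_le_nhds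
        simpa [div_eq_mul_inv] using a2.pos_mul_atTop one_pos (tendsto_inv_nhdsGT_zero.comp a1)
      intro U hU
      have h3 := (hgt.comp h2) hU
      rw [mem_map, mem_nhdsWithin] at *
      obtain ⟨O, hO, h1O, hOs⟩ := h3
      refine ⟨O, hO, h1O, fun s hs => ?_⟩
      by_cases hs1 : s < 1
      · show k s ∈ U
        simp only [hk, if_pos hs1]
        exact hOs ⟨hs.1, hs1⟩
      · show k s ∈ U
        simp only [hk, if_neg hs1]
        exact mem_of_mem_nhds hU
  have hk0 : k 0 = p 0 := by simp [hk, hg]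
  refine ⟨p 0, (hp 0).2, ⟨⟨⟨fun t : I => k t, hkc.comp_continuous continuous_subtype_val
    fun t => t.2⟩, hk0, by simp [hk]⟩, fun t => ?_⟩⟩
  show k t ∈ _
  by_cases ht : (t:ℝ) < 1
  · simp only [hk, if_pos ht]
    exact Or.inl (hgF _ (div_nonneg t.2.1 (by linarith))).1
  · simp only [hk, if_neg ht]
    exact Or.inr rfl

section Access

variable {S : Type*} [MetricSpace S] [Surf S] [CompactSpace S] [ConnectedSpace S] [CocTriv S]
  {f : ℝ → S} {F : Set S} {u v : S}

theorem Face.joinedIn_point (hf : IsLoop f) (hF : Face (range f) F) (hu : u ∈ range f) {x : S}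
    (hx : x ∈ F) : JoinedIn (F ∪ {u}) x u := by
  have : u ∈ closure F := by rw [hF.closure_eq]; exact Or.inr hu
  obtain ⟨p, hp, h⟩ := joinedIn_of_seq this fun V hV => hF.locally_joined hf hu hV
  exact (((hF.isOpen.isConnected_iff_isPathConnected.1 hF.conn).joinedIn x hx p hp).mono
    subset_union_left).trans h

theorem Face.joinedIn_pair (hf : IsLoop f) (hF : Face (range f) F) (hu : u ∈ range f)
    (hv : v ∈ range f) : JoinedIn (F ∪ {u, v}) u v := by
  obtain ⟨x, hx⟩ := hF.conn.nonempty
  exact ((hF.joinedIn_point hf hu hx).symm.mono (union_subset_union_right _ (by simp))).trans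
    ((hF.joinedIn_point hf hv hx).mono (union_subset_union_right _ (by simp)))

end Access

section PathArc

variable {X : Type*} [MetricSpace X] {γ : ℝ → X} {a b : ℝ}

/-- If a path identifies exactly the end points of the gaps of a compact set `K`, then the image
of `K` is an arc. -/
theorem isArc_image_of_gaps (hγ : Continuous γ) {K : Set ℝ} (hK : IsCompact K) (haK : a ∈ K)
    (hbK : b ∈ K) (hKI : K ⊆ Icc a b) (hab : γ a ≠ γ b)
    (H : ∀ s ∈ K, ∀ t ∈ K, s < t → (γ s = γ t ↔ Ioo s t ∩ K = ∅)) :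
    IsArc (γ '' K) (γ a) (γ b) := by
  obtain ⟨e, he⟩ := TopologicalSpace.exists_dense_seq ℝ
  set φ : ℝ → ℝ → ℝ := fun q r => min 1 (infDist (γ r) (γ '' (K ∩ Iic q))) with hφ
  have hφc : ∀ q, Continuous (φ q) := fun q =>
    continuous_const.min ((continuous_infDist_pt _).comp hγ)
  set ρ : ℝ → ℝ → ℝ := fun q t => sSup (φ q '' (K ∩ Iic t)) with hρ
  have hbd : ∀ q t, BddAbove (φ q '' (K ∩ Iic t)) := fun q t =>
    ⟨1, by rintro _ ⟨r, -, rfl⟩; exact min_le_left _ _⟩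
  have hφ0 : ∀ q r, 0 ≤ φ q r := fun q r => le_min zero_le_one infDist_nonneg
  have hφρ : ∀ q, ∀ r ∈ K, ∀ t, r ≤ t → φ q r ≤ ρ q t := fun q r hr t hrt =>
    le_csSup (hbd q t) ⟨r, ⟨hr, hrt⟩, rfl⟩
  have hρle : ∀ q, ∀ t ∈ K, ∀ x, (∀ r ∈ K, r ≤ t → φ q r ≤ x) → ρ q t ≤ x := by
    intro q t ht x hx
    refine csSup_le ⟨_, t, ⟨ht, self_mem_Iic⟩, rfl⟩ ?_
    rintro _ ⟨r, hr, rfl⟩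
    exact hx r hr.1 hr.2
  have hρ0 : ∀ q, ∀ t ∈ K, 0 ≤ ρ q t := fun q t ht => (hφ0 q t).trans (hφρ q t ht t le_rfl)
  have hρ1 : ∀ q, ∀ t ∈ K, ρ q t ≤ 1 := fun q t ht => hρle q t ht 1 fun r _ _ => min_le_left _ _
  have hρm : ∀ q, ∀ s ∈ K, ∀ t, s ≤ t → ρ q s ≤ ρ q t := fun q s hs t hst =>
    hρle q s hs _ fun r hr hrs => hφρ q r hr t (hrs.trans hst)
  have hρc : ∀ q, ContinuousOn (ρ q) K := by
    intro q
    have hu := hK.uniformContinuousOn_of_continuous (hφc q).continuousOn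
    rw [Metric.uniformContinuousOn_iff] at hu
    have key : ∀ ε > 0, ∃ δ > 0, ∀ s ∈ K, ∀ t ∈ K, dist s t < δ → ρ q t < ρ q s + ε := by
      intro ε hε
      obtain ⟨δ, hδ, h⟩ := hu (ε / 2) (by positivity)
      refine ⟨δ, hδ, fun s hs t ht hst => ?_⟩
      refine lt_of_le_of_lt (hρle q t ht (ρ q s + ε / 2) fun r hr hrt => ?_) (by linarith)
      rcases le_total r s with h1 | h1
      · linarith [hφρ q r hr s h1]
      · have h2 := h r hr s hs (by
          rw [Real.dist_eq, abs_of_nonneg (by linarith)]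
          rw [dist_comm, Real.dist_eq, abs_of_nonneg (by linarith)] at hst
          linarith)
        rw [Real.dist_eq, abs_lt] at h2
        linarith [hφρ q s hs s le_rfl]
    rw [Metric.continuousOn_iff]
    intro s hs ε hε
    obtain ⟨δ, hδ, h⟩ := key ε hε
    refine ⟨δ, hδ, fun t ht hd => ?_⟩
    have h1 := h t ht s hs hd
    have h2 := h s hs t ht (by rwa [dist_comm])
    rw [Real.dist_eq, abs_lt]
    constructor <;> linarith
  have hρg : ∀ q, ∀ s ∈ K, ∀ t ∈ K, s < t → γ s = γ t → ρ q s = ρ q t := by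
    intro q s hs t ht hst hg
    refine (hρm q s hs t hst.le).antisymm (hρle q t ht _ fun r hr hrt => ?_)
    rcases le_or_gt r s with h1 | h1
    · exact hφρ q r hr s h1
    · rcases hrt.lt_or_eq with h2 | rfl
      · exact ((eq_empty_iff_forall_notMem.1 ((H s hs t ht hst).1 hg)) r ⟨⟨h1, h2⟩, hr⟩).elim
      · have : φ q r = φ q s := by simp only [hφ, hg]
        rw [this]
        exact hφρ q s hs s le_rfl
  set m : ℝ → ℝ := fun t => ∑' n : ℕ, (1 / 2 : ℝ) ^ n * ρ (e n) t with hm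
  have hsum : ∀ t ∈ K, Summable fun n : ℕ => (1 / 2 : ℝ) ^ n * ρ (e n) t := fun t ht =>
    summable_geometric_two.of_nonneg_of_le (fun n => mul_nonneg (by positivity) (hρ0 _ t ht))
      fun n => mul_le_of_le_one_right (by positivity) (hρ1 _ t ht)
  have hmc : ContinuousOn m K := by
    refine continuousOn_tsum (fun n => continuousOn_const.mul (hρc _)) summable_geometric_two
      fun n t ht => ?_
    rw [Real.norm_of_nonneg (mul_nonneg (by positivity) (hρ0 _ t ht))]
    exact mul_le_of_le_one_right (by positivity) (hρ1 _ t ht)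
  have hmm : ∀ s ∈ K, ∀ t ∈ K, s ≤ t → m s ≤ m t := fun s hs t ht hst =>
    (hsum s hs).tsum_le_tsum (fun n => mul_le_mul_of_nonneg_left (hρm _ s hs t hst)
      (by positivity)) (hsum t ht)
  have hmg : ∀ s ∈ K, ∀ t ∈ K, s < t → γ s = γ t → m s = m t := fun s hs t ht hst hg => by
    simp only [hm, hρg _ s hs t ht hst hg]
  have hms : ∀ s ∈ K, ∀ t ∈ K, s < t → γ s ≠ γ t → m s < m t := by
    intro s hs t ht hst hg
    obtain ⟨r, ⟨hsr, hrt⟩, hr⟩ : (Ioo s t ∩ K).Nonempty := by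
      rw [nonempty_iff_ne_empty]
      exact fun h => hg ((H s hs t ht hst).2 h)
    obtain ⟨n, hn⟩ := he.exists_mem_open isOpen_Ioo (nonempty_Ioo.2 hsr)
    refine (hsum s hs).tsum_lt_tsum (i := n) (fun n => mul_le_mul_of_nonneg_left
      (hρm _ s hs t hst.le) (by positivity)) ?_ (hsum t ht)
    refine mul_lt_mul_of_pos_left ?_ (by positivity)
    have h0 : ρ (e n) s ≤ 0 := hρle _ s hs 0 fun k hk hks => by
      have : infDist (γ k) (γ '' (K ∩ Iic (e n))) = 0 :=
        infDist_zero_of_mem ⟨k, ⟨hk, hks.trans hn.1.le⟩, rfl⟩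
      simp only [hφ, this]
      exact min_le_right _ _
    refine h0.trans_lt (lt_of_lt_of_le ?_ (hφρ _ t ht t le_rfl))
    have hcl : IsClosed (γ '' (K ∩ Iic (e n))) :=
      ((hK.inter_right isClosed_Iic).image hγ).isClosed
    refine lt_min one_pos ((hcl.notMem_iff_infDist_pos ⟨_, s, ⟨hs, hn.1.le⟩, rfl⟩).1 ?_)
    rintro ⟨k, ⟨hk, hkn⟩, hkt⟩
    have hkn : k ≤ e n := hkn
    have hkr : k < r := hkn.trans_lt hn.2
    exact (eq_empty_iff_forall_notMem.1 ((H k hk t ht (hkr.trans hrt)).1 hkt)) r ⟨⟨hkr, hrt⟩, hr⟩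
  have hiff : ∀ s ∈ K, ∀ t ∈ K, m s = m t ↔ γ s = γ t := by
    intro s hs t ht
    rcases lt_trichotomy s t with h | rfl | h
    · refine ⟨fun h1 => ?_, hmg s hs t ht h⟩
      by_contra h2
      exact (hms s hs t ht h h2).ne h1
    · simp
    · refine ⟨fun h1 => ?_, fun h1 => (hmg t ht s hs h h1.symm).symm⟩
      by_contra h2
      exact (hms t ht s hs h (Ne.symm h2)).ne h1.symm
  have hsurj : ∀ y ∈ Icc (m a) (m b), ∃ k ∈ K, m k = y := by
    intro y hy
    have c1 : IsCompact (K ∩ m ⁻¹' Iic y) :=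
      hK.of_isClosed_subset (hmc.preimage_isClosed_of_isClosed hK.isClosed isClosed_Iic)
        inter_subset_left
    have c2 : IsCompact (K ∩ m ⁻¹' Ici y) :=
      hK.of_isClosed_subset (hmc.preimage_isClosed_of_isClosed hK.isClosed isClosed_Ici)
        inter_subset_left
    obtain ⟨s, ⟨hs, hsy⟩, hs2⟩ := c1.exists_isGreatest ⟨a, haK, hy.1⟩
    obtain ⟨t, ⟨ht, hty⟩, ht2⟩ := c2.exists_isLeast ⟨b, hbK, hy.2⟩
    have hsy : m s ≤ y := hsy
    have hty : y ≤ m t := hty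
    by_contra! hne
    have h1 := hsy.lt_of_ne (hne s hs)
    have hst : s < t := by
      by_contra! h
      linarith [hmm t ht s hs h]
    have : Ioo s t ∩ K = ∅ := by
      rw [eq_empty_iff_forall_notMem]
      rintro k ⟨hk, hkK⟩
      rcases le_total (m k) y with h | h
      · exact (hs2 ⟨hkK, h⟩).not_gt hk.1
      · exact (ht2 ⟨hkK, h⟩).not_gt hk.2
    linarith [(hiff s hs t ht).2 ((H s hs t ht hst).2 this)]
  have hmab : m a < m b := hms a haK b hbK
    ((hKI haK).2.lt_of_ne fun h => hab (by rw [h])) hab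
  have hKm : ∀ k ∈ K, m k ∈ Icc (m a) (m b) := fun k hk =>
    ⟨hmm a haK k hk (hKI hk).1, hmm k hk b hbK (hKI hk).2⟩
  choose! k hkK hk using hsurj
  have hkγ : ∀ s ∈ K, γ (k (m s)) = γ s := fun s hs =>
    (hiff _ (hkK _ (hKm s hs)) s hs).1 (hk _ (hKm s hs))
  have hc : ContinuousOn (γ ∘ k) (Icc (m a) (m b)) := by
    rw [continuousOn_iff_isClosed]
    intro Z hZ
    refine ⟨m '' (K ∩ γ ⁻¹' Z), ((hK.inter_right (hZ.preimage hγ)).image_of_continuousOn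
      (hmc.mono inter_subset_left)).isClosed, ?_⟩
    ext y
    constructor
    · rintro ⟨h1, h2⟩
      exact ⟨⟨k y, ⟨hkK y h2, h1⟩, hk y h2⟩, h2⟩
    · rintro ⟨⟨s, ⟨hs, hsZ⟩, rfl⟩, h2⟩
      refine ⟨?_, h2⟩
      show γ (k (m s)) ∈ Z
      rw [hkγ s hs]
      exact hsZ
  have hi : InjOn (γ ∘ k) (Icc (m a) (m b)) := fun y hy z hz hyz => by
    rw [← hk y hy, ← hk z hz]
    exact (hiff _ (hkK y hy) _ (hkK z hz)).2 hyz
  have := isArc_of_injOn hmab hc hi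
  have himg : (γ ∘ k) '' Icc (m a) (m b) = γ '' K := by
    apply Subset.antisymm
    · rintro _ ⟨y, hy, rfl⟩
      exact ⟨_, hkK y hy, rfl⟩
    · rintro _ ⟨s, hs, rfl⟩
      exact ⟨m s, hKm s hs, hkγ s hs⟩
  rw [himg, Function.comp, Function.comp, hkγ a haK, hkγ b hbK] at this
  exact this

/-- A minimal compact set of parameters all of whose gaps have identified end points. -/
theorem exists_minimal_gaps (hγ : Continuous γ) (hab : a ≤ b) : ∃ K : Set ℝ, IsCompact K ∧
    a ∈ K ∧ b ∈ K ∧ K ⊆ Icc a b ∧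
    ∀ s ∈ K, ∀ t ∈ K, s < t → (γ s = γ t ↔ Ioo s t ∩ K = ∅) := by
  set P : Set (Set ℝ) := {K | IsClosed K ∧ a ∈ K ∧ b ∈ K ∧ K ⊆ Icc a b ∧
    ∀ s ∈ K, ∀ t ∈ K, s < t → Ioo s t ∩ K = ∅ → γ s = γ t} with hP
  obtain ⟨K, hK⟩ := zorn_superset P fun c hcP hc => by
    rcases c.eq_empty_or_nonempty with rfl | hne
    · refine ⟨Icc a b, ⟨isClosed_Icc, ⟨le_rfl, hab⟩, ⟨hab, le_rfl⟩, Subset.rfl,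
        fun s hs t ht hst h => ?_⟩, by simp⟩
      exact ((eq_empty_iff_forall_notMem.1 h) ((s + t) / 2) ⟨⟨by linarith, by linarith⟩,
        by linarith [hs.1], by linarith [ht.2]⟩).elim
    · refine ⟨⋂₀ c, ⟨isClosed_sInter fun K hK => (hcP hK).1, fun K hK => (hcP hK).2.1,
        fun K hK => (hcP hK).2.2.1, ?_, fun s hs t ht hst hgap => ?_⟩,
        fun K hK => sInter_subset_of_mem hK⟩
      · obtain ⟨K, hK⟩ := hne
        exact (sInter_subset_of_mem hK).trans (hcP hK).2.2.2.1
      · refine eq_of_forall_dist_le fun ε hε => ?_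
        obtain ⟨δ₁, hδ₁, h1⟩ := Metric.continuous_iff.1 hγ s (ε / 2) (by positivity)
        obtain ⟨δ₂, hδ₂, h2⟩ := Metric.continuous_iff.1 hγ t (ε / 2) (by positivity)
        set δ := min (min δ₁ δ₂) ((t - s) / 2) with hδ
        have hδ0 : 0 < δ := lt_min (lt_min hδ₁ hδ₂) (by linarith)
        have hδt : δ ≤ (t - s) / 2 := min_le_right _ _
        have hd1 : δ ≤ δ₁ := (min_le_left _ _).trans (min_le_left _ _)
        have hd2 : δ ≤ δ₂ := (min_le_left _ _).trans (min_le_right _ _)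
        have : Nonempty c := hne.to_subtype
        obtain ⟨⟨K, hKc⟩, hKe⟩ := (isCompact_Icc (a := s + δ) (b := t - δ)).elim_directed_family_closed
          (fun K : c => (K : Set ℝ)) (fun K => (hcP K.2).1) (by
            rw [eq_empty_iff_forall_notMem] at hgap ⊢
            rintro x ⟨hx, hxc⟩
            exact hgap x ⟨⟨by linarith [hx.1], by linarith [hx.2]⟩, fun K hK =>
              mem_iInter.1 hxc ⟨K, hK⟩⟩) (by
            rintro ⟨A, hA⟩ ⟨B, hB⟩
            rcases hc.total hA hB with h | h
            · exact ⟨⟨A, hA⟩, Subset.rfl, h⟩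
            · exact ⟨⟨B, hB⟩, h, Subset.rfl⟩)
        have hKe : ∀ x ∈ K, x < s + δ ∨ t - δ < x := fun x hx => by
          by_contra! h
          exact (eq_empty_iff_forall_notMem.1 hKe) x ⟨h, hx⟩
        obtain ⟨hKcl, -, -, -, hKg⟩ := hcP hKc
        obtain ⟨s', ⟨⟨hs1, hs2⟩, hsK⟩, hs3⟩ := ((isCompact_Icc (a := s) (b := (s + t) / 2)).inter_right
          hKcl).exists_isGreatest ⟨s, ⟨le_rfl, by linarith⟩, hs K hKc⟩
        obtain ⟨t', ⟨⟨ht1, ht2⟩, htK⟩, ht3⟩ := ((isCompact_Icc (a := (s + t) / 2) (b := t)).inter_right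
          hKcl).exists_isLeast ⟨t, ⟨by linarith, le_rfl⟩, ht K hKc⟩
        have e1 : s' < s + δ := (hKe s' hsK).resolve_right (by linarith)
        have e2 : t - δ < t' := (hKe t' htK).resolve_left (by linarith)
        have e3 := hKg s' hsK t' htK (by linarith) (by
          rw [eq_empty_iff_forall_notMem]
          rintro x ⟨hx, hxK⟩
          rcases le_total x ((s + t) / 2) with h | h
          · exact (hs3 ⟨⟨by linarith [hx.1], h⟩, hxK⟩).not_gt hx.1
          · exact (ht3 ⟨⟨h, by linarith [hx.2]⟩, hxK⟩).not_gt hx.2)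
        have d1 := h1 s' (by rw [Real.dist_eq, abs_lt]; constructor <;> linarith)
        have d2 := h2 t' (by rw [Real.dist_eq, abs_lt]; constructor <;> linarith)
        rw [← e3] at d2
        rw [dist_comm] at d1
        exact (dist_triangle _ (γ s') _).trans (by linarith)
  obtain ⟨hKc, haK, hbK, hKI, hKg⟩ := hK.prop
  refine ⟨K, isCompact_Icc.of_isClosed_subset hKc hKI, haK, hbK, hKI,
    fun s hs t ht hst => ⟨fun h => ?_, hKg s hs t ht hst⟩⟩
  have h1 : K \ Ioo s t ∈ P := by
    refine ⟨hKc.sdiff isOpen_Ioo, ⟨haK, fun h => ?_⟩, ⟨hbK, fun h => ?_⟩,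
      sdiff_subset.trans hKI, fun x hx y hy hxy hg => ?_⟩
    · exact (hKI hs).1.not_gt h.1
    · exact (hKI ht).2.not_gt h.2
    · rw [eq_empty_iff_forall_notMem] at hg
      have hs' := hg s
      have ht' := hg t
      have key : Ioo x y ∩ Ioo s t = ∅ → γ x = γ y := fun h => by
        refine hKg x hx.1 y hy.1 hxy ?_
        rw [eq_empty_iff_forall_notMem] at h ⊢
        exact fun z hz => hg z ⟨hz.1, hz.2, fun h' => h z ⟨hz.1, h'⟩⟩
      by_cases h2 : x < s
      · have : y ≤ s := by
          by_contra! h3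
          exact hs' ⟨⟨h2, h3⟩, hs, fun h => h.1.false⟩
        refine key (eq_empty_iff_forall_notMem.2 fun z hz => ?_)
        linarith [hz.1.2, hz.2.1]
      by_cases h3 : t ≤ x
      · refine key (eq_empty_iff_forall_notMem.2 fun z hz => ?_)
        linarith [hz.1.1, hz.2.2]
      push Not at h2 h3
      have hxs : x = s := by
        by_contra h4
        exact hx.2 ⟨h2.lt_of_ne (Ne.symm h4), h3⟩
      subst hxs
      have hyt : y = t := by
        rcases lt_trichotomy y t with h4 | h4 | h4
        · exact (hy.2 ⟨hxy, h4⟩).elim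
        · exact h4
        · exact (ht' ⟨⟨h3, h4⟩, ht, fun h => h.2.false⟩).elim
      rw [hyt, h]
  have h2 := hK.le_of_le h1 sdiff_subset
  rw [eq_empty_iff_forall_notMem]
  exact fun x hx => (h2 hx.2).2 hx.1

/-- Distinct points joined by a path are joined by an arc. -/
theorem JoinedIn.exists_isArc {F : Set X} {u v : X} (h : JoinedIn F u v) (huv : u ≠ v) :
    ∃ A, IsArc A u v ∧ A ⊆ F := by
  obtain ⟨γ, hγ⟩ := h
  obtain ⟨K, h1, h2, h3, h4, h5⟩ := exists_minimal_gaps γ.continuous_extend zero_le_one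
  have := isArc_image_of_gaps γ.continuous_extend h1 h2 h3 h4 (by simpa using huv) h5
  rw [Path.extend_zero, Path.extend_one] at this
  refine ⟨_, this, ?_⟩
  rintro _ ⟨t, ht, rfl⟩
  rw [Path.extend_apply _ (h4 ht)]
  exact hγ _

end PathArc

/-- Distinct boundary points of a face are joined by a crosscut. -/
theorem Face.exists_crosscut {S : Type*} [MetricSpace S] [Surf S] [CompactSpace S]
    [ConnectedSpace S] [CocTriv S] {f : ℝ → S} {F : Set S} {u v : S} (hf : IsLoop f)
    (hF : Face (range f) F) (hu : u ∈ range f) (hv : v ∈ range f) (huv : u ≠ v) :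
    ∃ A, IsArc A u v ∧ A \ {u, v} ⊆ F := by
  obtain ⟨A, h1, h2⟩ := (hF.joinedIn_pair hf hu hv).exists_isArc huv
  exact ⟨A, h1, fun x hx => (h2 hx.1).resolve_right hx.2⟩

section Ulc

variable {X Y : Type*} [MetricSpace X] [MetricSpace Y]

/-- Uniform local connectedness. -/
def Ulc (K : Set X) : Prop :=
  ∀ ε > 0, ∃ δ > 0, ∀ u ∈ K, ∀ v ∈ K, dist u v < δ →
    ∃ T ⊆ K, IsPreconnected T ∧ u ∈ T ∧ v ∈ T ∧ ∀ x ∈ T, dist x u < ε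

theorem exists_dist_lt_of_injOn {K : Set X} (hK : IsCompact K) {f : X → Y} (hf : ContinuousOn f K)
    (hi : InjOn f K) {ε : ℝ} (hε : 0 < ε) :
    ∃ δ > 0, ∀ u ∈ K, ∀ v ∈ K, dist (f u) (f v) < δ → dist u v < ε := by
  have hZ : IsCompact ((K ×ˢ K) ∩ {p : X × X | ε ≤ dist p.1 p.2}) :=
    (hK.prod hK).inter_right (isClosed_le continuous_const continuous_dist)
  rcases eq_empty_or_nonempty ((K ×ˢ K) ∩ {p : X × X | ε ≤ dist p.1 p.2}) with h | h
  · refine ⟨1, one_pos, fun u hu v hv _ => ?_⟩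
    by_contra! h'
    exact (eq_empty_iff_forall_notMem.1 h) (u, v) ⟨⟨hu, hv⟩, h'⟩
  · have hc : ContinuousOn (fun p : X × X => dist (f p.1) (f p.2))
        ((K ×ˢ K) ∩ {p : X × X | ε ≤ dist p.1 p.2}) :=
      continuous_dist.comp_continuousOn ((hf.comp continuousOn_fst fun p hp => hp.1.1).prodMk
        (hf.comp continuousOn_snd fun p hp => hp.1.2))
    obtain ⟨p, hp, hmin⟩ := hZ.exists_isMinOn h hc
    refine ⟨dist (f p.1) (f p.2), dist_pos.2 fun h' => ?_, fun u hu v hv huv => ?_⟩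
    · have h1 : ε ≤ dist p.1 p.2 := hp.2
      rw [hi hp.1.1 hp.1.2 h', dist_self] at h1
      linarith
    · by_contra! h'
      exact (isMinOn_iff.1 hmin (u, v) ⟨⟨hu, hv⟩, h'⟩).not_gt huv

theorem Ulc.image {K : Set X} (h : Ulc K) (hK : IsCompact K) {f : X → Y} (hf : ContinuousOn f K)
    (hi : InjOn f K) : Ulc (f '' K) := by
  intro ε hε
  have hu := hK.uniformContinuousOn_of_continuous hf
  rw [Metric.uniformContinuousOn_iff] at hu
  obtain ⟨η, hη, h1⟩ := hu ε hε
  obtain ⟨δ, hδ, h2⟩ := h η hη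
  obtain ⟨κ, hκ, h3⟩ := exists_dist_lt_of_injOn hK hf hi hδ
  refine ⟨κ, hκ, ?_⟩
  rintro _ ⟨u, hu, rfl⟩ _ ⟨v, hv, rfl⟩ huv
  obtain ⟨T, t1, t2, t3, t4, t5⟩ := h2 u hu v hv (h3 u hu v hv huv)
  refine ⟨f '' T, image_mono t1, t2.image _ (hf.mono t1), ⟨u, t3, rfl⟩, ⟨v, t4, rfl⟩, ?_⟩
  rintro _ ⟨x, hx, rfl⟩
  exact h1 x (t1 hx) u hu (t5 x hx)

theorem Ulc.union {A B : Set X} (hA : Ulc A) (hB : Ulc B) (hAc : IsCompact A) (hBc : IsCompact B) :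
    Ulc (A ∪ B) := by
  have key : ∀ η > 0, ∃ δ > 0, ∀ u ∈ A, ∀ v ∈ B, dist u v < δ →
      ∃ q ∈ A ∩ B, dist u q < η ∧ dist v q < η := by
    intro η hη
    set Z := (A ×ˢ B) ∩ ⋂ q ∈ A ∩ B, {p : X × X | η ≤ dist p.1 q ∨ η ≤ dist p.2 q} with hZ
    have hZc : IsCompact Z := (hAc.prod hBc).inter_right <| isClosed_biInter fun q _ =>
      (isClosed_le continuous_const (continuous_fst.dist continuous_const)).union
        (isClosed_le continuous_const (continuous_snd.dist continuous_const))
    have hmem : ∀ u ∈ A, ∀ v ∈ B, (u, v) ∉ Z → ∃ q ∈ A ∩ B, dist u q < η ∧ dist v q < η := by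
      intro u hu v hv h
      by_contra! hne
      refine h ⟨⟨hu, hv⟩, mem_iInter₂.2 fun q hq => ?_⟩
      rcases lt_or_ge (dist u q) η with h1 | h1
      exacts [Or.inr (hne q hq h1), Or.inl h1]
    rcases Z.eq_empty_or_nonempty with h | h
    · exact ⟨1, one_pos, fun u hu v hv _ => hmem u hu v hv (h ▸ notMem_empty _)⟩
    · obtain ⟨p, hp, hmin⟩ := hZc.exists_isMinOn h continuous_dist.continuousOn
      refine ⟨dist p.1 p.2, dist_pos.2 fun h' => ?_, fun u hu v hv huv => hmem u hu v hv fun h =>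
        (isMinOn_iff.1 hmin (u, v) h).not_gt huv⟩
      have := mem_iInter₂.1 hp.2 p.1 ⟨hp.1.1, h' ▸ hp.1.2⟩
      rcases this with h1 | h1
      · exact hη.not_ge (by simpa using h1)
      · exact hη.not_ge (by simpa [h'] using h1)
  intro ε hε
  obtain ⟨δ₁, hδ₁, h1⟩ := hA (ε / 4) (by positivity)
  obtain ⟨δ₂, hδ₂, h2⟩ := hB (ε / 4) (by positivity)
  obtain ⟨δ₃, hδ₃, h3⟩ := key (min (min δ₁ δ₂) (ε / 4)) (by positivity)
  have mixed : ∀ u ∈ A, ∀ v ∈ B, dist u v < δ₃ → ∃ T ⊆ A ∪ B, IsPreconnected T ∧ u ∈ T ∧ v ∈ T ∧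
      ∀ x ∈ T, dist x u < ε ∧ dist x v < ε := by
    intro u hu v hv huv
    obtain ⟨q, hq, hq1, hq2⟩ := h3 u hu v hv huv
    rw [lt_min_iff, lt_min_iff] at hq1 hq2
    obtain ⟨T, t1, t2, t3, t4, t5⟩ := h1 u hu q hq.1 hq1.1.1
    obtain ⟨T', s1, s2, s3, s4, s5⟩ := h2 v hv q hq.2 hq2.1.2
    refine ⟨T ∪ T', union_subset_union t1 s1, t2.union q t4 s4 s2, Or.inl t3, Or.inr s3, ?_⟩
    have huv : dist u v < ε / 2 := (dist_triangle_right u v q).trans_lt (by linarith)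
    rintro x (hx | hx)
    · exact ⟨by linarith [t5 x hx], (dist_triangle x u v).trans_lt (by linarith [t5 x hx])⟩
    · refine ⟨(dist_triangle x v u).trans_lt ?_, by linarith [s5 x hx]⟩
      rw [dist_comm v u]
      linarith [s5 x hx]
  refine ⟨min (min δ₁ δ₂) δ₃, by positivity, ?_⟩
  rintro u (hu | hu) v (hv | hv) huv <;> rw [lt_min_iff, lt_min_iff] at huv
  · obtain ⟨T, t1, t2, t3, t4, t5⟩ := h1 u hu v hv huv.1.1
    exact ⟨T, t1.trans subset_union_left, t2, t3, t4, fun x hx => by linarith [t5 x hx]⟩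
  · obtain ⟨T, t1, t2, t3, t4, t5⟩ := mixed u hu v hv huv.2
    exact ⟨T, t1, t2, t3, t4, fun x hx => (t5 x hx).1⟩
  · obtain ⟨T, t1, t2, t3, t4, t5⟩ := mixed v hv u hu (by rw [dist_comm]; exact huv.2)
    exact ⟨T, t1, t2, t4, t3, fun x hx => (t5 x hx).2⟩
  · obtain ⟨T, t1, t2, t3, t4, t5⟩ := h2 u hu v hv huv.1.2
    exact ⟨T, t1.trans subset_union_right, t2, t3, t4, fun x hx => by linarith [t5 x hx]⟩

theorem ulc_Icc (a b : ℝ) : Ulc (Icc a b) := by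
  intro ε hε
  refine ⟨ε, hε, fun u hu v hv huv => ⟨uIcc u v, ordConnected_Icc.uIcc_subset hu hv,
    isPreconnected_uIcc, left_mem_uIcc, right_mem_uIcc, fun x hx => ?_⟩⟩
  rw [Real.dist_eq] at huv ⊢
  exact (abs_sub_left_of_mem_uIcc hx).trans_lt (by rwa [abs_sub_comm])

theorem IsArc.ulc {A : Set X} {u v : X} (h : IsArc A u v) : Ulc A := by
  obtain ⟨γ, h1, rfl⟩ := h
  rw [← γ.extend_range]
  have : range γ.extend = γ.extend '' Icc 0 1 := by
    rw [Path.extend_range]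
    ext x
    constructor
    · rintro ⟨t, rfl⟩
      exact ⟨t, t.2, γ.extend_extends' t⟩
    · rintro ⟨t, ht, rfl⟩
      exact ⟨⟨t, ht⟩, (γ.extend_apply ht).symm⟩
  rw [this]
  refine (ulc_Icc 0 1).image isCompact_Icc γ.continuous_extend.continuousOn fun s hs t ht hst => ?_
  rw [γ.extend_apply hs, γ.extend_apply ht] at hst
  exact congrArg Subtype.val (h1 hst)

theorem IsArc.mem_closure {A : Set X} {u v : X} (h : IsArc A u v) : u ∈ closure (A \ {u, v}) := by
  by_contra hu
  have := isPreconnected_iff_subset_of_disjoint_closed.1 h.isPreconnected {u}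
    (closure (A \ {u, v}) ∪ {v}) isClosed_singleton (isClosed_closure.union isClosed_singleton)
    (fun x hx => by
      by_cases h1 : x = u
      · exact Or.inl h1
      by_cases h2 : x = v
      · exact Or.inr (Or.inr h2)
      · exact Or.inr (Or.inl (subset_closure ⟨hx, by simp [h1, h2]⟩)))
    (by
      rw [eq_empty_iff_forall_notMem]
      rintro x ⟨-, rfl, h1 | h1⟩
      exacts [hu h1, h.ne h1])
  rcases this with h1 | h1
  · exact h.ne (h1 h.right_mem).symm
  · exact (h1 h.left_mem).elim hu h.ne

end Ulc

section State

variable {S S' : Type*} [MetricSpace S] [MetricSpace S']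

/-- A pair of matching finite cell decompositions of `S` and `S'`, with the correspondence of the
one-dimensional skeletons given by its graph `G`. -/
structure State (G : Set (S × S')) (C : Set (Set S × Set S')) : Prop where
  compact : IsCompact G
  inj₁ : InjOn Prod.fst G
  inj₂ : InjOn Prod.snd G
  fin : C.Finite
  loop : ∀ P ∈ C, ∃ f : ℝ → S × S', IsLoop f ∧ range f ⊆ G ∧
    Face (range (Prod.fst ∘ f)) P.1 ∧ Face (range (Prod.snd ∘ f)) P.2
  cover : ∀ z ∈ G, ∃ P ∈ C, z.1 ∈ frontier P.1 ∧ z.2 ∈ frontier P.2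
  disj₁ : ∀ P ∈ C, ∀ Q ∈ C, P ≠ Q → Disjoint P.1 Q.1
  disj₂ : ∀ P ∈ C, ∀ Q ∈ C, P ≠ Q → Disjoint P.2 Q.2
  union₁ : ∀ x, x ∉ Prod.fst '' G ↔ ∃ P ∈ C, x ∈ P.1
  union₂ : ∀ x, x ∉ Prod.snd '' G ↔ ∃ P ∈ C, x ∈ P.2
  ulc : Ulc G
  conn : IsPreconnected G
  noCut : ∀ w ∈ G, IsPreconnected (G \ {w})

/-- Each cell pair of `C'` is contained in one of `C`. -/
def Refines (C' C : Set (Set S × Set S')) : Prop :=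
  ∀ Q ∈ C', ∃ P ∈ C, Q.1 ⊆ P.1 ∧ Q.2 ⊆ P.2

theorem Refines.rfl {C : Set (Set S × Set S')} : Refines C C := fun Q hQ =>
  ⟨Q, hQ, Subset.rfl, Subset.rfl⟩

theorem Refines.trans {C C' C'' : Set (Set S × Set S')} (h : Refines C'' C') (h' : Refines C' C) :
    Refines C'' C := fun Q hQ => by
  obtain ⟨P, hP, h1, h2⟩ := h Q hQ
  obtain ⟨R, hR, h3, h4⟩ := h' P hP
  exact ⟨R, hR, h1.trans h3, h2.trans h4⟩

theorem State.swap {G : Set (S × S')} {C : Set (Set S × Set S')} (h : State G C) :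
    State (Prod.swap '' G) (Prod.swap '' C) where
  compact := h.compact.image continuous_swap
  inj₁ := by
    rintro _ ⟨x, hx, rfl⟩ _ ⟨y, hy, rfl⟩ hxy
    rw [h.inj₂ hx hy hxy]
  inj₂ := by
    rintro _ ⟨x, hx, rfl⟩ _ ⟨y, hy, rfl⟩ hxy
    rw [h.inj₁ hx hy hxy]
  fin := h.fin.image _
  loop := by
    rintro _ ⟨P, hP, rfl⟩
    obtain ⟨f, h1, h2, h3, h4⟩ := h.loop P hP
    refine ⟨Prod.swap ∘ f, h1.image continuous_swap.continuousOn Prod.swap_injective.injOn, ?_,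
      h4, h3⟩
    rw [range_comp]
    exact image_mono h2
  cover := by
    rintro _ ⟨z, hz, rfl⟩
    obtain ⟨P, hP, h1, h2⟩ := h.cover z hz
    exact ⟨_, ⟨P, hP, rfl⟩, h2, h1⟩
  disj₁ := by
    rintro _ ⟨P, hP, rfl⟩ _ ⟨Q, hQ, rfl⟩ hPQ
    exact h.disj₂ P hP Q hQ fun h => hPQ (h ▸ rfl)
  disj₂ := by
    rintro _ ⟨P, hP, rfl⟩ _ ⟨Q, hQ, rfl⟩ hPQ
    exact h.disj₁ P hP Q hQ fun h => hPQ (h ▸ rfl)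
  union₁ x := by
    rw [image_image]
    exact (h.union₂ x).trans (by aesop)
  union₂ x := by
    rw [image_image]
    exact (h.union₁ x).trans (by aesop)
  ulc := h.ulc.image h.compact continuous_swap.continuousOn Prod.swap_injective.injOn
  conn := h.conn.image _ continuous_swap.continuousOn
  noCut := by
    rintro _ ⟨w, hw, rfl⟩
    rw [← image_singleton, ← image_sdiff Prod.swap_injective]
    exact (h.noCut w hw).image _ continuous_swap.continuousOn

theorem Refines.swap {C C' : Set (Set S × Set S')} (h : Refines C' C) :
    Refines (Prod.swap '' C') (Prod.swap '' C) := by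
  rintro _ ⟨Q, hQ, rfl⟩
  obtain ⟨P, hP, h1, h2⟩ := h Q hQ
  exact ⟨_, ⟨P, hP, _root_.rfl⟩, h2, h1⟩

section Step

variable {X ι : Type*} {Γ A : Set X} {C : Set ι} {φ : ι → Set X} {P a b : ι} {u v : X}

theorem union_step (hP : P ∈ C) (h : ∀ x, x ∉ Γ ↔ ∃ Q ∈ C, x ∈ φ Q)
    (hd : ∀ Q ∈ C, ∀ R ∈ C, Q ≠ R → Disjoint (φ Q) (φ R)) (hu : u ∈ Γ) (hv : v ∈ Γ)
    (hA : A \ {u, v} ⊆ φ P) (hab : φ a ∪ φ b = φ P \ A) (x : X) :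
    x ∉ Γ ∪ A ↔ ∃ Q ∈ C \ {P} ∪ {a, b}, x ∈ φ Q := by
  constructor
  · intro hx
    obtain ⟨Q, hQ, hxQ⟩ := (h x).1 fun h => hx (Or.inl h)
    by_cases hQP : Q = P
    · subst hQP
      rcases (hab ▸ ⟨hxQ, fun h => hx (Or.inr h)⟩ : x ∈ φ a ∪ φ b) with h | h
      · exact ⟨a, Or.inr (Or.inl rfl), h⟩
      · exact ⟨b, Or.inr (Or.inr rfl), h⟩
    · exact ⟨Q, Or.inl ⟨hQ, hQP⟩, hxQ⟩
  · have key : x ∈ φ a ∪ φ b → x ∉ Γ ∪ A := fun hx => by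
      rw [hab] at hx
      exact fun h' => h'.elim ((h x).2 ⟨P, hP, hx.1⟩) hx.2
    rintro ⟨Q, ⟨hQ, hQP⟩ | rfl | rfl, hxQ⟩
    · have hxΓ := (h x).2 ⟨Q, hQ, hxQ⟩
      rintro (h' | h')
      · exact hxΓ h'
      · by_cases hx : x ∈ ({u, v} : Set X)
        · rcases hx with rfl | rfl
          exacts [hxΓ hu, hxΓ hv]
        · exact disjoint_left.1 (hd Q hQ P hP hQP) hxQ (hA ⟨h', hx⟩)
    · exact key (Or.inl hxQ)
    · exact key (Or.inr hxQ)

theorem disj_step (hP : P ∈ C) (hd : ∀ Q ∈ C, ∀ R ∈ C, Q ≠ R → Disjoint (φ Q) (φ R))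
    (hab : φ a ∪ φ b = φ P \ A) (hdab : Disjoint (φ a) (φ b)) :
    ∀ Q ∈ C \ {P} ∪ {a, b}, ∀ R ∈ C \ {P} ∪ {a, b}, Q ≠ R → Disjoint (φ Q) (φ R) := by
  have ha : φ a ⊆ φ P := subset_union_left.trans (hab.subset.trans sdiff_subset)
  have hb : φ b ⊆ φ P := subset_union_right.trans (hab.subset.trans sdiff_subset)
  rintro Q (hQ | rfl | rfl) R (hR | rfl | rfl) hQR
  · exact hd Q hQ.1 R hR.1 hQR
  · exact (hd Q hQ.1 P hP hQ.2).mono_right ha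
  · exact (hd Q hQ.1 P hP hQ.2).mono_right hb
  · exact ((hd R hR.1 P hP hR.2).mono_right ha).symm
  · exact (hQR rfl).elim
  · exact hdab
  · exact ((hd R hR.1 P hP hR.2).mono_right hb).symm
  · exact hdab.symm
  · exact (hQR rfl).elim

end Step

theorem noCut_union_arc {X : Type*} [TopologicalSpace X] {G T : Set X} {z w : X}
    (hG : ∀ q ∈ G, IsPreconnected (G \ {q})) (hG' : IsPreconnected G) (hT : IsArc T z w)
    (hz : z ∈ G) (hw : w ∈ G) (q : X) : IsPreconnected ((G ∪ T) \ {q}) := by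
  have hGq : IsPreconnected (G \ {q}) := by
    by_cases hq : q ∈ G
    · exact hG q hq
    · rwa [sdiff_singleton_eq_self hq]
  have hne := hT.ne
  obtain ⟨γ, h1, rfl⟩ := hT
  have key : ∀ t, γ t ≠ q → ∃ B, B ⊆ (G ∪ range γ) \ {q} ∧ γ t ∈ B ∧ IsPreconnected B ∧
      (B ∩ (G \ {q})).Nonempty := by
    intro t ht
    by_cases hq : ∃ s, γ s = q ∧ s ≤ t
    · obtain ⟨s, rfl, hst⟩ := hq
      have hlt : s < t := hst.lt_of_ne fun h => ht (h ▸ rfl)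
      have h1w : w ∈ γ '' Icc t 1 := ⟨1, ⟨t.2.2, le_rfl⟩, γ.target⟩
      have hsub : γ '' Icc t 1 ⊆ (G ∪ range γ) \ {γ s} := by
        rintro _ ⟨r, hr, rfl⟩
        exact ⟨Or.inr (mem_range_self _), fun h => (hlt.trans_le hr.1).ne (h1 h).symm⟩
      exact ⟨_, hsub, ⟨t, ⟨le_rfl, t.2.2⟩, rfl⟩,
        isPreconnected_Icc.image _ γ.continuous.continuousOn, w, h1w, hw, (hsub h1w).2⟩
    · have h0z : z ∈ γ '' Icc 0 t := ⟨0, ⟨le_rfl, t.2.1⟩, γ.source⟩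
      have hsub : γ '' Icc 0 t ⊆ (G ∪ range γ) \ {q} := by
        rintro _ ⟨r, hr, rfl⟩
        exact ⟨Or.inr (mem_range_self _), fun h => hq ⟨r, h, hr.2⟩⟩
      exact ⟨_, hsub, ⟨t, ⟨t.2.1, le_rfl⟩, rfl⟩,
        isPreconnected_Icc.image _ γ.continuous.continuousOn, z, h0z, hz, (hsub h0z).2⟩
  obtain ⟨b, hb⟩ : ∃ b, b ∈ G \ {q} := by
    by_cases h : z = q
    · exact ⟨w, hw, fun h' => hne (h.trans (mem_singleton_iff.1 h').symm)⟩
    · exact ⟨z, hz, h⟩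
  refine isPreconnected_of_forall b fun y hy => ?_
  rcases hy with ⟨hy | ⟨t, rfl⟩, hyq⟩
  · exact ⟨G \ {q}, sdiff_subset_sdiff_left subset_union_left, hb, ⟨hy, hyq⟩, hGq⟩
  · obtain ⟨B, b1, b2, b3, c, b4, b5⟩ := key t hyq
    exact ⟨B ∪ G \ {q}, union_subset b1 (sdiff_subset_sdiff_left subset_union_left), Or.inr hb,
      Or.inl b2, b3.union c b4 b5 hGq⟩

theorem InjOn.union_of_ends {X Y : Type*} {G T : Set X} {g : X → Y} {z w : X} (hG : InjOn g G)
    (hT : InjOn g T) (hz : z ∈ G ∩ T) (hw : w ∈ G ∩ T)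
    (h : ∀ y ∈ T, g y ∈ g '' G → g y = g z ∨ g y = g w) : InjOn g (G ∪ T) := by
  have key : ∀ x ∈ G, ∀ y ∈ T, g x = g y → x = y := fun x hx y hy hxy => by
    rcases h y hy ⟨x, hx, hxy⟩ with e | e
    · rw [hT hy hz.2 e]
      exact hG hx hz.1 (hxy.trans e)
    · rw [hT hy hw.2 e]
      exact hG hx hw.1 (hxy.trans e)
  rintro x (hx | hx) y (hy | hy) hxy
  exacts [hG hx hy hxy, key x hx y hy hxy, (key y hy x hx hxy.symm).symm, hT hx hy hxy]

variable [Surf S] [CompactSpace S] [ConnectedSpace S] [CocTriv S]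
  [Surf S'] [CompactSpace S'] [ConnectedSpace S'] [CocTriv S']
  {G : Set (S × S')} {C : Set (Set S × Set S')} {P : Set S × Set S'} {z w : S × S'} {A : Set S}

/-- Subdividing one cell pair by a pair of crosscuts. -/
theorem State.crosscut (h : State G C) (hP : P ∈ C) (hz : z ∈ G) (hw : w ∈ G)
    (hA : IsArc A z.1 w.1) (hAP : A \ {z.1, w.1} ⊆ P.1) :
    ∃ G' C', State G' C' ∧ G ⊆ G' ∧ Prod.fst '' G' = Prod.fst '' G ∪ A ∧ Refines C' C := by
  classical
  obtain ⟨f, hf, hfG, hf1, hf2⟩ := h.loop P hP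
  have hfr : ∀ y ∈ G, y.1 ∈ closure P.1 → y ∈ range f := fun y hy hyc => by
    rw [hf1.closure_eq] at hyc
    rcases hyc with h' | ⟨t, ht⟩
    · exact ((h.union₁ y.1).2 ⟨P, hP, h'⟩ ⟨y, hy, rfl⟩).elim
    · exact ⟨t, h.inj₁ (hfG (mem_range_self t)) hy ht⟩
  have hzf := hfr z hz (closure_mono hAP hA.mem_closure)
  have hwf := hfr w hw (closure_mono hAP (by
    have := hA.symm.mem_closure
    rwa [pair_comm] at this))
  have hzw : z ≠ w := fun e => hA.ne (e ▸ rfl)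
  have i1 := h.inj₁.mono hfG
  have i2 := h.inj₂.mono hfG
  have hl1 : IsLoop (Prod.fst ∘ f) := hf.image continuous_fst.continuousOn i1
  have hl2 : IsLoop (Prod.snd ∘ f) := hf.image continuous_snd.continuousOn i2
  obtain ⟨A₀, B₀, hA₀, hB₀, hU, hI⟩ := hf.split hzf hwf hzw
  have hA₀f : A₀ ⊆ range f := hU ▸ subset_union_left
  have hB₀f : B₀ ⊆ range f := hU ▸ subset_union_right
  obtain ⟨A', hA', hAP'⟩ := Face.exists_crosscut (u := z.2) (v := w.2) hl2 hf2
    (range_comp Prod.snd f ▸ ⟨z, hzf, rfl⟩) (range_comp Prod.snd f ▸ ⟨w, hwf, rfl⟩)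
    fun e => hzw (h.inj₂ hz hw e)
  obtain ⟨F₁, F₂, a1, a2, a3, a4⟩ := theta hl1 hf1
    (hA₀.image continuous_fst.continuousOn (i1.mono hA₀f))
    (hB₀.image continuous_fst.continuousOn (i1.mono hB₀f))
    (by rw [← image_union, hU, range_comp])
    (by rw [← i1.image_inter hA₀f hB₀f, hI, image_pair]) hA hAP
  obtain ⟨F₁', F₂', b1, b2, b3, b4⟩ := theta hl2 hf2
    (hA₀.image continuous_snd.continuousOn (i2.mono hA₀f))
    (hB₀.image continuous_snd.continuousOn (i2.mono hB₀f))
    (by rw [← image_union, hU, range_comp])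
    (by rw [← i2.image_inter hA₀f hB₀f, hI, image_pair]) hA' hAP'
  obtain ⟨T, hT, hT1, hT2, t1, t2⟩ : ∃ T : Set (S × S'), IsArc T z w ∧ Prod.fst '' T = A ∧
      Prod.snd '' T = A' ∧ InjOn Prod.fst T ∧ InjOn Prod.snd T := by
    obtain ⟨γ, g1, rfl⟩ := hA
    obtain ⟨γ', g2, rfl⟩ := hA'
    refine ⟨range (γ.prod γ'), ⟨γ.prod γ', fun s t hst => g1 (congrArg Prod.fst hst), rfl⟩,
      ?_, ?_, ?_, ?_⟩
    · rw [← range_comp]; rfl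
    · rw [← range_comp]; rfl
    · rintro _ ⟨s, rfl⟩ _ ⟨t, rfl⟩ hst
      rw [g1 hst]
    · rintro _ ⟨s, rfl⟩ _ ⟨t, rfl⟩ hst
      rw [g2 hst]
  have hz' : z ∈ G ∩ T := ⟨hz, hT.left_mem⟩
  have hw' : w ∈ G ∩ T := ⟨hw, hT.right_mem⟩
  have e1 : ∀ y ∈ T, y.1 ∈ Prod.fst '' G → y.1 = z.1 ∨ y.1 = w.1 := fun y hy hyG => by
    by_contra h'
    exact (h.union₁ y.1).2 ⟨P, hP, hAP ⟨hT1 ▸ ⟨y, hy, rfl⟩, h'⟩⟩ hyG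
  have e2 : ∀ y ∈ T, y.2 ∈ Prod.snd '' G → y.2 = z.2 ∨ y.2 = w.2 := fun y hy hyG => by
    by_contra h'
    exact (h.union₂ y.2).2 ⟨P, hP, hAP' ⟨hT2 ▸ ⟨y, hy, rfl⟩, h'⟩⟩ hyG
  have hTG : ∀ y ∈ T, y ∈ G → y ∈ ({z, w} : Set (S × S')) := fun y hy hyG =>
    (e1 y hy ⟨y, hyG, rfl⟩).imp (h.inj₁ hyG hz) (h.inj₁ hyG hw)
  have hloop : ∀ B F F', IsArc B z w → B ⊆ range f → Face (A ∪ Prod.fst '' B) F →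
      Face (A' ∪ Prod.snd '' B) F' → ∃ g : ℝ → S × S', IsLoop g ∧ range g ⊆ G ∪ T ∧
        Face (range (Prod.fst ∘ g)) F ∧ Face (range (Prod.snd ∘ g)) F' := by
    intro B F F' hB hBf hF hF'
    obtain ⟨g, hg, hgr⟩ := hT.loop hB fun y hy => hTG y hy.1 (hfG (hBf hy.2))
    refine ⟨g, hg, ?_, ?_, ?_⟩
    · rw [hgr]
      exact union_subset subset_union_right ((hBf.trans hfG).trans subset_union_left)
    · rwa [range_comp, hgr, image_union, hT1]
    · rwa [range_comp, hgr, image_union, hT2]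
  have hsub : F₁ ∪ F₂ ⊆ P.1 := a4.subset.trans sdiff_subset
  have hsub' : F₁' ∪ F₂' ⊆ P.2 := b4.subset.trans sdiff_subset
  refine ⟨G ∪ T, C \ {P} ∪ {(F₁, F₁'), (F₂, F₂')}, ?_, subset_union_left,
    by rw [image_union, hT1], ?_⟩
  · constructor
    · exact h.compact.union hT.isCompact
    · exact InjOn.union_of_ends h.inj₁ t1 hz' hw' e1
    · exact InjOn.union_of_ends h.inj₂ t2 hz' hw' e2
    · exact (h.fin.sdiff).union (by simp)
    · rintro Q (hQ | rfl | rfl)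
      · obtain ⟨g, g1, g2, g3⟩ := h.loop Q hQ.1
        exact ⟨g, g1, g2.trans subset_union_left, g3⟩
      · exact hloop _ _ _ hA₀ hA₀f a1 b1
      · exact hloop _ _ _ hB₀ hB₀f a2 b2
    · have hT' : ∀ y ∈ T ∪ A₀, y.1 ∈ frontier F₁ ∧ y.2 ∈ frontier F₁' := fun y hy => by
        rw [a1.frontier, b1.frontier, ← hT1, ← hT2, ← image_union, ← image_union]
        exact ⟨⟨y, hy, rfl⟩, y, hy, rfl⟩
      rintro y (hy | hy)
      · obtain ⟨Q, hQ, hQ1, hQ2⟩ := h.cover y hy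
        by_cases hQP : Q = P
        · subst hQP
          have := hfr y hy (frontier_subset_closure hQ1)
          rw [← hU] at this
          rcases this with h' | h'
          · exact ⟨_, Or.inr (Or.inl rfl), hT' y (Or.inr h')⟩
          · refine ⟨_, Or.inr (Or.inr rfl), ?_⟩
            rw [a2.frontier, b2.frontier]
            exact ⟨Or.inr ⟨y, h', rfl⟩, Or.inr ⟨y, h', rfl⟩⟩
        · exact ⟨Q, Or.inl ⟨hQ, hQP⟩, hQ1, hQ2⟩
      · exact ⟨_, Or.inr (Or.inl rfl), hT' y (Or.inl hy)⟩
    · exact disj_step (φ := Prod.fst) hP h.disj₁ a4 a3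
    · exact disj_step (φ := Prod.snd) hP h.disj₂ b4 b3
    · rw [image_union, hT1]
      exact union_step (φ := Prod.fst) hP h.union₁ h.disj₁ ⟨z, hz, rfl⟩ ⟨w, hw, rfl⟩ hAP a4
    · rw [image_union, hT2]
      exact union_step (φ := Prod.snd) hP h.union₂ h.disj₂ ⟨z, hz, rfl⟩ ⟨w, hw, rfl⟩ hAP' b4
    · exact h.ulc.union hT.ulc h.compact hT.isCompact
    · exact h.conn.union z hz hT.left_mem hT.isPreconnected
    · exact fun q _ => noCut_union_arc h.noCut h.conn hT hz hw q
  · rintro Q (hQ | rfl | rfl)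
    · exact ⟨Q, hQ.1, Subset.rfl, Subset.rfl⟩
    · exact ⟨P, hP, subset_union_left.trans hsub, subset_union_left.trans hsub'⟩
    · exact ⟨P, hP, subset_union_right.trans hsub, subset_union_right.trans hsub'⟩

end State

section Gap

variable {X : Type*} [MetricSpace X] {f : ℝ → X} {K : Set X} {x u v : X}

/-- The component of a point in the complement of a closed set, on a closed curve. -/
theorem IsLoop.exists_gap (hf : IsLoop f) (hK : IsClosed K) (hx : x ∈ range f) (hxK : x ∉ K)
    (hu : u ∈ K ∩ range f) (hv : v ∈ K ∩ range f) (huv : u ≠ v) :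
    ∃ a ∈ K, ∃ b ∈ K, ∃ A, IsArc A a b ∧ A ⊆ range f ∧ x ∈ A ∧ A \ {a, b} ⊆ Kᶜ ∧
      IsPreconnected (A \ {a, b}) ∧
      ∀ T, IsPreconnected T → T ⊆ range f \ K → ∀ y ∈ A \ {a, b}, y ∈ T → T ⊆ A := by
  obtain ⟨t, rfl⟩ := hx
  have hc : IsClosed (f ⁻¹' K) := hK.preimage hf.cont
  have key : ∀ u ∈ K ∩ range f, ∃ s ∈ Ioo (t - 1) t, f s = u := by
    intro u hu
    obtain ⟨s, hs, rfl⟩ := hf.exists_mem_Ico (t - 1) hu.2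
    refine ⟨s, ⟨hs.1.lt_of_ne ?_, by linarith [hs.2]⟩, rfl⟩
    rintro rfl
    exact hxK (by have := hf.per (t - 1); rw [sub_add_cancel] at this; exact this ▸ hu.1)
  obtain ⟨s₁, s₂, h1, h2, h12, k1, k2⟩ : ∃ s₁ s₂, t - 1 < s₁ ∧ s₂ < t ∧ s₁ < s₂ ∧ f s₁ ∈ K ∧
      f s₂ ∈ K := by
    obtain ⟨s, hs, rfl⟩ := key u hu
    obtain ⟨s', hs', rfl⟩ := key v hv
    rcases lt_trichotomy s s' with h | h | h
    · exact ⟨s, s', hs.1, hs'.2, h, hu.1, hv.1⟩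
    · exact (huv (h ▸ rfl)).elim
    · exact ⟨s', s, hs'.1, hs.2, h, hv.1, hu.1⟩
  obtain ⟨a, ⟨⟨ha1, ha2⟩, haK⟩, ha⟩ := ((isCompact_Icc (a := s₂) (b := t)).inter_right
    hc).exists_isGreatest ⟨s₂, ⟨le_rfl, h2.le⟩, k2⟩
  obtain ⟨b, ⟨⟨hb1, hb2⟩, hbK⟩, hb⟩ := ((isCompact_Icc (a := t) (b := s₁ + 1)).inter_right
    hc).exists_isLeast ⟨s₁ + 1, ⟨by linarith, le_rfl⟩, by rw [mem_preimage, hf.per]; exact k1⟩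
  have hat : a < t := ha2.lt_of_ne (by rintro rfl; exact hxK haK)
  have htb : t < b := hb1.lt_of_ne (by rintro rfl; exact hxK hbK)
  have hgap : ∀ r ∈ Ioo a b, f r ∉ K := by
    intro r hr hrK
    rcases le_total r t with h | h
    · exact (ha ⟨⟨by linarith [hr.1], h⟩, hrK⟩).not_gt hr.1
    · exact (hb ⟨⟨h, by linarith [hr.2]⟩, hrK⟩).not_gt hr.2
  have hA := hf.isArc (a := a) (b := b) (by linarith) (by linarith)
  have hd : f '' Icc a b \ {f a, f b} = f '' Ioo a b := by
    apply Subset.antisymm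
    · rintro _ ⟨⟨r, hr, rfl⟩, hne⟩
      refine ⟨r, ⟨hr.1.lt_of_ne ?_, hr.2.lt_of_ne ?_⟩, rfl⟩
      · rintro rfl; exact hne (Or.inl rfl)
      · rintro rfl; exact hne (Or.inr rfl)
    · rintro _ ⟨r, hr, rfl⟩
      refine ⟨⟨r, Ioo_subset_Icc_self hr, rfl⟩, fun h => hgap r hr ?_⟩
      rcases h with h | h
      · rw [h]; exact haK
      · rw [mem_singleton_iff.1 h]; exact hbK
  refine ⟨f a, haK, f b, hbK, _, hA, image_subset_range _ _, ⟨t, ⟨hat.le, htb.le⟩, rfl⟩, ?_, ?_, ?_⟩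
  · rw [hd]
    rintro _ ⟨r, hr, rfl⟩
    exact hgap r hr
  · rw [hd]
    exact isPreconnected_Ioo.image _ hf.cont.continuousOn
  · intro T hT hTK y hy hyT
    have hcl : ∀ c d, IsClosed (f '' Icc c d) := fun c d => (isCompact_Icc.image hf.cont).isClosed
    have hI := hf.inter_eq (a := a) (b := b) (by linarith) (by linarith)
    have := isPreconnected_iff_subset_of_disjoint_closed.1 hT _ _ (hcl a b) (hcl b (a + 1))
      (by rw [← hf.range_eq (by linarith) (by linarith)]; exact fun z hz => (hTK hz).1) (by
        rw [hI, eq_empty_iff_forall_notMem]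
        rintro z ⟨hz, rfl | rfl⟩
        exacts [(hTK hz).2 haK, (hTK hz).2 hbK])
    exact this.resolve_right fun h => hy.2 (hI ▸ ⟨hy.1, h hyT⟩)

end Gap

section AddGaps

variable {S S' : Type*} [MetricSpace S] [MetricSpace S']
  {G : Set (S × S')} {C : Set (Set S × Set S')}

theorem State.isClosed₁ (h : State G C) : IsClosed (Prod.fst '' G) :=
  (h.compact.image continuous_fst).isClosed

theorem State.exists_face (h : State G C) {T : Set S} (hT : IsPreconnected T)
    (hne : T.Nonempty) (hTG : T ⊆ (Prod.fst '' G)ᶜ) : ∃ P ∈ C, T ⊆ P.1 := by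
  obtain ⟨x, hx⟩ := hne
  obtain ⟨P, hP, hxP⟩ := (h.union₁ x).1 (hTG hx)
  obtain ⟨f, hf, hfG, hF, -⟩ := h.loop P hP
  refine ⟨P, hP, hT.subset_of_closure_inter_subset hF.isOpen ⟨x, hx, hxP⟩ ?_⟩
  rintro y ⟨hy, hyT⟩
  rw [hF.closure_eq] at hy
  refine hy.resolve_right fun hyf => hTG hyT ?_
  obtain ⟨t, rfl⟩ := hyf
  exact ⟨f t, hfG (mem_range_self t), rfl⟩

variable [Surf S] [CompactSpace S] [ConnectedSpace S] [CocTriv S]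
  [Surf S'] [CompactSpace S'] [ConnectedSpace S'] [CocTriv S'] {f : ℝ → S} {u v : S}

/-- The gaps of the skeleton on a closed curve containing finitely many given points can be added
to the skeleton. -/
theorem State.add_gaps (h : State G C) (hf : IsLoop f) (hu : u ∈ Prod.fst '' G ∩ range f)
    (hv : v ∈ Prod.fst '' G ∩ range f) (huv : u ≠ v) (Q : Finset S) (hQ : (Q : Set S) ⊆ range f) :
    ∃ G' C', State G' C' ∧ G ⊆ G' ∧ Refines C' C ∧ (Q : Set S) ⊆ Prod.fst '' G' ∧
      ∀ x ∈ Prod.fst '' G', ∀ T, IsPreconnected T → T ⊆ range f \ Prod.fst '' G → x ∈ T →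
        T ⊆ Prod.fst '' G' := by
  classical
  induction Q using Finset.induction_on with
  | empty => exact ⟨G, C, h, Subset.rfl, Refines.rfl, by simp, fun x hx T _ h1 h2 =>
      ((h1 h2).2 hx).elim⟩
  | insert x Q hxQ ih =>
    rw [Finset.coe_insert, insert_subset_iff] at hQ
    obtain ⟨G', C', h', hG, hC, hQ', hinv⟩ := ih hQ.2
    have hΓ := image_mono (f := Prod.fst) hG
    by_cases hx : x ∈ Prod.fst '' G'
    · refine ⟨G', C', h', hG, hC, ?_, hinv⟩
      rw [Finset.coe_insert, insert_subset_iff]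
      exact ⟨hx, hQ'⟩
    obtain ⟨_, ⟨z, hz, rfl⟩, _, ⟨w, hw, rfl⟩, A, hA, hAf, hxA, hAK, hAc, hAT⟩ :=
      hf.exists_gap h'.isClosed₁ hQ.1 hx ⟨hΓ hu.1, hu.2⟩ ⟨hΓ hv.1, hv.2⟩ huv
    have hxA' : x ∈ A \ {z.1, w.1} := ⟨hxA, by
      rintro (rfl | rfl)
      exacts [hx ⟨z, hz, rfl⟩, hx ⟨w, hw, rfl⟩]⟩
    obtain ⟨P, hP, hAP⟩ := h'.exists_face hAc ⟨x, hxA'⟩ hAK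
    obtain ⟨G'', C'', h'', hG', hfst, hC'⟩ := h'.crosscut hP hz hw hA hAP
    refine ⟨G'', C'', h'', hG.trans hG', hC'.trans hC, ?_, ?_⟩
    · rw [Finset.coe_insert, insert_subset_iff, hfst]
      exact ⟨Or.inr hxA, hQ'.trans subset_union_left⟩
    · intro y hy T hT hTf hyT
      rw [hfst]
      by_cases hne : (T ∩ Prod.fst '' G').Nonempty
      · obtain ⟨y', hy'T, hy'⟩ := hne
        exact (hinv y' hy' T hT hTf hy'T).trans subset_union_left
      · have hTK : T ⊆ range f \ Prod.fst '' G' := fun q hq => ⟨(hTf hq).1, fun hq' => hne ⟨q, hq, hq'⟩⟩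
        rw [hfst] at hy
        have hyA := hy.resolve_left (hTK hyT).2
        refine (hAT T hT hTK y ⟨hyA, ?_⟩ hyT).trans subset_union_right
        rintro (rfl | rfl)
        exacts [(hTK hyT).2 ⟨z, hz, rfl⟩, (hTK hyT).2 ⟨w, hw, rfl⟩]

end AddGaps

section Cell

variable {X : Type*} [MetricSpace X] {f : ℝ → X} {K K' D : Set X}

theorem exists_cell_connection (hf : Continuous f) {a b : ℝ} (hab : a ≤ b) (hK : IsClosed K)
    (hKK : K ⊆ K') (ha : f a ∈ K') (hb : f b ∈ K') (hD : f '' Icc a b ⊆ D)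
    (hT : ∀ s ∈ Icc a b, ∀ t ∈ Icc a b, f s ∈ K → f t ∈ K →
      ∃ T ⊆ K, IsPreconnected T ∧ f s ∈ T ∧ f t ∈ T ∧ T ⊆ D)
    (hinv : ∀ x ∈ K', ∀ T, IsPreconnected T → T ⊆ range f \ K → x ∈ T → T ⊆ K') :
    ∃ T, IsPreconnected T ∧ T ⊆ K' ∩ D ∧ f a ∈ T ∧ f b ∈ T := by
  have hc : IsCompact (Icc a b ∩ f ⁻¹' K) := isCompact_Icc.inter_right (hK.preimage hf)
  rcases (Icc a b ∩ f ⁻¹' K).eq_empty_or_nonempty with he | hne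
  · refine ⟨f '' Icc a b, isPreconnected_Icc.image _ hf.continuousOn, subset_inter ?_ hD,
      ⟨a, ⟨le_rfl, hab⟩, rfl⟩, ⟨b, ⟨hab, le_rfl⟩, rfl⟩⟩
    refine hinv _ ha _ (isPreconnected_Icc.image _ hf.continuousOn) ?_ ⟨a, ⟨le_rfl, hab⟩, rfl⟩
    rintro _ ⟨t, ht, rfl⟩
    exact ⟨mem_range_self _, fun h => (eq_empty_iff_forall_notMem.1 he) t ⟨ht, h⟩⟩
  · obtain ⟨s, ⟨hs, hsK⟩, hs'⟩ := hc.exists_isLeast hne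
    obtain ⟨t, ⟨ht, htK⟩, ht'⟩ := hc.exists_isGreatest hne
    obtain ⟨T, t1, t2, t3, t4, t5⟩ := hT s hs t ht hsK htK
    have e1 : f '' Icc a s ⊆ K' := by
      rintro _ ⟨r, hr, rfl⟩
      rcases hr.2.lt_or_eq with h | rfl
      · suffices H : f '' Icc a r ⊆ K' from H ⟨r, ⟨hr.1, le_rfl⟩, rfl⟩
        refine hinv _ ha (f '' Icc a r) (isPreconnected_Icc.image _ hf.continuousOn) ?_
          ⟨a, ⟨le_rfl, hr.1⟩, rfl⟩
        rintro _ ⟨q, hq, rfl⟩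
        exact ⟨mem_range_self _, fun hqK => (hq.2.trans_lt h).not_ge
          (hs' ⟨⟨hq.1, hq.2.trans (hr.2.trans hs.2)⟩, hqK⟩)⟩
      · exact hKK hsK
    have e2 : f '' Icc t b ⊆ K' := by
      rintro _ ⟨r, hr, rfl⟩
      rcases hr.1.lt_or_eq with h | rfl
      · suffices H : f '' Icc r b ⊆ K' from H ⟨r, ⟨le_rfl, hr.2⟩, rfl⟩
        refine hinv _ hb (f '' Icc r b) (isPreconnected_Icc.image _ hf.continuousOn) ?_
          ⟨b, ⟨hr.2, le_rfl⟩, rfl⟩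
        rintro _ ⟨q, hq, rfl⟩
        exact ⟨mem_range_self _, fun hqK => (h.trans_le hq.1).not_ge
          (ht' ⟨⟨ht.1.trans (hr.1.trans hq.1), hq.2⟩, hqK⟩)⟩
      · exact hKK htK
    have p1 := (isPreconnected_Icc (a := a) (b := s)).image _ hf.continuousOn
    have p2 := (isPreconnected_Icc (a := t) (b := b)).image _ hf.continuousOn
    refine ⟨f '' Icc a s ∪ T ∪ f '' Icc t b,
      IsPreconnected.union (f t) (Or.inr t4) ⟨t, ⟨le_rfl, ht.2⟩, rfl⟩
        (IsPreconnected.union (f s) ⟨s, ⟨hs.1, le_rfl⟩, rfl⟩ t3 p1 t2) p2, subset_inter ?_ ?_, Or.inl (Or.inl ⟨a, ⟨le_rfl, hs.1⟩, rfl⟩),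
      Or.inr ⟨b, ⟨ht.2, le_rfl⟩, rfl⟩⟩
    · exact union_subset (union_subset e1 (t1.trans hKK)) e2
    · exact union_subset (union_subset ((image_mono (Icc_subset_Icc_right hs.2)).trans hD) t5)
        ((image_mono (Icc_subset_Icc_left ht.1)).trans hD)

theorem triv_loop {e : X → X → ZMod 2} (hf : IsLoop f) (he : Coc e (range f)) {N : ℕ} (hN : 0 < N)
    {s : X → ZMod 2} (hs : SecOn e s K)
    (hcell : ∀ k < N, ∃ T D t, IsPreconnected T ∧ T ⊆ K ∩ D ∧ f ((k : ℝ) / N) ∈ T ∧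
      f (((k : ℝ) + 1) / N) ∈ T ∧ f '' Icc ((k : ℝ) / N) (((k : ℝ) + 1) / N) ⊆ D ∧ SecOn e t D) :
    Triv e (range f) := by
  classical
  have hN' : (0:ℝ) < N := by exact_mod_cast hN
  have h0 : f 0 ∈ K := by
    obtain ⟨T, D, t, -, h, h0, -⟩ := hcell 0 hN
    have := (h h0).1
    simpa using this
  have key : ∀ k : ℕ, k ≤ N → ∃ t, SecOn e t (f '' Icc 0 ((k : ℝ) / N)) ∧ t (f 0) = s (f 0) ∧
      t (f ((k : ℝ) / N)) = s (f ((k : ℝ) / N)) := by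
    intro k
    induction k with
    | zero =>
      intro _
      refine ⟨s, hs.mono ?_, rfl, rfl⟩
      rintro _ ⟨r, hr, rfl⟩
      have : r = 0 := le_antisymm (by simpa using hr.2) hr.1
      rwa [this]
    | succ k ih =>
      intro hk
      have hk1 : ((k : ℝ) + 1) / N ≤ 1 := (div_le_one hN').2 (by exact_mod_cast hk)
      have hk0 : 0 ≤ (k : ℝ) / N := by positivity
      have hkk : (k : ℝ) / N ≤ ((k : ℝ) + 1) / N := by gcongr; linarith
      push_cast
      obtain ⟨t, ht, ht0, htk⟩ := ih (by omega)
      obtain ⟨T, D, t', hT, hTK, hTa, hTb, hD, ht'⟩ := hcell k (by omega)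
      obtain ⟨κ, hκ⟩ := (ht'.mono (hTK.trans inter_subset_right)).unique
        (hs.mono (hTK.trans inter_subset_left)) hT
      have ht'' := (ht'.add_const κ).mono hD
      set A := f '' Icc 0 ((k : ℝ) / N) with hA
      set B := f '' Icc ((k : ℝ) / N) (((k : ℝ) + 1) / N) with hB
      have hAB : ∀ x ∈ A, x ∈ B → t x = t' x + κ := by
        rintro _ ⟨r, hr, rfl⟩ ⟨q, hq, hqr⟩
        obtain ⟨n, hn⟩ := hf.inj _ _ hqr.symm
        have hn0 : (0:ℝ) ≤ n := by linarith [hr.2, hq.1]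
        have hn1 : (n:ℝ) ≤ 1 := by linarith [hr.1, hq.2]
        have hn01 : n = 0 ∨ n = 1 := by
          have a1 : 0 ≤ n := by exact_mod_cast hn0
          have a2 : n ≤ 1 := by exact_mod_cast hn1
          omega
        rcases hn01 with rfl | rfl
        · have : r = (k : ℝ) / N := by
            simp at hn
            linarith [hr.2, hq.1]
          rw [this, htk, hκ _ hTa]
        · have e1 : r = 0 := by push_cast at hn; linarith [hr.1, hq.2]
          have e2 : q = ((k : ℝ) + 1) / N := by push_cast at hn; linarith [hr.1, hq.2]
          rw [e2] at hqr
          rw [← hqr, ← hκ _ hTb, hqr, e1, ht0]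
      refine ⟨A.piecewise t fun x => t' x + κ, ?_, ?_, ?_⟩
      · have hU : f '' Icc 0 (((k : ℝ) + 1) / N) = A ∪ B := by
          rw [← image_union, Icc_union_Icc_eq_Icc hk0 hkk]
        rw [hU]
        refine SecOn.closed_union (isCompact_Icc.image hf.cont).isClosed
          (isCompact_Icc.image hf.cont).isClosed (ht.congr fun x hx => by simp [hx])
          (ht''.congr fun x hx => ?_) (he.mono (inter_subset_left.trans (image_subset_range _ _)))
        by_cases hxA : x ∈ A
        · simp [hxA, hAB x hxA hx]
        · simp [hxA]
      · rw [piecewise_eq_of_mem _ _ _ (show f 0 ∈ A from ⟨0, ⟨le_rfl, hk0⟩, rfl⟩), ht0]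
      · by_cases hxA : f (((k : ℝ) + 1) / N) ∈ A
        · rw [piecewise_eq_of_mem _ _ _ hxA, hAB _ hxA ⟨_, ⟨hkk, le_rfl⟩, rfl⟩, hκ _ hTb]
        · rw [piecewise_eq_of_notMem _ _ _ hxA, hκ _ hTb]
  obtain ⟨t, ht, -⟩ := key N le_rfl
  rw [div_self hN'.ne'] at ht
  refine ⟨t, ?_⟩
  rwa [hf.range_eq (a := 0) (b := 0) le_rfl (by norm_num), zero_add,
    ← image_union, union_eq_right.2 (Icc_subset_Icc_right zero_le_one)]

end Cell

section Circle

/-- The standard parametrisation of a circle. -/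
theorem isLoop_circleMap {r : ℝ} (hr : 0 < r) :
    IsLoop fun t : ℝ => circleMap 0 r (2 * Real.pi * t) where
  cont := by fun_prop
  per t := by
    have := periodic_circleMap 0 r (2 * Real.pi * t)
    simpa [mul_add] using this
  inj s t h := by
    obtain ⟨n, hn⟩ := (circleMap_eq_circleMap_iff 0 hr.ne').1 h
    refine ⟨-n, ?_⟩
    have hpi : (2 * Real.pi : ℂ) ≠ 0 := by exact_mod_cast Real.two_pi_pos.ne'
    have h2 : ((2 * Real.pi * s : ℝ) : ℂ) = (2 * Real.pi * t : ℝ) + n * (2 * Real.pi) := by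
      have := mul_right_cancel₀ Complex.I_ne_zero
        (hn.trans (by ring : _ = (((2 * Real.pi * t : ℝ) : ℂ) + n * (2 * Real.pi)) * Complex.I))
      exact this
    have h3 : 2 * Real.pi * s = 2 * Real.pi * t + n * (2 * Real.pi) := by exact_mod_cast h2
    have h4 : 2 * Real.pi * (t - (s - n)) = 0 := by linarith
    have := (mul_eq_zero.1 h4).resolve_left Real.two_pi_pos.ne'
    push_cast
    linarith

theorem range_circleMap_two_pi {r : ℝ} (hr : 0 < r) :
    range (fun t : ℝ => circleMap 0 r (2 * Real.pi * t)) = sphere (0 : ℂ) r := by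
  have h := range_circleMap 0 r
  rw [abs_of_pos hr] at h
  rw [← h]
  refine Subset.antisymm (fun x ⟨t, ht⟩ => ⟨_, ht⟩) fun x ⟨t, ht⟩ => ⟨t / (2 * Real.pi), ?_⟩
  rw [← ht]
  exact congrArg _ (mul_div_cancel₀ _ Real.two_pi_pos.ne')

theorem exists_two_points {X : Type*} [TopologicalSpace X] {K U V : Set X} (hK : IsPreconnected K)
    (hK' : ∀ w ∈ K, IsPreconnected (K \ {w})) (hU : IsOpen U) (hV : IsOpen V)
    (hUV : Disjoint U V) (h1 : (K ∩ U).Nonempty) (h2 : (K ∩ V).Nonempty) :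
    ∃ u ∈ K \ (U ∪ V), ∃ v ∈ K \ (U ∪ V), u ≠ v := by
  by_contra! H
  rcases (K \ (U ∪ V)).eq_empty_or_nonempty with he | ⟨w, hw⟩
  · obtain ⟨x, -, hx⟩ := hK U V hU hV (sdiff_eq_empty.1 he) h1 h2
    exact hUV.le_bot hx
  · obtain ⟨a, ha, haU⟩ := h1
    obtain ⟨b, hb, hbV⟩ := h2
    obtain ⟨x, -, hx⟩ := hK' w hw.1 U V hU hV (fun y hy => by
        by_contra hyn
        exact hy.2 (H y ⟨hy.1, hyn⟩ w hw))
      ⟨a, ⟨ha, fun h => hw.2 (Or.inl (mem_singleton_iff.1 h ▸ haU))⟩, haU⟩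
      ⟨b, ⟨hb, fun h => hw.2 (Or.inr (mem_singleton_iff.1 h ▸ hbV))⟩, hbV⟩
    exact hUV.le_bot hx

end Circle

section Mesh

variable {S S' : Type*} [MetricSpace S] [MetricSpace S']
  {G : Set (S × S')} {C : Set (Set S × Set S')}

theorem State.conn₁ (h : State G C) : IsPreconnected (Prod.fst '' G) :=
  h.conn.image _ continuous_fst.continuousOn

theorem State.noCut₁ (h : State G C) {w : S} (hw : w ∈ Prod.fst '' G) :
    IsPreconnected (Prod.fst '' G \ {w}) := by
  obtain ⟨z, hz, rfl⟩ := hw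
  have : Prod.fst '' G \ {z.1} = Prod.fst '' (G \ {z}) := by
    rw [h.inj₁.image_sdiff, inter_eq_right.2 (singleton_subset_iff.2 hz), image_singleton]
  rw [this]
  exact (h.noCut z hz).image _ continuous_fst.continuousOn

variable [Surf S] [CompactSpace S] [ConnectedSpace S] [CocTriv S]
  [Surf S'] [CompactSpace S'] [ConnectedSpace S'] [CocTriv S'] {j : ℂ → S}

/-- A decomposition may be refined so that the cells meeting a disc stay close to it. -/
theorem State.mesh_disc (h : State G C) (hj : IsOpenEmbedding j)
    (h1 : (Prod.fst '' G ∩ j '' ball 0 1).Nonempty) (h2 : ¬ Prod.fst '' G ⊆ j '' closedBall 0 2) :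
    ∃ G' C', State G' C' ∧ G ⊆ G' ∧ Refines C' C ∧
      ∀ P ∈ C', (P.1 ∩ j '' ball 0 1).Nonempty → P.1 ⊆ j '' closedBall 0 3 := by
  classical
  set g : ℝ → ℂ := fun t => circleMap 0 2 (2 * Real.pi * t) with hg
  have hgl : IsLoop g := isLoop_circleMap two_pos
  have hgr : range g = sphere 0 2 := range_circleMap_two_pi two_pos
  have hf : IsLoop (j ∘ g) := hgl.image hj.continuous.continuousOn hj.injective.injOn
  set f := j ∘ g with hfdef
  have hfr : range f = j '' sphere 0 2 := by rw [hfdef, range_comp, hgr]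
  have hgn : ∀ t, ‖g t‖ = 2 := fun t => by
    have : g t ∈ sphere (0:ℂ) 2 := hgr ▸ mem_range_self t
    simpa using this
  have hclosed : ∀ r, IsClosed (j '' closedBall 0 r) := fun r =>
    ((isCompact_closedBall (0:ℂ) r).image hj.continuous).isClosed
  obtain ⟨u, hu, v, hv, huv⟩ : ∃ u ∈ Prod.fst '' G ∩ range f, ∃ v ∈ Prod.fst '' G ∩ range f,
      u ≠ v := by
    have key : ∀ x, x ∉ j '' ball 0 2 ∪ (j '' closedBall 0 2)ᶜ → x ∈ range f := by
      intro x hx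
      rw [hfr]
      simp only [mem_union, not_or, mem_compl_iff, not_not] at hx
      obtain ⟨z, hz, rfl⟩ := hx.2
      refine ⟨z, ?_, rfl⟩
      have : z ∉ ball (0:ℂ) 2 := fun hz' => hx.1 ⟨z, hz', rfl⟩
      simp only [mem_closedBall, mem_ball, mem_sphere, not_lt] at *
      linarith
    obtain ⟨u, hu, v, hv, huv⟩ := exists_two_points h.conn₁ (fun w hw => h.noCut₁ hw)
      (hj.isOpenMap _ (isOpen_ball (x := 0) (ε := 2))) (hclosed 2).isOpen_compl
      (disjoint_compl_right.mono_left (image_mono ball_subset_closedBall))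
      (h1.mono (inter_subset_inter_right _ (image_mono (ball_subset_ball (by norm_num)))))
      (by
        obtain ⟨x, hx, hx'⟩ := not_subset.1 h2
        exact ⟨x, hx, hx'⟩)
    exact ⟨u, ⟨hu.1, key u hu.2⟩, v, ⟨hv.1, key v hv.2⟩, huv⟩
  obtain ⟨ρ, hρ, hleb⟩ := lebesgue_number_lemma_of_metric (s := range f)
    (c := fun t : ℝ => j '' ball (g t) (1 / 2)) hf.isCompact
    (fun t => hj.isOpenMap _ isOpen_ball) (by
      rintro _ ⟨t, rfl⟩
      exact mem_iUnion.2 ⟨t, g t, mem_ball_self (by norm_num), rfl⟩)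
  obtain ⟨δ, hδ, hulc⟩ := (h.ulc.image h.compact continuous_fst.continuousOn h.inj₁) (ρ / 2)
    (half_pos hρ)
  obtain ⟨η, hη, hfη⟩ := Metric.uniformContinuousOn_iff.1
    ((isCompact_Icc (a := (0:ℝ)) (b := 1)).uniformContinuousOn_of_continuous hf.cont.continuousOn)
    (min (ρ / 2) δ) (lt_min (half_pos hρ) hδ)
  obtain ⟨N, hN⟩ := exists_nat_one_div_lt hη
  set M := N + 1 with hM
  have hM0 : (0:ℝ) < M := by positivity
  have hMη : 1 / (M : ℝ) < η := by rw [hM]; push_cast; exact hN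
  obtain ⟨G', C', h', hG, hC, hQ, hinv⟩ := h.add_gaps hf hu hv huv
    ((Finset.range (M + 1)).image fun k : ℕ => f (k / M)) (by
      intro x hx
      obtain ⟨k, -, rfl⟩ := Finset.mem_image.1 (Finset.mem_coe.1 hx)
      exact mem_range_self _)
  refine ⟨G', C', h', hG, hC, ?_⟩
  rintro P hP ⟨p, hpP, hp⟩ q hqP
  by_contra hq
  have hΓ' := h'.isClosed₁
  obtain ⟨ℓ, hℓ, hℓG, hF, -⟩ := h'.loop P hP
  have hjn : Jn (Prod.fst '' G') p q := ⟨P.1, hF.conn.isPreconnected,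
    fun x hx => (h'.union₁ x).2 ⟨P, hP, hx⟩, hpP, hqP⟩
  obtain ⟨e, he⟩ := exists_dip p q
  obtain ⟨s, hs⟩ := he.triv_of_jn hΓ' hjn
  have hq2 : q ∉ j '' closedBall 0 2 := fun h => hq (image_mono (closedBall_subset_closedBall
    (by norm_num)) h)
  have hpf : p ∉ range f := by
    rw [hfr]
    rintro ⟨z, hz, hzp⟩
    obtain ⟨w, hw, rfl⟩ := hp
    rw [hj.injective hzp] at hz
    simp only [mem_ball, mem_sphere] at hz hw
    linarith
  have hqf : q ∉ range f := by
    rw [hfr]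
    exact fun h => hq2 (image_mono sphere_subset_closedBall h)
  have hD : ∀ t, ∃ r, SecOn e r (j '' closedBall (g t) (1 / 2)) := by
    intro t
    have hj' : IsOpenEmbedding (j ∘ fun z => g t + z) :=
      hj.comp (Homeomorph.addLeft (g t)).isOpenEmbedding
    have : j '' closedBall (g t) (1 / 2) = (j ∘ fun z => g t + z) '' closedBall 0 (1 / 2) := by
      rw [image_comp]
      congr 1
      ext z
      simp [mem_closedBall, dist_eq_norm, ← sub_eq_neg_add]
    rw [this]
    refine (acyc_disc hj' (by norm_num : (0:ℝ) < 1 / 2)).triv e (he.1.mono ?_)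
    rw [← this]
    rintro _ ⟨z, hz, rfl⟩ hpq
    rw [mem_closedBall, dist_eq_norm] at hz
    have z1 := norm_sub_norm_le (g t) z
    have z2 := norm_sub_norm_le z (g t)
    rw [norm_sub_rev] at z1
    have := hgn t
    rcases hpq with hzp | hzq
    · obtain ⟨w, hw, hw'⟩ := hp
      rw [← hzp] at hw'
      rw [hj.injective hw', mem_ball, dist_zero_right] at hw
      linarith
    · refine hq ⟨z, ?_, hzq⟩
      rw [mem_closedBall, dist_zero_right]
      linarith
  refine not_jn_circle hj (image_mono (ball_subset_ball (by norm_num : (1:ℝ) ≤ 2)) hp) hq2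
    (hfr ▸ he.jn_of_triv hf.isCompact.isClosed hpf hqf ?_)
  refine triv_loop hf (he.1.mono ?_) (N := M) (by omega) hs fun k hk => ?_
  · rintro x hx (rfl | rfl)
    exacts [hpf hx, hqf hx]
  set a : ℝ := (k : ℝ) / M with ha
  set b : ℝ := ((k : ℝ) + 1) / M with hb
  have hba : b - a = 1 / M := by rw [ha, hb]; ring
  have hM1 : 0 < 1 / (M : ℝ) := by positivity
  have hab : a ≤ b := by linarith
  have ha0 : 0 ≤ a := by positivity
  have hb1 : b ≤ 1 := (div_le_one hM0).2 (by exact_mod_cast hk)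
  have hclose : ∀ s ∈ Icc a b, ∀ t ∈ Icc a b, dist (f s) (f t) < min (ρ / 2) δ := by
    intro s hs t ht
    refine hfη s ⟨by linarith [hs.1], by linarith [hs.2]⟩ t ⟨by linarith [ht.1], by linarith [ht.2]⟩
      ?_
    rw [Real.dist_eq, abs_lt]
    constructor <;> linarith [hs.1, hs.2, ht.1, ht.2]
  obtain ⟨i, hi⟩ := hleb (f a) (mem_range_self a)
  obtain ⟨r, hr⟩ := hD i
  have hsub : ball (f a) ρ ⊆ j '' closedBall (g i) (1 / 2) :=
    hi.trans (image_mono ball_subset_closedBall)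
  have hmemQ : ∀ m : ℕ, m ≤ M → f ((m : ℝ) / M) ∈ Prod.fst '' G' := fun m hm =>
    hQ (Finset.mem_coe.2 (Finset.mem_image.2 ⟨m, Finset.mem_range.2 (by omega), rfl⟩))
  have hcellD : f '' Icc a b ⊆ j '' closedBall (g i) (1 / 2) := by
    rintro _ ⟨t, ht, rfl⟩
    refine hsub ?_
    have := hclose t ht a ⟨le_rfl, hab⟩
    exact this.trans_le ((min_le_left _ _).trans (by linarith))
  obtain ⟨T, hT, hTK, hTa, hTb⟩ := exists_cell_connection hf.cont hab h.isClosed₁ (image_mono hG)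
    (hmemQ k hk.le) (by have := hmemQ (k + 1) hk; push_cast at this; exact this) hcellD (by
      intro s hs t ht hsK htK
      obtain ⟨T, t1, t2, t3, t4, t5⟩ := hulc _ hsK _ htK ((hclose s hs t ht).trans_le
        (min_le_right _ _))
      refine ⟨T, t1, t2, t3, t4, fun x hx => hsub ?_⟩
      have k1 := t5 x hx
      have k2 := (hclose s hs a ⟨le_rfl, hab⟩).trans_le (min_le_left _ _)
      rw [mem_ball]
      linarith [dist_triangle x (f s) (f a)]) hinv
  exact ⟨T, _, r, hT, hTK, hTa, hTb, hcellD, hr⟩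

/-- Every decomposition has a refinement with small cells. -/
theorem State.mesh (h : State G C) {ε : ℝ}
    (hΓ : ∃ u ∈ Prod.fst '' G, ∃ v ∈ Prod.fst '' G, ε ≤ dist u v) (hε : 0 < ε) :
    ∃ G' C', State G' C' ∧ G ⊆ G' ∧ Refines C' C ∧ ∀ P ∈ C', ∀ x ∈ P.1, ∀ y ∈ P.1, dist x y < ε := by
  classical
  choose j hj hj0 hjr using fun x : S => Surf.chart x (ball x (ε / 2))
    (ball_mem_nhds x (half_pos hε))
  have hdist : ∀ i, ∀ x ∈ range (j i), ∀ y ∈ range (j i), dist x y < ε := fun i x hx y hy => by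
    have h1 := mem_ball.1 (hjr i hx)
    have h2 := mem_ball'.1 (hjr i hy)
    linarith [dist_triangle x i y]
  obtain ⟨t, ht⟩ := isCompact_univ.elim_finite_subcover (fun i => j i '' ball 0 1)
    (fun i => (hj i).isOpenMap _ isOpen_ball)
    (fun x _ => mem_iUnion.2 ⟨x, 0, mem_ball_self one_pos, hj0 x⟩)
  have key : ∀ n : ℕ, ∀ A ⊆ t, (t \ A).card ≤ n → ∀ G' C', State G' C' → G ⊆ G' → Refines C' C →
      (∀ i ∈ A, ∀ P ∈ C', (P.1 ∩ j i '' ball 0 1).Nonempty → P.1 ⊆ range (j i)) →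
      ∃ G' C', State G' C' ∧ G ⊆ G' ∧ Refines C' C ∧ ∀ i ∈ t,
        (Prod.fst '' G' ∩ j i '' ball 0 1).Nonempty →
        ∀ P ∈ C', (P.1 ∩ j i '' ball 0 1).Nonempty → P.1 ⊆ range (j i) := by
    intro n
    induction n with
    | zero =>
      intro A hA hn G' C' h' hG hC hAC
      refine ⟨G', C', h', hG, hC, fun i hi _ => hAC i ?_⟩
      exact Finset.sdiff_eq_empty_iff_subset.1 (Finset.card_eq_zero.1 (Nat.le_zero.1 hn)) hi
    | succ n ih =>
      intro A hA hn G' C' h' hG hC hAC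
      by_cases H : ∃ i ∈ t \ A, (Prod.fst '' G' ∩ j i '' ball 0 1).Nonempty
      · obtain ⟨i, hi, hiG⟩ := H
        obtain ⟨hit, hiA⟩ := Finset.mem_sdiff.1 hi
        obtain ⟨u, hu, v, hv, huv⟩ := hΓ
        obtain ⟨G₁, C₁, h₁, hG₁, hC₁, hP₁⟩ := h'.mesh_disc (hj i) hiG fun hsub =>
          (hdist i u (image_subset_range _ _ (hsub (image_mono hG hu))) v
            (image_subset_range _ _ (hsub (image_mono hG hv)))).not_ge huv
        refine ih (insert i A) (Finset.insert_subset hit hA) ?_ G₁ C₁ h₁ (hG.trans hG₁)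
          (hC₁.trans hC) ?_
        · have : t \ insert i A = (t \ A).erase i := by
            ext x
            simp only [Finset.mem_sdiff, Finset.mem_insert, Finset.mem_erase]
            tauto
          rw [this, Finset.card_erase_of_mem hi]
          omega
        · intro k hk P hP hPk
          rcases Finset.mem_insert.1 hk with rfl | hk
          · exact (hP₁ P hP hPk).trans (image_subset_range _ _)
          · obtain ⟨Q, hQ, hPQ, -⟩ := hC₁ P hP
            exact hPQ.trans (hAC k hk Q hQ (hPk.mono (inter_subset_inter_left _ hPQ)))
      · refine ⟨G', C', h', hG, hC, fun i hi hiG => hAC i ?_⟩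
        by_contra hiA
        exact H ⟨i, Finset.mem_sdiff.2 ⟨hi, hiA⟩, hiG⟩
  obtain ⟨G', C', h', hG, hC, hP'⟩ := key _ ∅ (by simp) le_rfl G C h Subset.rfl Refines.rfl (by simp)
  refine ⟨G', C', h', hG, hC, fun P hP x hx y hy => ?_⟩
  obtain ⟨f, hf, hfG, hF, -⟩ := h'.loop P hP
  obtain ⟨i, hi, hui⟩ := mem_iUnion₂.1 (ht (mem_univ (f 0).1))
  have hcl : (f 0).1 ∈ closure P.1 := by
    rw [hF.closure_eq]
    exact Or.inr ⟨0, rfl⟩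
  have hPi := hP' i hi ⟨_, ⟨f 0, hfG (mem_range_self 0), rfl⟩, hui⟩ P hP (by
    rw [inter_comm]
    exact mem_closure_iff.1 hcl _ ((hj i).isOpenMap _ isOpen_ball) hui)
  exact hdist i x (hPi hx) y (hPi hy)

end Mesh

section Initial

theorem IsLoop.isPreconnected_compl {X : Type*} [TopologicalSpace X] {f : ℝ → X} (hf : IsLoop f)
    {w : X} (hw : w ∈ range f) : IsPreconnected (range f \ {w}) := by
  obtain ⟨t, rfl⟩ := hw
  have : range f \ {f t} = f '' Ioo t (t + 1) := by
    apply Subset.antisymm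
    · rintro x ⟨hx, hne⟩
      obtain ⟨s, hs, rfl⟩ := hf.exists_mem_Ico t hx
      refine ⟨s, ⟨hs.1.lt_of_ne ?_, hs.2⟩, rfl⟩
      rintro rfl
      exact hne rfl
    · rintro _ ⟨s, hs, rfl⟩
      refine ⟨mem_range_self s, fun h => hs.1.ne' ?_⟩
      exact hf.injOn_Ico t ⟨hs.1.le, hs.2⟩ ⟨le_rfl, by linarith⟩ h
  rw [this]
  exact isPreconnected_Ioo.image _ hf.cont.continuousOn

theorem IsLoop.ulc {X : Type*} [MetricSpace X] {f : ℝ → X} (hf : IsLoop f) : Ulc (range f) := by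
  obtain ⟨A, B, hA, hB, hU, -⟩ := hf.split (mem_range_self 0) (mem_range_self (1 / 2))
    (hf.isArc (by norm_num) (by norm_num)).ne
  exact hU ▸ hA.ulc.union hB.ulc hA.isCompact hB.isCompact

theorem Face.disc {S : Type*} [TopologicalSpace S] [T2Space S] {j : ℂ → S} (hj : IsOpenEmbedding j)
    {r : ℝ} (hr : 0 < r) : Face (j '' sphere 0 r) (j '' ball 0 r) where
  isOpen := hj.isOpenMap _ isOpen_ball
  conn := ((convex_ball (0:ℂ) r).isConnected ⟨0, mem_ball_self hr⟩).image _
    hj.continuous.continuousOn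
  frontier := by
    have h1 : closure (j '' ball 0 r) = j '' closedBall 0 r := by
      apply Subset.antisymm
      · exact closure_minimal (image_mono ball_subset_closedBall)
          ((isCompact_closedBall (0:ℂ) r).image hj.continuous).isClosed
      · rw [← closure_ball (0:ℂ) hr.ne']
        exact image_closure_subset_closure_image hj.continuous
    rw [(hj.isOpenMap _ isOpen_ball).frontier_eq, h1, ← image_sdiff hj.injective,
      closedBall_sdiff_ball]

theorem Face.notMem_iff {X : Type*} [TopologicalSpace X] {J F : Set X} (h : Face J F) (x : X) :
    x ∉ J ↔ x ∈ F ∨ x ∈ (closure F)ᶜ := by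
  rw [h.closure_eq, mem_compl_iff, mem_union, not_or]
  have := fun hx : x ∈ F => disjoint_left.1 h.disjoint hx
  tauto

variable {S S' : Type*} [MetricSpace S] [MetricSpace S']
  [Surf S] [CompactSpace S] [ConnectedSpace S] [CocTriv S]
  [Surf S'] [CompactSpace S'] [ConnectedSpace S'] [CocTriv S']

/-- The decompositions of two surfaces into two cells. -/
theorem State.of_loop {f : ℝ → S × S'} (h1 : IsLoop (Prod.fst ∘ f)) (h2 : IsLoop (Prod.snd ∘ f))
    {F : Set S} {F' : Set S'} (hF : Face (range (Prod.fst ∘ f)) F)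
    (hF' : Face (range (Prod.snd ∘ f)) F') :
    State (range f) {(F, F'), ((closure F)ᶜ, (closure F')ᶜ)} := by
  have hf : IsLoop f := ⟨h1.cont.prodMk h2.cont, fun t => Prod.ext (h1.per t) (h2.per t),
    fun s t hst => h1.inj s t (congrArg Prod.fst hst)⟩
  have hO := h1.other_face hF
  have hO' := h2.other_face hF'
  refine ⟨hf.isCompact, ?_, ?_, by simp, ?_, ?_, ?_, ?_, ?_, ?_, hf.ulc,
    isPreconnected_range hf.cont, fun w => hf.isPreconnected_compl⟩
  · rintro _ ⟨s, rfl⟩ _ ⟨t, rfl⟩ hst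
    obtain ⟨n, rfl⟩ := h1.inj s t hst
    exact (hf.add_int s n).symm
  · rintro _ ⟨s, rfl⟩ _ ⟨t, rfl⟩ hst
    obtain ⟨n, rfl⟩ := h2.inj s t hst
    exact (hf.add_int s n).symm
  · rintro P (rfl | rfl)
    exacts [⟨f, hf, Subset.rfl, hF, hF'⟩, ⟨f, hf, Subset.rfl, hO, hO'⟩]
  · rintro _ ⟨t, rfl⟩
    refine ⟨_, Or.inl rfl, ?_, ?_⟩
    · rw [hF.frontier]; exact ⟨t, rfl⟩
    · rw [hF'.frontier]; exact ⟨t, rfl⟩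
  · rintro P (rfl | rfl) Q (rfl | rfl) h
    exacts [(h rfl).elim, disjoint_compl_right.mono_left subset_closure,
      (disjoint_compl_right.mono_left subset_closure).symm, (h rfl).elim]
  · rintro P (rfl | rfl) Q (rfl | rfl) h
    exacts [(h rfl).elim, disjoint_compl_right.mono_left subset_closure,
      (disjoint_compl_right.mono_left subset_closure).symm, (h rfl).elim]
  · intro x
    rw [← range_comp, hF.notMem_iff]
    simp
  · intro x
    rw [← range_comp, hF'.notMem_iff]
    simp

theorem exists_state (S S' : Type*) [MetricSpace S] [MetricSpace S']
    [Surf S] [CompactSpace S] [ConnectedSpace S] [CocTriv S]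
    [Surf S'] [CompactSpace S'] [ConnectedSpace S'] [CocTriv S'] :
    ∃ (G : Set (S × S')) (C : Set (Set S × Set S')), State G C ∧ G.Nontrivial := by
  obtain ⟨x⟩ := (inferInstance : Nonempty S)
  obtain ⟨x'⟩ := (inferInstance : Nonempty S')
  obtain ⟨j, hj, -, -⟩ := Surf.chart x univ univ_mem
  obtain ⟨j', hj', -, -⟩ := Surf.chart x' univ univ_mem
  have hg := isLoop_circleMap one_pos
  have hgr := range_circleMap_two_pi one_pos
  set g : ℝ → ℂ := fun t => circleMap 0 1 (2 * Real.pi * t)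
  have h1 : IsLoop (j ∘ g) := hg.image hj.continuous.continuousOn hj.injective.injOn
  have h2 : IsLoop (j' ∘ g) := hg.image hj'.continuous.continuousOn hj'.injective.injOn
  refine ⟨_, _, State.of_loop (f := fun t => (j (g t), j' (g t))) h1 h2 (F := j '' ball 0 1)
    (F' := j' '' ball 0 1) ?_ ?_, ⟨_, ⟨0, rfl⟩, _, ⟨1 / 2, rfl⟩, ?_⟩⟩
  · have := Face.disc hj one_pos
    rwa [← hgr, ← range_comp] at this
  · have := Face.disc hj' one_pos
    rwa [← hgr, ← range_comp] at this
  · intro h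
    exact (h1.isArc (a := 0) (b := 1 / 2) (by norm_num) (by norm_num)).ne (congrArg Prod.fst h)

variable {G : Set (S × S')} {C : Set (Set S × Set S')}

theorem State.mesh₂ (h : State G C) (hG : G.Nontrivial) {ε : ℝ} (hε : 0 < ε) :
    ∃ G' C', State G' C' ∧ G ⊆ G' ∧ Refines C' C ∧
      ∀ P ∈ C', (∀ x ∈ P.1, ∀ y ∈ P.1, dist x y < ε) ∧ ∀ x ∈ P.2, ∀ y ∈ P.2, dist x y < ε := by
  obtain ⟨z, hz, w, hw, hzw⟩ := hG
  have n1 : 0 < dist z.1 w.1 := dist_pos.2 fun h' => hzw (h.inj₁ hz hw h')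
  have n2 : 0 < dist z.2 w.2 := dist_pos.2 fun h' => hzw (h.inj₂ hz hw h')
  obtain ⟨G₁, C₁, h₁, hG₁, hC₁, hP₁⟩ := h.mesh (ε := min ε (dist z.1 w.1))
    ⟨_, ⟨z, hz, rfl⟩, _, ⟨w, hw, rfl⟩, min_le_right _ _⟩ (lt_min hε n1)
  obtain ⟨G₂, C₂, h₂, hG₂, hC₂, hP₂⟩ := h₁.swap.mesh (ε := min ε (dist z.2 w.2))
    ⟨_, ⟨_, ⟨z, hG₁ hz, rfl⟩, rfl⟩, _, ⟨_, ⟨w, hG₁ hw, rfl⟩, rfl⟩, min_le_right _ _⟩ (lt_min hε n2)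
  have hC₂' : Refines (Prod.swap '' C₂) C₁ := by
    have := hC₂.swap
    rwa [← image_comp, Prod.swap_swap_eq, image_id] at this
  refine ⟨_, _, h₂.swap, hG₁.trans ?_, hC₂'.trans hC₁, ?_⟩
  · have := image_mono (f := Prod.swap) hG₂
    rwa [← image_comp, Prod.swap_swap_eq, image_id] at this
  · rintro P hP
    constructor
    · obtain ⟨Q, hQ, hPQ, -⟩ := hC₂' P hP
      exact fun x hx y hy => (hP₁ Q hQ x (hPQ hx) y (hPQ hy)).trans_le (min_le_left _ _)
    · obtain ⟨Q, hQ, rfl⟩ := hP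
      exact fun x hx y hy => (hP₂ Q hQ x hx y hy).trans_le (min_le_left _ _)

theorem exists_state_seq (S S' : Type*) [MetricSpace S] [MetricSpace S']
    [Surf S] [CompactSpace S] [ConnectedSpace S] [CocTriv S]
    [Surf S'] [CompactSpace S'] [ConnectedSpace S'] [CocTriv S'] :
    ∃ (G : ℕ → Set (S × S')) (C : ℕ → Set (Set S × Set S')), (∀ n, State (G n) (C n)) ∧
      (∀ n, Refines (C (n + 1)) (C n)) ∧ ∀ n, ∀ P ∈ C (n + 1),
        (∀ x ∈ P.1, ∀ y ∈ P.1, dist x y < 1 / ((n : ℝ) + 1)) ∧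
        ∀ x ∈ P.2, ∀ y ∈ P.2, dist x y < 1 / ((n : ℝ) + 1) := by
  obtain ⟨G₀, C₀, h₀, hG₀⟩ := exists_state S S'
  have step : ∀ (n : ℕ) (p : {p : Set (S × S') × Set (Set S × Set S') //
      State p.1 p.2 ∧ p.1.Nontrivial}), ∃ q : {p : Set (S × S') × Set (Set S × Set S') //
      State p.1 p.2 ∧ p.1.Nontrivial}, Refines q.1.2 p.1.2 ∧ ∀ P ∈ q.1.2,
        (∀ x ∈ P.1, ∀ y ∈ P.1, dist x y < 1 / ((n : ℝ) + 1)) ∧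
        ∀ x ∈ P.2, ∀ y ∈ P.2, dist x y < 1 / ((n : ℝ) + 1) := by
    rintro n ⟨⟨G, C⟩, h, hG⟩
    obtain ⟨G', C', h', hG', hC', hP⟩ := h.mesh₂ hG (ε := 1 / ((n : ℝ) + 1)) (by positivity)
    exact ⟨⟨(G', C'), h', hG.mono hG'⟩, hC', hP⟩
  choose next hnext hnext' using step
  let q := fun n : ℕ => Nat.rec (motive := fun _ => {p : Set (S × S') × Set (Set S × Set S') //
      State p.1 p.2 ∧ p.1.Nontrivial}) ⟨(G₀, C₀), h₀, hG₀⟩ next n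
  exact ⟨fun n => (q n).1.1, fun n => (q n).1.2, fun n => (q n).2.1, fun n => hnext n (q n),
    fun n => hnext' n (q n)⟩

end Initial

section Limit

variable {S S' : Type*} [MetricSpace S] [MetricSpace S']
  {G : Set (S × S')} {C : Set (Set S × Set S')}

theorem State.exists_mem_closure (h : State G C) (x : S) : ∃ P ∈ C, x ∈ closure P.1 := by
  by_cases hx : x ∈ Prod.fst '' G
  · obtain ⟨z, hz, rfl⟩ := hx
    obtain ⟨P, hP, h1, -⟩ := h.cover z hz
    exact ⟨P, hP, frontier_subset_closure h1⟩
  · obtain ⟨P, hP, hxP⟩ := (h.union₁ x).1 hx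
    exact ⟨P, hP, subset_closure hxP⟩

theorem State.exists_common (h : State G C) {P Q : Set S × Set S'} (hP : P ∈ C) (hQ : Q ∈ C)
    {x : S} (hxP : x ∈ closure P.1) (hxQ : x ∈ closure Q.1) :
    (closure P.2 ∩ closure Q.2).Nonempty := by
  obtain ⟨f, hf, hfG, hF, hF'⟩ := h.loop P hP
  obtain ⟨g, hg, hgG, hE, hE'⟩ := h.loop Q hQ
  by_cases hPQ : P = Q
  · obtain ⟨y, hy⟩ := hF'.conn.nonempty
    exact ⟨y, subset_closure hy, hPQ ▸ subset_closure hy⟩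
  have hd := h.disj₁ P hP Q hQ hPQ
  have h1 := (hF.closure_eq ▸ hxP).resolve_left
    (disjoint_left.1 (hd.closure_right hF.isOpen).symm hxQ)
  have h2 := (hE.closure_eq ▸ hxQ).resolve_left
    (disjoint_left.1 (hd.closure_left hE.isOpen) hxP)
  obtain ⟨s, rfl⟩ := h1
  obtain ⟨t, ht⟩ := h2
  have hst : g t = f s := h.inj₁ (hgG ⟨t, rfl⟩) (hfG ⟨s, rfl⟩) ht
  refine ⟨(f s).2, ?_, ?_⟩
  · rw [hF'.closure_eq]; exact Or.inr ⟨s, rfl⟩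
  · rw [hE'.closure_eq]; exact Or.inr ⟨t, congrArg Prod.snd hst⟩

theorem dist_le_of_mem_closure {X : Type*} [MetricSpace X] {A : Set X} {ε : ℝ}
    (h : ∀ x ∈ A, ∀ y ∈ A, dist x y < ε) {x y : X} (hx : x ∈ closure A) (hy : y ∈ closure A) :
    dist x y ≤ ε := by
  have : (x, y) ∈ closure (A ×ˢ A) := closure_prod_eq (s := A) (t := A) ▸ ⟨hx, hy⟩
  exact closure_minimal (t := {p : X × X | dist p.1 p.2 ≤ ε}) (fun p hp => (h _ hp.1 _ hp.2).le)
    (isClosed_le continuous_dist continuous_const) this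

variable [CompactSpace S] [CompactSpace S']

/-- The correspondence defined by a sequence of matching decompositions. -/
def limitGraph (C : ℕ → Set (Set S × Set S')) : Set (S × S') :=
  ⋂ n, ⋃ P ∈ C n, closure P.1 ×ˢ closure P.2

variable {G : ℕ → Set (S × S')} {C : ℕ → Set (Set S × Set S')}

theorem limitGraph_swap : limitGraph (fun n => Prod.swap '' C n) = Prod.swap ⁻¹' limitGraph C := by
  ext z
  simp only [limitGraph, mem_iInter, mem_iUnion, mem_preimage, exists_prop, mem_prod,
    exists_mem_image, Prod.fst_swap, Prod.snd_swap, and_comm (a := z.1 ∈ _)]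

theorem isClosed_limitGraph (h : ∀ n, State (G n) (C n)) : IsClosed (limitGraph C) :=
  isClosed_iInter fun n => (h n).fin.isClosed_biUnion fun _ _ => isClosed_closure.prod isClosed_closure

theorem exists_limitGraph (h : ∀ n, State (G n) (C n)) (hr : ∀ n, Refines (C (n + 1)) (C n))
    (x : S) : ∃ y, (x, y) ∈ limitGraph C := by
  have := IsCompact.nonempty_iInter_of_sequence_nonempty_isCompact_isClosed
    (fun n => {y | ∃ P ∈ C n, x ∈ closure P.1 ∧ y ∈ closure P.2}) (by
      rintro n y ⟨P, hP, h1, h2⟩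
      obtain ⟨Q, hQ, k1, k2⟩ := hr n P hP
      exact ⟨Q, hQ, closure_mono k1 h1, closure_mono k2 h2⟩) (by
      intro n
      obtain ⟨P, hP, hx⟩ := (h n).exists_mem_closure x
      obtain ⟨f, hf, hfG, hF, hF'⟩ := (h n).loop P hP
      obtain ⟨y, hy⟩ := hF'.conn.nonempty
      exact ⟨y, P, hP, hx, subset_closure hy⟩) ?_ ?_
  · obtain ⟨y, hy⟩ := this
    refine ⟨y, mem_iInter.2 fun n => ?_⟩
    obtain ⟨P, hP, h1, h2⟩ := mem_iInter.1 hy n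
    exact mem_biUnion hP ⟨h1, h2⟩
  all_goals
    have key : ∀ n, IsClosed {y | ∃ P ∈ C n, x ∈ closure P.1 ∧ y ∈ closure P.2} := by
      intro n
      have : {y | ∃ P ∈ C n, x ∈ closure P.1 ∧ y ∈ closure P.2} =
          Prod.mk x ⁻¹' ⋃ P ∈ C n, closure P.1 ×ˢ closure P.2 := by
        ext y
        simp only [mem_ofPred_eq, mem_preimage, mem_iUnion, mem_prod, exists_prop]
      rw [this]
      exact ((h n).fin.isClosed_biUnion fun _ _ =>
        isClosed_closure.prod isClosed_closure).preimage (by fun_prop)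
  · exact (key 0).isCompact
  · exact key

theorem limitGraph_unique (h : ∀ n, State (G n) (C n))
    (hd : ∀ n, ∀ P ∈ C (n + 1), ∀ x ∈ P.2, ∀ y ∈ P.2, dist x y < 1 / ((n : ℝ) + 1))
    {x : S} {y y' : S'} (hy : (x, y) ∈ limitGraph C) (hy' : (x, y') ∈ limitGraph C) : y = y' := by
  refine eq_of_forall_dist_le fun ε hε => ?_
  obtain ⟨n, hn⟩ := exists_nat_one_div_lt (half_pos hε)
  obtain ⟨P, hP, h1, h2⟩ := mem_iUnion₂.1 (mem_iInter.1 hy (n + 1))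
  obtain ⟨Q, hQ, k1, k2⟩ := mem_iUnion₂.1 (mem_iInter.1 hy' (n + 1))
  obtain ⟨q, q1, q2⟩ := (h (n + 1)).exists_common hP hQ h1 k1
  have e1 := dist_le_of_mem_closure (hd n P hP) h2 q1
  have e2 := dist_le_of_mem_closure (hd n Q hQ) q2 k2
  linarith [dist_triangle y q y']

theorem nonempty_homeomorph (S S' : Type*) [MetricSpace S] [MetricSpace S']
    [Surf S] [CompactSpace S] [ConnectedSpace S] [CocTriv S]
    [Surf S'] [CompactSpace S'] [ConnectedSpace S'] [CocTriv S'] : Nonempty (S ≃ₜ S') := by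
  obtain ⟨G, C, h, hr, hd⟩ := exists_state_seq S S'
  have hZ : CompactSpace (limitGraph C) :=
    isCompact_iff_compactSpace.1 (isClosed_limitGraph h).isCompact
  have b1 : Function.Bijective fun z : limitGraph C => z.1.1 := by
    refine ⟨?_, fun x => ?_⟩
    · rintro ⟨⟨x, y⟩, hy⟩ ⟨⟨x', y'⟩, hy'⟩ (rfl : x = x')
      have := limitGraph_unique h (fun n P hP => (hd n P hP).2) hy hy'
      subst this
      rfl
    · obtain ⟨y, hy⟩ := exists_limitGraph h hr x
      exact ⟨⟨_, hy⟩, rfl⟩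
  have b2 : Function.Bijective fun z : limitGraph C => z.1.2 := by
    have h' := fun n => (h n).swap
    have hs := limitGraph_swap (C := C)
    refine ⟨?_, fun y => ?_⟩
    · rintro ⟨⟨x, y⟩, hy⟩ ⟨⟨x', y'⟩, hy'⟩ (rfl : y = y')
      have := limitGraph_unique h' (x := y) (y := x) (y' := x') (by
        rintro n _ ⟨P, hP, rfl⟩
        exact (hd n P hP).1) (hs ▸ hy) (hs ▸ hy')
      subst this
      rfl
    · obtain ⟨x, hx⟩ := exists_limitGraph h' (fun n => (hr n).swap) y
      rw [hs] at hx
      exact ⟨⟨_, hx⟩, rfl⟩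
  have c1 : Continuous (Equiv.ofBijective _ b1) := by
    exact continuous_fst.comp continuous_subtype_val
  have c2 : Continuous (Equiv.ofBijective _ b2) := by
    exact continuous_snd.comp continuous_subtype_val
  exact ⟨c1.homeoOfEquivCompactToT2.symm.trans c2.homeoOfEquivCompactToT2⟩

end Limit

section Final

theorem Surf.of_chartedSpace (S : Type*) [TopologicalSpace S]
    [ChartedSpace (EuclideanSpace ℝ (Fin 2)) S] : Surf S where
  chart x U hU := by
    let φ : ℂ ≃ₜ EuclideanSpace ℝ (Fin 2) := Complex.orthonormalBasisOneI.repr.toHomeomorph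
    let e := chartAt (EuclideanSpace ℝ (Fin 2)) x
    have hx : x ∈ e.source := mem_chart_source _ x
    have hV : IsOpen (e.target ∩ e.symm ⁻¹' interior U) := e.isOpen_inter_preimage_symm isOpen_interior
    obtain ⟨r, hr, hrV⟩ := Metric.isOpen_iff.1 (hV.preimage φ.continuous) (φ.symm (e x)) (by
      rw [mem_preimage, φ.apply_symm_apply]
      refine ⟨e.map_source hx, ?_⟩
      rw [mem_preimage, e.left_inv hx]
      exact mem_interior_iff_mem_nhds.2 hU)
    obtain ⟨i, hi, hi0, hir⟩ := exists_embed_ball (φ.symm (e x)) hr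
    have hφi : IsOpenEmbedding (φ ∘ i) := φ.isOpenEmbedding.comp hi
    have hmem : ∀ z, (φ ∘ i) z ∈ e.target ∩ e.symm ⁻¹' interior U := fun z =>
      hrV (hir ▸ mem_range_self z)
    refine ⟨e.symm ∘ φ ∘ i, .of_continuous_injective_isOpenMap ?_ ?_ ?_, ?_, ?_⟩
    · exact e.symm.continuousOn.comp_continuous hφi.continuous fun z => (hmem z).1
    · exact fun z w h => hφi.injective (e.symm.injOn (hmem z).1 (hmem w).1 h)
    · intro W hW
      rw [image_comp]
      refine e.symm.isOpen_image_of_subset_source (hφi.isOpenMap W hW) ?_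
      rintro _ ⟨z, -, rfl⟩
      exact (hmem z).1
    · rw [Function.comp_apply, Function.comp_apply, hi0, φ.apply_symm_apply, e.left_inv hx]
    · rintro _ ⟨z, rfl⟩
      exact interior_subset (hmem z).2

theorem cocTriv_sphere : CocTriv (sphere (0 : EuclideanSpace ℝ (Fin 3)) 1) where
  triv c hc := by
    have : Fact (Module.finrank ℝ (EuclideanSpace ℝ (Fin 3)) = 2 + 1) := ⟨by simp⟩
    have hj : ∀ v : sphere (0 : EuclideanSpace ℝ (Fin 3)) 1,
        IsOpenEmbedding (stereographic' 2 v).symm ∧ range (stereographic' 2 v).symm = {v}ᶜ := by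
      intro v
      have h1 : (stereographic' 2 v).symm.source = univ := stereographic'_target v
      refine ⟨(stereographic' 2 v).symm.isOpenEmbedding h1, ?_⟩
      rw [← image_univ, ← h1, OpenPartialHomeomorph.image_source_eq_target]
      exact stereographic'_source v
    have ht : ∀ v : sphere (0 : EuclideanSpace ℝ (Fin 3)) 1, Triv c {v}ᶜ := by
      intro v
      obtain ⟨h1, h2⟩ := hj v
      rw [← h2, ← image_univ]
      refine Triv.push h1.isEmbedding (triv_starConvex isOpen_univ (mem_univ 0) ?_
        (hc.pull h1.continuous fun _ _ => mem_univ _))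
      exact convex_univ.starConvex (mem_univ 0)
    obtain ⟨v⟩ : Nonempty (sphere (0 : EuclideanSpace ℝ (Fin 3)) 1) :=
      (NormedSpace.sphere_nonempty.2 zero_le_one).to_subtype
    obtain ⟨h1, h2⟩ := hj v
    have hv : v ≠ -v := ne_neg_of_mem_unit_sphere ℝ v
    obtain ⟨z, hz⟩ : -v ∈ range (stereographic' 2 v).symm := by
      rw [h2]
      exact hv.symm
    have hI : ({v}ᶜ ∩ {-v}ᶜ : Set (sphere (0 : EuclideanSpace ℝ (Fin 3)) 1)) =
        (stereographic' 2 v).symm '' {z}ᶜ := by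
      rw [← h2, compl_eq_univ_sdiff {z}, image_sdiff h1.injective, image_univ, image_singleton, hz,
        sdiff_eq]
    have := Triv.open_glue isOpen_compl_singleton isOpen_compl_singleton (ht v) (ht (-v)) (by
      rw [hI]
      refine IsPreconnected.image ?_ _ h1.continuous.continuousOn
      refine (isConnected_compl_singleton_of_one_lt_rank ?_ z).isPreconnected
      rw [← Module.finrank_eq_rank]
      simp)
    refine this.mono fun y _ => ?_
    by_cases hy : y = v
    · exact Or.inr (hy ▸ hv)
    · exact Or.inl hy

end Final

/-- **Example.**  Let `S` be a closed surface (a compact connected topological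
`2`-manifold without boundary) not homeomorphic to the `2`-sphere.  Then its
fundamental group is surface-like: there are classes `α, β ∈ H¹(π₁(S); ℤ/2)` with
`α ∪ β ≠ 0` in `H²(π₁(S); ℤ/2)`. -/
theorem isSurfaceLike_surface_group (S : Type) [TopologicalSpace S] [CompactSpace S]
    [ConnectedSpace S] [T2Space S] [ChartedSpace (EuclideanSpace ℝ (Fin 2)) S]
    (hS : IsEmpty (S ≃ₜ ↥(Metric.sphere (0 : EuclideanSpace ℝ (Fin 3)) 1)))
    (x : S) :
    IsSurfaceLike (FundamentalGroup S x) := by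
  have hSurf : Surf S := Surf.of_chartedSpace S
  have hsc : SecondCountableTopology S :=
    ChartedSpace.secondCountable_of_sigmaCompact (EuclideanSpace ℝ (Fin 2)) S
  obtain ⟨m, hm⟩ : ∃ m : MetricSpace S,
      m.toUniformSpace.toTopologicalSpace = ‹TopologicalSpace S› :=
    ⟨TopologicalSpace.metrizableSpaceMetric S, rfl⟩
  subst hm
  by_contra hn
  have hfin : Fact (Module.finrank ℝ (EuclideanSpace ℝ (Fin 3)) = 2 + 1) := ⟨by simp⟩
  have s1 : Surf (sphere (0 : EuclideanSpace ℝ (Fin 3)) 1) := Surf.of_chartedSpace _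
  have s2 := cocTriv_sphere
  have s3 : ConnectedSpace (sphere (0 : EuclideanSpace ℝ (Fin 3)) 1) :=
    isConnected_iff_connectedSpace.1 (isConnected_sphere (by
      rw [← Module.finrank_eq_rank]
      simp) 0 zero_le_one)
  have s4 : CocTriv S := ⟨fun c hc => triv_of_cup hc fun d hd =>
    exists_cup_of_not_surfaceLike (x₀ := x) (fun φ ψ hφ hψ => by
      by_contra! hf
      exact hn ⟨φ, ψ, hφ, hψ, hf⟩) hc hd⟩
  obtain ⟨e⟩ := nonempty_homeomorph S (sphere (0 : EuclideanSpace ℝ (Fin 3)) 1)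
  exact hS.false e
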